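/- arXiv:2004.13018 — 5 statements merged into one kernel-verified Lean document; each statement's English description precedes it below -/
import Mathlib

section
/- (Exchange Property, Theorem 4.2, with the explicit constant from its proof.) Let S, T ∈ ℐ be index pairs of two k×k submatrices of A with S ≠ T. Then |det(A_S)| · |det(A_T)| ≤ (2k² + 8k) · max { |det(A_{S Δ U})| · |det(A_{T Δ U})| : U ∈ ℰ(S,T) }. -/
open Finset

/-- The determinant of the square submatrix of `A` with rows `R` (in increasing order)
and columns `C` (in increasing order); junk value `0` if `R.card ≠ C.card`. -/
noncomputable def subdet {m n : ℕ} (A : Matrix (Fin m) (Fin n) ℝ)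
    (R : Finset (Fin m)) (C : Finset (Fin n)) : ℝ :=
  if h : R.card = C.card then
    (A.submatrix (R.orderEmbOfFin rfl) (C.orderEmbOfFin h.symm)).det
  else 0

section LinearAlgebra
open Matrix

lemma det_updateCol_eq_det_mul {K : Type*} [Fintype K] [DecidableEq K]
    (F G : Matrix K K ℝ) (hF : F.det ≠ 0) (p q : K) :
    (F.updateCol p (G.col q)).det = F.det * (F⁻¹ * G) p q := by
  have hu : IsUnit F.det := hF.isUnit
  have h : G.col q = F *ᵥ ((F⁻¹ * G).col q) := by
    ext i
    change G i q = (F * (F⁻¹ * G)) i q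
    rw [mul_nonsing_inv_cancel_left _ _ hu]
  rw [h, ← cramer_apply, cramer_eq_adjugate_mulVec, mulVec_mulVec, adjugate_mul, smul_mulVec,
    one_mulVec]
  rfl

lemma det_updateCol_updateCol_eq_det_mul {K : Type*} [Fintype K] [DecidableEq K]
    (F G : Matrix K K ℝ) (hF : F.det ≠ 0) {p p' : K} (hp : p ≠ p') (q q' : K) :
    ((F.updateCol p (G.col q)).updateCol p' (G.col q')).det =
      F.det * ((F⁻¹ * G) p q * (F⁻¹ * G) p' q' - (F⁻¹ * G) p q' * (F⁻¹ * G) p' q) := by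
  have hu : IsUnit F.det := hF.isUnit
  set M := F⁻¹ * G with hM
  have hG : G = F * M := by rw [hM, mul_nonsing_inv_cancel_left _ _ hu]
  let L : Matrix K (Fin 2) ℝ := of fun i j =>
    ![M i q - (1 : Matrix K K ℝ) i p, M i q' - (1 : Matrix K K ℝ) i p'] j
  let N : Matrix (Fin 2) K ℝ := of fun j i =>
    ![(1 : Matrix K K ℝ) p i, (1 : Matrix K K ℝ) p' i] j
  have h : (F.updateCol p (G.col q)).updateCol p' (G.col q') = F * (1 + L * N) := by
    rw [hG, mul_add, mul_one, ← Matrix.mul_assoc F L N]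
    ext i j
    have h0 : (F * L) i 0 = (F * M) i q - F i p := by
      simp [L, mul_apply, mul_sub, one_apply]
    have h1 : (F * L) i 1 = (F * M) i q' - F i p' := by
      simp [L, mul_apply, mul_sub, one_apply]
    rw [Matrix.add_apply, mul_apply (M := F * L), Fin.sum_univ_two, h0, h1]
    by_cases hj' : j = p'
    · subst hj'
      simp [N, one_apply, hp]
    · by_cases hj : j = p
      · subst hj
        simp [N, one_apply, hp, hp.symm]
      · simp [N, one_apply, hj, hj', Ne.symm hj, Ne.symm hj']
  rw [h, det_mul, det_one_add_mul_comm, det_fin_two]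
  simp [L, N, mul_apply, one_apply, hp, hp.symm]

lemma sum_mul_minors_eq_trace {D₁ D₂ : Type*} [Fintype D₁] [Fintype D₂]
    (P P' : Matrix D₁ D₁ ℝ) (Q Q' : Matrix D₁ D₂ ℝ) (R R' : Matrix D₂ D₁ ℝ)
    (W W' : Matrix D₂ D₂ ℝ) :
    ∑ a, ∑ x, ∑ b, ∑ y, (P a x * W b y - Q a y * R b x) * (P' x a * W' y b - Q' x b * R' y a) =
      (P * P').trace * (W * W').trace + (Q * R').trace * (R * Q').trace
        - (P * (Q' * (W * R'))).trace - (Q * (W' * (R * P'))).trace := by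
  have h1 : (P * P').trace * (W * W').trace =
      ∑ a, ∑ x, ∑ b, ∑ y, P a x * P' x a * (W b y * W' y b) := by
    simp only [trace, diag_apply, mul_apply, Finset.sum_mul]
    simp only [Finset.mul_sum]
  have h2 : (Q * R').trace * (R * Q').trace =
      ∑ a, ∑ x, ∑ b, ∑ y, Q a y * R' y a * (R b x * Q' x b) := by
    simp only [trace, diag_apply, mul_apply, Finset.sum_mul]
    simp only [Finset.mul_sum]
    refine Finset.sum_congr rfl fun a _ => ?_
    rw [Finset.sum_comm]
    conv_lhs => enter [2, b]; rw [Finset.sum_comm]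
    rw [Finset.sum_comm]
  have h3 : (P * (Q' * (W * R'))).trace =
      ∑ a, ∑ x, ∑ b, ∑ y, P a x * (Q' x b * (W b y * R' y a)) := by
    simp only [trace, diag_apply, mul_apply, Finset.mul_sum]
  have h4 : (Q * (W' * (R * P'))).trace =
      ∑ a, ∑ x, ∑ b, ∑ y, Q a y * (W' y b * (R b x * P' x a)) := by
    simp only [trace, diag_apply, mul_apply, Finset.mul_sum]
    refine Finset.sum_congr rfl fun a _ => ?_
    rw [Finset.sum_comm]
    conv_lhs => enter [2, b]; rw [Finset.sum_comm]
    rw [Finset.sum_comm]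
  rw [h1, h2, h3, h4]
  simp only [← Finset.sum_add_distrib, ← Finset.sum_sub_distrib]
  refine Finset.sum_congr rfl fun a _ => Finset.sum_congr rfl fun x _ =>
    Finset.sum_congr rfl fun b _ => Finset.sum_congr rfl fun y _ => ?_
  ring

lemma abs_sum_sum_le {α β : Type*} [Fintype α] [Fintype β] (t : α → β → ℝ) (δ : ℝ)
    (ht : ∀ a b, |t a b| ≤ δ) :
    |∑ a, ∑ b, t a b| ≤ Fintype.card α * (Fintype.card β * δ) := by
  refine (Finset.abs_sum_le_sum_abs _ _).trans ((Finset.sum_le_card_nsmul _ _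
    (Fintype.card β * δ) fun a _ => ?_).trans_eq (by simp))
  exact (Finset.abs_sum_le_sum_abs _ _).trans ((Finset.sum_le_card_nsmul _ _ δ
    fun b _ => ht a b).trans_eq (by simp))

/-- Among the same-block entries and `2 × 2` minors pairing same-block indices, one has a large
product with the matching entry or minor of the inverse matrix. -/
lemma exists_large_minor_mul_minor {D₁ D₂ : Type*} [Fintype D₁] [Fintype D₂] [DecidableEq D₁]
    [DecidableEq D₂] (M X : Matrix (D₁ ⊕ D₂) (D₁ ⊕ D₂) ℝ) (hMX : M * X = 1)
    [Nonempty (D₁ ⊕ D₂)] (k : ℕ) (h₁ : Fintype.card D₁ ≤ k) (h₂ : Fintype.card D₂ ≤ k) :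
    (∃ p q, p.isLeft = q.isLeft ∧ 1 ≤ (2 * (k : ℝ) ^ 2 + 8 * k) * |M p q * X q p|) ∨
    ∃ p p' q q', p.isLeft = q.isLeft ∧ p'.isLeft = q'.isLeft ∧
      1 ≤ (2 * (k : ℝ) ^ 2 + 8 * k) *
        |(M p q * M p' q' - M p q' * M p' q) * (X q p * X q' p' - X q p' * X q' p)| := by
  by_contra! hcon
  obtain ⟨hc1, hc2⟩ := hcon
  have hpos : 0 < Fintype.card D₁ + Fintype.card D₂ := by
    rw [← Fintype.card_sum]; exact Fintype.card_pos
  have hk : (1 : ℝ) ≤ k := by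
    have : 1 ≤ k := by omega
    exact_mod_cast this
  set c : ℝ := 2 * (k : ℝ) ^ 2 + 8 * k with hc
  have hc0 : 0 < c := by positivity
  have hXM : X * M = 1 := mul_eq_one_comm.mp hMX
  set P := M.toBlocks₁₁
  set Q := M.toBlocks₁₂
  set R := M.toBlocks₂₁
  set W := M.toBlocks₂₂
  set P' := X.toBlocks₁₁
  set Q' := X.toBlocks₁₂
  set R' := X.toBlocks₂₁
  set W' := X.toBlocks₂₂
  have hM : M = fromBlocks P Q R W := (fromBlocks_toBlocks M).symm
  have hX : X = fromBlocks P' Q' R' W' := (fromBlocks_toBlocks X).symm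
  have e1 : fromBlocks P Q R W * fromBlocks P' Q' R' W' = fromBlocks 1 0 0 1 := by
    rw [← hM, ← hX, hMX, fromBlocks_one]
  have e2 : fromBlocks P' Q' R' W' * fromBlocks P Q R W = fromBlocks 1 0 0 1 := by
    rw [← hM, ← hX, hXM, fromBlocks_one]
  rw [fromBlocks_multiply, fromBlocks_inj] at e1 e2
  obtain ⟨a1, a2, a3, a4⟩ := e1
  obtain ⟨-, -, -, b4⟩ := e2
  have hPP : P * P' = 1 - Q * R' := eq_sub_of_add_eq a1
  have hPQ : P * Q' = -(Q * W') := eq_neg_of_add_eq_zero_left a2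
  have hRP : R * P' = -(W * R') := eq_neg_of_add_eq_zero_left a3
  have hRQ : R * Q' = 1 - W * W' := eq_sub_of_add_eq a4
  have hWW : W' * W = 1 - R' * Q := eq_sub_of_add_eq' b4
  set r : ℝ := (Fintype.card D₁ : ℝ) with hr
  set s : ℝ := (Fintype.card D₂ : ℝ) with hs
  set z := (Q * R').trace with hz
  set w := (Q * R' * (Q * R')).trace with hw
  have t1 : (P * P').trace = r - z := by rw [hPP, trace_sub, trace_one]
  have t2 : (W * W').trace = s - z := by
    rw [trace_mul_comm, hWW, trace_sub, trace_one, trace_mul_comm R' Q]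
  have t3 : (R * Q').trace = z := by rw [hRQ, trace_sub, trace_one, t2]; ring
  have t4 : (P * (P' * (P * P'))).trace = r - 2 * z + w := by
    rw [← Matrix.mul_assoc, hPP]
    simp only [sub_mul, mul_sub, mul_one, one_mul, trace_sub, trace_one]
    rw [← hz, ← hw]; ring
  have t5 : (W * (W' * (W * W'))).trace = s - 2 * z + w := by
    rw [trace_mul_comm, Matrix.mul_assoc, Matrix.mul_assoc, ← Matrix.mul_assoc W' W, hWW]
    simp only [sub_mul, mul_sub, mul_one, one_mul, trace_sub, trace_one]
    rw [trace_mul_comm R' Q, ← hz, Matrix.mul_assoc, trace_mul_comm R', hw]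
    simp only [Matrix.mul_assoc]; ring
  have t6 : (Q * (W' * (W * R'))).trace = z - w := by
    rw [← Matrix.mul_assoc W' W, hWW]
    rw [Matrix.sub_mul, Matrix.mul_sub, Matrix.one_mul, trace_sub]
    rw [← hz, hw]
    simp only [Matrix.mul_assoc]
  have t7 : (P * (Q' * (W * R'))).trace = w - z := by
    rw [← Matrix.mul_assoc, hPQ, Matrix.neg_mul, trace_neg, Matrix.mul_assoc, t6]; ring
  have t8 : (Q * (W' * (R * P'))).trace = w - z := by
    rw [hRP, Matrix.mul_neg, Matrix.mul_neg, trace_neg, t6]; ring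
  have hδ : ∀ t : ℝ, c * t < 1 → t ≤ c⁻¹ := fun t ht => by
    rw [← one_div, le_div_iff₀ hc0]; linarith
  have bP : |r - z| ≤ r * (r * c⁻¹) := by
    rw [← t1]
    simp only [trace, diag_apply, mul_apply]
    exact abs_sum_sum_le _ _ fun a x => hδ _ (hc1 (.inl a) (.inl x) rfl)
  have bW : |s - z| ≤ s * (s * c⁻¹) := by
    rw [← t2]
    simp only [trace, diag_apply, mul_apply]
    exact abs_sum_sum_le _ _ fun a x => hδ _ (hc1 (.inr a) (.inr x) rfl)
  have hr0 : 0 ≤ r := by positivity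
  have hs0 : 0 ≤ s := by positivity
  have hrk : r ≤ k := Nat.cast_le.mpr h₁
  have hsk : s ≤ k := Nat.cast_le.mpr h₂
  have hi0 : 0 < c⁻¹ := inv_pos.mpr hc0
  have hic : c * c⁻¹ = 1 := mul_inv_cancel₀ hc0.ne'
  by_cases hrs : Fintype.card D₁ = Fintype.card D₂
  · have hrs' : s = r := by rw [hs, hr, hrs]
    have hr1 : 1 ≤ r := by
      have : 1 ≤ Fintype.card D₁ := by omega
      rw [hr]; exact_mod_cast this
    have sM := sum_mul_minors_eq_trace P P' Q Q' R R' W W'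
    have sP := sum_mul_minors_eq_trace P P' P P' P P' P P'
    have sW := sum_mul_minors_eq_trace W W' W W' W W' W W'
    rw [t1, t2, t3, t7, t8, ← hz] at sM
    rw [t1, t4] at sP
    rw [t2, t5] at sW
    have cM := abs_sum_sum_le (fun a x => ∑ b, ∑ y,
      (P a x * W b y - Q a y * R b x) * (P' x a * W' y b - Q' x b * R' y a)) (s * (s * c⁻¹))
      fun a x => abs_sum_sum_le _ _ fun b y =>
        hδ _ (hc2 (.inl a) (.inr b) (.inl x) (.inr y) rfl rfl)
    have cP := abs_sum_sum_le (fun a x => ∑ b, ∑ y,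
      (P a x * P b y - P a y * P b x) * (P' x a * P' y b - P' x b * P' y a)) (r * (r * c⁻¹))
      fun a x => abs_sum_sum_le _ _ fun b y =>
        hδ _ (hc2 (.inl a) (.inl b) (.inl x) (.inl y) rfl rfl)
    have cW := abs_sum_sum_le (fun a x => ∑ b, ∑ y,
      (W a x * W b y - W a y * W b x) * (W' x a * W' y b - W' x b * W' y a)) (s * (s * c⁻¹))
      fun a x => abs_sum_sum_le _ _ fun b y =>
        hδ _ (hc2 (.inr a) (.inr b) (.inr x) (.inr y) rfl rfl)
    rw [sM, ← hr] at cM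
    rw [sP, ← hr] at cP
    rw [sW, ← hs] at cW
    rw [hrs'] at cM cW bW
    have cM' := (abs_le.mp cM).2
    have cP' := (abs_le.mp cP).1
    have cW' := (abs_le.mp cW).1
    have bP' := mul_le_mul_of_nonneg_left (abs_le.mp bP).2 (sub_nonneg.mpr hr1)
    have bound : r ^ 2 ≤ r ^ 2 * ((2 * r ^ 2 + 2 * r - 2) * c⁻¹) := by
      linarith only [cM', cP', cW', bP']
    have hlt : (2 * r ^ 2 + 2 * r - 2) * c⁻¹ < 1 := by
      rw [← hic]
      have := pow_le_pow_left₀ hr0 hrk 2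
      exact mul_lt_mul_of_pos_right (by linarith only [this, hrk, hk, hc]) hi0
    have := mul_lt_mul_of_pos_left hlt (pow_pos (lt_of_lt_of_le one_pos hr1) 2)
    linarith only [this, bound]
  · have habs : 1 ≤ |r - s| := by
      have : (1 : ℤ) ≤ |(Fintype.card D₁ : ℤ) - Fintype.card D₂| :=
        Int.one_le_abs (by omega)
      rw [hr, hs]; exact_mod_cast this
    have h3 : |r - s| ≤ |r - z| + |s - z| := by
      have := abs_sub (r - z) (s - z)
      rwa [sub_sub_sub_cancel_right] at this
    have h4 : (r ^ 2 + s ^ 2) * c⁻¹ < 1 := by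
      rw [← hic]
      have := pow_le_pow_left₀ hr0 hrk 2
      have := pow_le_pow_left₀ hs0 hsk 2
      exact mul_lt_mul_of_pos_right (by linarith) hi0
    linarith only [habs, h3, h4, bP, bW]

end LinearAlgebra

section Frames
open Matrix Function

lemma abs_det_submatrix_fromCols_eq_abs_subdet {m n : ℕ} (A : Matrix (Fin m) (Fin n) ℝ)
    {K : Type*} [Fintype K] [DecidableEq K] (e : K ≃ Fin m) {h : K → Fin m ⊕ Fin n}
    (hinj : Injective h) {R : Finset (Fin m)} {C : Finset (Fin n)}
    (himg : univ.image h = Rᶜ.disjSum C) :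
    |((fromCols 1 A).submatrix e h).det| = |subdet A R C| := by
  have hcard : R.card = C.card := by
    have h1 : (univ.image h).card = m := by
      rw [card_image_of_injective _ hinj, card_univ, Fintype.card_congr e, Fintype.card_fin]
    rw [himg, card_disjSum, card_compl, Fintype.card_fin] at h1
    have h2 := card_le_univ R
    rw [Fintype.card_fin] at h2
    omega
  let ρ : Fin R.card ⊕ {x // x ∉ R} ≃ Fin m :=
    (Equiv.sumCongr (R.orderIsoOfFin rfl).toEquiv (Equiv.refl _)).trans (Equiv.sumCompl (· ∈ R))
  let γ : Fin R.card ⊕ {x // x ∉ R} → Fin m ⊕ Fin n :=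
    Sum.elim (fun j => Sum.inr (C.orderEmbOfFin hcard.symm j)) fun x => Sum.inl x.1
  have hγ : Injective γ := by
    refine Injective.sumElim (Sum.inr_injective.comp (C.orderEmbOfFin hcard.symm).injective)
      (Sum.inl_injective.comp Subtype.val_injective) ?_
    intro a b
    exact Sum.inr_ne_inl
  have hrange : Set.range γ = Set.range h := by
    have h1 : Set.range h = ((univ.image h : Finset (Fin m ⊕ Fin n)) : Set (Fin m ⊕ Fin n)) := by
      simp
    have h2 : ∀ c, (∃ j, C.orderEmbOfFin hcard.symm j = c) ↔ c ∈ C := fun c => by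
      rw [← Set.mem_range, range_orderEmbOfFin, mem_coe]
    rw [h1, himg]
    ext x
    rcases x with x | x
    · simp [γ]
    · simp [γ, h2]
  let κ : Fin R.card ⊕ {x // x ∉ R} ≃ K := (Equiv.ofInjective γ hγ).trans
    ((Equiv.setCongr hrange).trans (Equiv.ofInjective h hinj).symm)
  have hκ : ∀ x, h (κ x) = γ x := fun x => by
    simp only [κ, Equiv.trans_apply, Equiv.apply_ofInjective_symm]
    rfl
  rw [← abs_det_submatrix_equiv_equiv (ρ.trans e.symm) κ, subdet, dif_pos hcard]
  have hblock : ((fromCols 1 A).submatrix e h).submatrix (ρ.trans e.symm) κ =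
      fromBlocks (A.submatrix (R.orderEmbOfFin rfl) (C.orderEmbOfFin hcard.symm)) 0
        (A.submatrix Subtype.val (C.orderEmbOfFin hcard.symm)) 1 := by
    ext i j
    simp only [submatrix_apply, hκ, Equiv.trans_apply, Equiv.apply_symm_apply]
    rcases i with i | i <;> rcases j with j | j
    · simp [ρ, γ]
    · have : R.orderEmbOfFin rfl i ≠ j.1 := fun hij => j.2 (hij ▸ orderEmbOfFin_mem R rfl i)
      simp [ρ, γ, one_apply, this]
    · simp [ρ, γ]
    · simp [ρ, γ, one_apply, Subtype.ext_iff]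
  rw [hblock, det_fromBlocks_zero₁₂, det_one, mul_one]

lemma updateCol_submatrix_eq_submatrix_update {l o K ι : Type*} [DecidableEq K]
    (B : Matrix l ι ℝ) (e : o → l) (h : K → ι) (p : K) (x : ι) :
    (B.submatrix e h).updateCol p (fun i => B (e i) x) = B.submatrix e (update h p x) := by
  ext i j
  by_cases hj : j = p
  · subst hj; simp
  · simp [hj]

lemma injective_update_of_notMem_image {K ι : Type*} [Fintype K] [DecidableEq K] [DecidableEq ι]
    {h : K → ι} (hinj : Injective h) {x : ι} (hx : x ∉ univ.image h) (p : K) :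
    Injective (update h p x) := by
  have hx' : ∀ j, h j ≠ x := fun j hj => hx (mem_image.mpr ⟨j, mem_univ _, hj⟩)
  intro i j hij
  by_cases hi : i = p <;> by_cases hj : j = p
  · rw [hi, hj]
  · subst hi
    simp [hj] at hij
    exact absurd hij.symm (hx' j)
  · subst hj
    simp [hi] at hij
    exact absurd hij (hx' i)
  · simp [hi, hj] at hij
    exact hinj hij

lemma image_update_eq_insert_erase {K ι : Type*} [Fintype K] [DecidableEq K] [DecidableEq ι]
    {h : K → ι} (hinj : Injective h) (x : ι) (p : K) :
    univ.image (update h p x) = insert x ((univ.image h).erase (h p)) := by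
  ext y
  simp only [mem_image, mem_univ, true_and, mem_insert, mem_erase]
  constructor
  · rintro ⟨j, rfl⟩
    by_cases hj : j = p
    · subst hj; simp
    · right
      simp only [update_of_ne hj]
      exact ⟨fun h' => hj (hinj h'), j, rfl⟩
  · rintro (rfl | ⟨hy, j, rfl⟩)
    · exact ⟨p, by simp⟩
    · exact ⟨j, update_of_ne (fun h' => hy (congrArg h h')) _ _⟩

lemma disjSum_symmDiff_union_eq {α β : Type*} [Fintype α] [DecidableEq α] [DecidableEq β]
    {R : Finset α} {C : Finset β} {X Y : Finset (α ⊕ β)}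
    (hX : X ⊆ Rᶜ.disjSum C) (hY : Disjoint Y (Rᶜ.disjSum C)) :
    (symmDiff R (X ∪ Y).toLeft)ᶜ.disjSum (symmDiff C (X ∪ Y).toRight) =
      (Rᶜ.disjSum C \ X) ∪ Y := by
  rw [disjoint_left] at hY
  ext z
  rcases z with z | z
  · have h1 := @hX (.inl z)
    have h2 := @hY (.inl z)
    simp only [inl_mem_disjSum, mem_compl, mem_union, mem_sdiff, mem_symmDiff, mem_toLeft]
      at h1 h2 ⊢
    tauto
  · have h1 := @hX (.inr z)
    have h2 := @hY (.inr z)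
    simp only [inr_mem_disjSum, mem_union, mem_sdiff, mem_symmDiff, mem_toRight] at h1 h2 ⊢
    tauto

lemma pivot_submatrix_mul_pivot_submatrix {D E : Type*} [Fintype D] [Fintype E] [DecidableEq D]
    [DecidableEq E] (F G : Matrix (D ⊕ E) (D ⊕ E) ℝ) (hF : F.det ≠ 0) (hG : G.det ≠ 0)
    (h : ∀ i x, F i (.inr x) = G i (.inr x)) :
    (F⁻¹ * G).submatrix Sum.inl Sum.inl * (G⁻¹ * F).submatrix Sum.inl Sum.inl =
      (1 : Matrix D D ℝ) := by
  have h1 : (F⁻¹ * G) * (G⁻¹ * F) = 1 := by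
    rw [Matrix.mul_assoc, mul_nonsing_inv_cancel_left _ _ hG.isUnit,
      nonsing_inv_mul _ hF.isUnit]
  have h2 : ∀ p x, (F⁻¹ * G) (.inl p) (.inr x) = 0 := fun p x => by
    have : (F⁻¹ * G) (.inl p) (.inr x) = (F⁻¹ * F) (.inl p) (.inr x) := by
      simp only [mul_apply, h]
    rw [this, nonsing_inv_mul _ hF.isUnit]
    simp
  ext p q
  have h3 := congr_fun (congr_fun h1 (.inl p)) (.inl q)
  rw [mul_apply, Fintype.sum_sum_type] at h3
  simp only [h2, zero_mul, sum_const_zero, add_zero] at h3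
  rw [mul_apply]
  simpa [one_apply] using h3

/-- The part `U` of the symmetric difference consisting of `X ⊆ Z_S \ Z_T` and `Y ⊆ Z_T \ Z_S`,
where `Z` encodes an index pair by its complementary rows and its columns, is balanced. -/
lemma union_isBalanced {α β : Type*} [Fintype α] [DecidableEq α] [DecidableEq β]
    {SR TR : Finset α} {SC TC : Finset β} {X Y : Finset (α ⊕ β)}
    (hX : X ⊆ SRᶜ.disjSum SC \ TRᶜ.disjSum TC) (hY : Y ⊆ TRᶜ.disjSum TC \ SRᶜ.disjSum SC)
    (hleft : X.toLeft.card = Y.toLeft.card) (hcard : X.card = Y.card) :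
    (X ∪ Y).toLeft ⊆ symmDiff SR TR ∧ (X ∪ Y).toRight ⊆ symmDiff SC TC ∧
      ((X ∪ Y).toLeft ∩ SR).card = ((X ∪ Y).toLeft \ SR).card ∧
      ((X ∪ Y).toRight ∩ SC).card = ((X ∪ Y).toRight \ SC).card ∧
      (X ∪ Y).toLeft.card + (X ∪ Y).toRight.card = 2 * X.card := by
  have hright : X.toRight.card = Y.toRight.card := by
    have h1 := card_toLeft_add_card_toRight (u := X)
    have h2 := card_toLeft_add_card_toRight (u := Y)
    omega
  have hXl : ∀ a, .inl a ∈ X → a ∉ SR ∧ a ∈ TR := fun a ha => by simpa using hX ha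
  have hYl : ∀ a, .inl a ∈ Y → a ∉ TR ∧ a ∈ SR := fun a ha => by simpa using hY ha
  have hXr : ∀ a, .inr a ∈ X → a ∈ SC ∧ a ∉ TC := fun a ha => by simpa using hX ha
  have hYr : ∀ a, .inr a ∈ Y → a ∈ TC ∧ a ∉ SC := fun a ha => by simpa using hY ha
  have e1 : (X ∪ Y).toLeft ∩ SR = Y.toLeft := by
    ext a
    have := hXl a
    have := hYl a
    simp only [mem_inter, mem_toLeft, mem_union]
    tauto
  have e2 : (X ∪ Y).toLeft \ SR = X.toLeft := by
    ext a
    have := hXl a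
    have := hYl a
    simp only [mem_sdiff, mem_toLeft, mem_union]
    tauto
  have e3 : (X ∪ Y).toRight ∩ SC = X.toRight := by
    ext a
    have := hXr a
    have := hYr a
    simp only [mem_inter, mem_toRight, mem_union]
    tauto
  have e4 : (X ∪ Y).toRight \ SC = Y.toRight := by
    ext a
    have := hXr a
    have := hYr a
    simp only [mem_sdiff, mem_toRight, mem_union]
    tauto
  refine ⟨fun a ha => ?_, fun a ha => ?_, by rw [e1, e2, hleft], by rw [e3, e4, hright], ?_⟩
  · have := hXl a
    have := hYl a
    simp only [mem_symmDiff, mem_toLeft, mem_union] at ha ⊢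
    tauto
  · have := hXr a
    have := hYr a
    simp only [mem_symmDiff, mem_toRight, mem_union] at ha ⊢
    tauto
  · have hdisj : Disjoint X Y := disjoint_left.mpr fun z hz hz' =>
      (mem_sdiff.mp (hY hz')).2 (mem_sdiff.mp (hX hz)).1
    rw [card_toLeft_add_card_toRight, card_union_of_disjoint hdisj]
    omega

/-- The two differences of the sets encoding a pair of index pairs have enumerations by a common
type that keep rows on the left and columns on the right. -/
lemma exists_enumerations {α β : Type*} [Fintype α] [DecidableEq α] [DecidableEq β]
    {SR TR : Finset α} {SC TC : Finset β} (hR : SR.card = TR.card) (hC : SC.card = TC.card) :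
    ∃ f g : {x // x ∈ TR \ SR} ⊕ {x // x ∈ SC \ TC} → α ⊕ β, Injective f ∧ Injective g ∧
      univ.image f = SRᶜ.disjSum SC \ TRᶜ.disjSum TC ∧
      univ.image g = TRᶜ.disjSum TC \ SRᶜ.disjSum SC ∧
      (∀ p, (f p).isLeft = p.isLeft) ∧ ∀ p, (g p).isLeft = p.isLeft := by
  let ε : {x // x ∈ TR \ SR} ≃ {x // x ∈ SR \ TR} :=
    equivOfCardEq (card_sdiff_comm hR.symm)
  let η : {x // x ∈ SC \ TC} ≃ {x // x ∈ TC \ SC} :=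
    equivOfCardEq (card_sdiff_comm hC)
  refine ⟨Sum.map Subtype.val Subtype.val, Sum.map (Subtype.val ∘ ε) (Subtype.val ∘ η),
    Sum.map_injective.mpr ⟨Subtype.val_injective, Subtype.val_injective⟩,
    Sum.map_injective.mpr ⟨Subtype.val_injective.comp ε.injective,
      Subtype.val_injective.comp η.injective⟩, ?_, ?_, by simp, by simp⟩
  · ext z
    rcases z with z | z <;> simp [and_comm]
  · have hε : ∀ z, (∃ a, (ε a).1 = z) ↔ z ∉ TR ∧ z ∈ SR := fun z => by
      rw [and_comm, ← mem_sdiff]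
      exact ⟨by rintro ⟨a, rfl⟩; exact (ε a).2, fun hz => ⟨ε.symm ⟨z, hz⟩, by simp⟩⟩
    have hη : ∀ z, (∃ a, (η a).1 = z) ↔ z ∈ TC ∧ z ∉ SC := fun z => by
      rw [← mem_sdiff]
      exact ⟨by rintro ⟨a, rfl⟩; exact (η a).2, fun hz => ⟨η.symm ⟨z, hz⟩, by simp⟩⟩
    ext z
    rcases z with z | z
    · simpa only [mem_image, mem_univ, true_and, Sum.exists, Sum.map_inl, Sum.map_inr,
        Function.comp_apply, Sum.inl.injEq, reduceCtorEq, exists_false, or_false, mem_sdiff, inl_mem_disjSum,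
        mem_compl, not_not] using hε z
    · simpa only [mem_image, mem_univ, true_and, Sum.exists, Sum.map_inl, Sum.map_inr,
        Function.comp_apply, Sum.inr.injEq, reduceCtorEq, exists_false, false_or, mem_sdiff, inr_mem_disjSum]
        using hη z

lemma image_sumElim_coe_eq {D ι : Type*} [Fintype D] [DecidableEq ι] {Z Z' : Finset ι}
    {f : D → ι} (hf : univ.image f = Z \ Z') :
    univ.image (Sum.elim f (Subtype.val : {x // x ∈ Z ∩ Z'} → ι)) = Z := by
  ext z
  have hz : (∃ a, f a = z) ↔ z ∈ Z \ Z' := by rw [← hf]; simp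
  simp only [mem_image, mem_univ, true_and, Sum.exists, Sum.elim_inl, Sum.elim_inr, hz,
    Subtype.exists, exists_prop, exists_eq_right, mem_sdiff, mem_inter]
  tauto

lemma injective_sumElim_coe {D ι : Type*} [Fintype D] [DecidableEq ι] {Z Z' I : Finset ι}
    {f : D → ι} (hinj : Injective f) (hf : univ.image f = Z \ Z') (hI : I ⊆ Z') :
    Injective (Sum.elim f (Subtype.val : {x // x ∈ I} → ι)) := by
  refine hinj.sumElim Subtype.val_injective fun a b hab => ?_
  have h1 : f a ∈ Z \ Z' := hf ▸ mem_image_of_mem f (mem_univ a)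
  exact (mem_sdiff.mp h1).2 (hI (hab ▸ b.2))

lemma card_toLeft_singleton_eq {α β : Type*} {x y : α ⊕ β} (h : x.isLeft = y.isLeft) :
    ({x} : Finset (α ⊕ β)).toLeft.card = ({y} : Finset (α ⊕ β)).toLeft.card := by
  classical
  have key : ∀ x : α ⊕ β, ({x} : Finset (α ⊕ β)).toLeft.card = x.isLeft.toNat := by
    rintro (x | x)
    · exact card_eq_one.mpr ⟨x, by ext; simp⟩
    · exact card_eq_zero.mpr (by ext; simp)
  rw [key, key, h]

lemma card_toLeft_pair_eq {α β : Type*} [DecidableEq α] [DecidableEq β] {x y x' y' : α ⊕ β}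
    (hx : x ≠ x') (hy : y ≠ y') (h : x.isLeft = y.isLeft) (h' : x'.isLeft = y'.isLeft) :
    ({x, x'} : Finset (α ⊕ β)).toLeft.card = ({y, y'} : Finset (α ⊕ β)).toLeft.card := by
  have key : ∀ {x x' : α ⊕ β}, x ≠ x' → ({x, x'} : Finset (α ⊕ β)).toLeft.card =
      ({x} : Finset (α ⊕ β)).toLeft.card + ({x'} : Finset (α ⊕ β)).toLeft.card := by
    intro x x' hx
    have hu : ({x, x'} : Finset (α ⊕ β)).toLeft =
        ({x} : Finset (α ⊕ β)).toLeft ∪ ({x'} : Finset (α ⊕ β)).toLeft := by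
      ext; simp
    rw [hu, card_union_of_disjoint]
    rw [disjoint_left]
    intro a ha ha'
    simp only [mem_toLeft, mem_singleton] at ha ha'
    exact hx (ha.symm.trans ha')
  rw [key hx, key hy, card_toLeft_singleton_eq h, card_toLeft_singleton_eq h']

lemma abs_det_updateCol_eq_abs_subdet {m n : ℕ} (A : Matrix (Fin m) (Fin n) ℝ)
    {K : Type*} [Fintype K] [DecidableEq K] (e : K ≃ Fin m) {h : K → Fin m ⊕ Fin n}
    (hinj : Injective h) {R : Finset (Fin m)} {C : Finset (Fin n)}
    (himg : univ.image h = Rᶜ.disjSum C) (p : K) {x : Fin m ⊕ Fin n} (hx : x ∉ Rᶜ.disjSum C)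
    {U : Finset (Fin m ⊕ Fin n)} (hU : U = {h p} ∪ {x}) :
    |(((fromCols 1 A).submatrix e h).updateCol p (fun i => fromCols 1 A (e i) x)).det| =
      |subdet A (symmDiff R U.toLeft) (symmDiff C U.toRight)| := by
  have hp : h p ∈ Rᶜ.disjSum C := himg ▸ mem_image_of_mem h (mem_univ p)
  rw [updateCol_submatrix_eq_submatrix_update]
  apply abs_det_submatrix_fromCols_eq_abs_subdet A e
    (injective_update_of_notMem_image hinj (himg ▸ hx) p)
  rw [hU, disjSum_symmDiff_union_eq (singleton_subset_iff.mpr hp)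
    (disjoint_singleton_left.mpr hx), image_update_eq_insert_erase hinj, himg]
  ext z
  simp only [mem_insert, mem_erase, mem_union, mem_sdiff, mem_singleton]
  tauto

lemma abs_det_updateCol_updateCol_eq_abs_subdet {m n : ℕ} (A : Matrix (Fin m) (Fin n) ℝ)
    {K : Type*} [Fintype K] [DecidableEq K] (e : K ≃ Fin m) {h : K → Fin m ⊕ Fin n}
    (hinj : Injective h) {R : Finset (Fin m)} {C : Finset (Fin n)}
    (himg : univ.image h = Rᶜ.disjSum C) {p p' : K} (hp : p ≠ p') {x x' : Fin m ⊕ Fin n}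
    (hx : x ∉ Rᶜ.disjSum C) (hx' : x' ∉ Rᶜ.disjSum C) (hxx : x ≠ x')
    {U : Finset (Fin m ⊕ Fin n)} (hU : U = {h p, h p'} ∪ {x, x'}) :
    |((((fromCols 1 A).submatrix e h).updateCol p (fun i => fromCols 1 A (e i) x)).updateCol p'
        (fun i => fromCols 1 A (e i) x')).det| =
      |subdet A (symmDiff R U.toLeft) (symmDiff C U.toRight)| := by
  have hm : ∀ p, h p ∈ Rᶜ.disjSum C := fun p => himg ▸ mem_image_of_mem h (mem_univ p)
  have hinj' := injective_update_of_notMem_image hinj (himg ▸ hx) p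
  have himg' := image_update_eq_insert_erase hinj x p
  rw [himg] at himg'
  rw [updateCol_submatrix_eq_submatrix_update, updateCol_submatrix_eq_submatrix_update]
  apply abs_det_submatrix_fromCols_eq_abs_subdet A e
    (injective_update_of_notMem_image hinj' (by
      rw [himg', mem_insert, mem_erase]
      tauto) p')
  rw [hU, disjSum_symmDiff_union_eq (by simp [insert_subset_iff, hm])
    (by simp [disjoint_insert_left, hx, hx']), image_update_eq_insert_erase hinj', himg',
    update_of_ne hp.symm]
  have hne : ∀ z, z = x → z ≠ h p' := fun z hz hz' => hx (hz ▸ hz' ▸ hm p')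
  ext z
  have := hne z
  simp only [mem_insert, mem_erase, mem_union, mem_sdiff, mem_singleton]
  tauto

end Frames

/-- **Exchange Property** (Theorem 4.2): for index pairs `S ≠ T` of `k × k` submatrices,
there is a 1- or 2-exchange `U` between `S` and `T` with
`|det A_S| * |det A_T| ≤ (2k² + 8k) * |det A_{S Δ U}| * |det A_{T Δ U}|`. -/
theorem exchange_property {k m n : ℕ} (hk : 1 ≤ k) (hm : k ≤ m) (hn : k ≤ n)
    (A : Matrix (Fin m) (Fin n) ℝ)
    (SR : Finset (Fin m)) (SC : Finset (Fin n))
    (TR : Finset (Fin m)) (TC : Finset (Fin n))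
    (hSR : SR.card = k) (hSC : SC.card = k) (hTR : TR.card = k) (hTC : TC.card = k)
    (hne : (SR, SC) ≠ (TR, TC)) :
    ∃ (UR : Finset (Fin m)) (UC : Finset (Fin n)),
      UR ⊆ symmDiff SR TR ∧ UC ⊆ symmDiff SC TC ∧
      (UR ∩ SR).card = (UR \ SR).card ∧ (UC ∩ SC).card = (UC \ SC).card ∧
      (UR.card + UC.card = 2 ∨ UR.card + UC.card = 4) ∧
      |subdet A SR SC| * |subdet A TR TC| ≤
        (2 * (k : ℝ) ^ 2 + 8 * k) *
          (|subdet A (symmDiff SR UR) (symmDiff SC UC)| *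
            |subdet A (symmDiff TR UR) (symmDiff TC UC)|) := by
  obtain ⟨f, g, hf, hg, hfi, hgi, hfl, hgl⟩ :=
    exists_enumerations (hSR.trans hTR.symm) (hSC.trans hTC.symm)
  set ZS := SRᶜ.disjSum SC with hZS
  set ZT := TRᶜ.disjSum TC with hZT
  have hfm : ∀ p, f p ∈ ZS \ ZT := fun p => hfi ▸ mem_image_of_mem f (mem_univ p)
  have hgm : ∀ p, g p ∈ ZT \ ZS := fun p => hgi ▸ mem_image_of_mem g (mem_univ p)
  suffices h : ∃ X Y, X ⊆ ZS \ ZT ∧ Y ⊆ ZT \ ZS ∧ X.toLeft.card = Y.toLeft.card ∧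
      X.card = Y.card ∧ (X.card = 1 ∨ X.card = 2) ∧
      |subdet A SR SC| * |subdet A TR TC| ≤ (2 * (k : ℝ) ^ 2 + 8 * k) *
        (|subdet A (symmDiff SR (X ∪ Y).toLeft) (symmDiff SC (X ∪ Y).toRight)| *
          |subdet A (symmDiff TR (X ∪ Y).toLeft) (symmDiff TC (X ∪ Y).toRight)|) by
    obtain ⟨X, Y, hX, hY, hl, hc, h12, hle⟩ := h
    obtain ⟨b1, b2, b3, b4, b5⟩ := union_isBalanced hX hY hl hc
    exact ⟨_, _, b1, b2, b3, b4, by omega, hle⟩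
  have hnonempty : Nonempty ({x // x ∈ TR \ SR} ⊕ {x // x ∈ SC \ TC}) := by
    by_contra hempty
    rw [not_nonempty_iff, isEmpty_sum] at hempty
    refine hne (Prod.mk.injEq _ _ _ _ ▸ ⟨?_, ?_⟩)
    · refine (eq_of_subset_of_card_le (fun x hx => ?_) (by omega)).symm
      by_contra hx'
      exact hempty.1.false ⟨x, mem_sdiff.mpr ⟨hx, hx'⟩⟩
    · refine eq_of_subset_of_card_le (fun x hx => ?_) (by omega)
      by_contra hx'
      exact hempty.2.false ⟨x, mem_sdiff.mpr ⟨hx, hx'⟩⟩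
  by_cases hzero : |subdet A SR SC| * |subdet A TR TC| = 0
  · obtain ⟨p⟩ := hnonempty
    refine ⟨{f p}, {g p}, by simpa using hfm p, by simpa using hgm p,
      card_toLeft_singleton_eq ((hfl p).trans (hgl p).symm), by simp, by simp, ?_⟩
    rw [hzero]
    positivity
  let φ := Sum.elim f (Subtype.val : {x // x ∈ ZS ∩ ZT} → Fin m ⊕ Fin n)
  let ψ := Sum.elim g (Subtype.val : {x // x ∈ ZS ∩ ZT} → Fin m ⊕ Fin n)
  have hφ : Function.Injective φ := injective_sumElim_coe hf hfi inter_subset_right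
  have hψ : Function.Injective ψ := injective_sumElim_coe hg hgi inter_subset_left
  have hφi : univ.image φ = ZS := image_sumElim_coe_eq hfi
  have hψi : univ.image ψ = ZT := by
    have := image_sumElim_coe_eq hgi
    rwa [inter_comm ZT ZS] at this
  have hcard : Fintype.card (({x // x ∈ TR \ SR} ⊕ {x // x ∈ SC \ TC}) ⊕ {x // x ∈ ZS ∩ ZT}) =
      Fintype.card (Fin m) := by
    rw [← card_univ, ← card_image_of_injective _ hφ, hφi, hZS, card_disjSum, card_compl,
      Fintype.card_fin]
    omega
  let e := Fintype.equivOfCardEq hcard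
  set B := Matrix.fromCols (1 : Matrix (Fin m) (Fin m) ℝ) A
  set F := B.submatrix e φ
  set G := B.submatrix e ψ
  have hFS : |F.det| = |subdet A SR SC| := abs_det_submatrix_fromCols_eq_abs_subdet A e hφ hφi
  have hGT : |G.det| = |subdet A TR TC| := abs_det_submatrix_fromCols_eq_abs_subdet A e hψ hψi
  rw [← hFS, ← hGT] at hzero ⊢
  have hF0 : F.det ≠ 0 := fun h => hzero (by rw [h, abs_zero, zero_mul])
  have hG0 : G.det ≠ 0 := fun h => hzero (by rw [h, abs_zero, mul_zero])
  have hscale : ∀ a b : ℝ, 1 ≤ (2 * (k : ℝ) ^ 2 + 8 * k) * |a * b| →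
      |F.det| * |G.det| ≤ (2 * (k : ℝ) ^ 2 + 8 * k) * (|F.det * a| * |G.det * b|) :=
    fun a b hab => by
      have h0 : 0 ≤ |F.det| * |G.det| := by positivity
      have h1 := mul_le_mul_of_nonneg_left hab h0
      simp only [abs_mul] at h1 ⊢
      linarith
  have hD1 : Fintype.card {x // x ∈ TR \ SR} ≤ k := by
    rw [Fintype.card_coe, ← hTR]; exact card_le_card sdiff_subset
  have hD2 : Fintype.card {x // x ∈ SC \ TC} ≤ k := by
    rw [Fintype.card_coe, ← hSC]; exact card_le_card sdiff_subset
  rcases exists_large_minor_mul_minor _ _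
    (pivot_submatrix_mul_pivot_submatrix F G hF0 hG0 fun i x => rfl) k hD1 hD2 with
    ⟨p, q, hpq, hle⟩ | ⟨p, p', q, q', hpq, hpq', hle⟩
  · refine ⟨{f p}, {g q}, by simpa using hfm p, by simpa using hgm q,
      card_toLeft_singleton_eq ((hfl p).trans (hpq.trans (hgl q).symm)), by simp, by simp, ?_⟩
    have uS := abs_det_updateCol_eq_abs_subdet A e hφ hφi (.inl p) (mem_sdiff.mp (hgm q)).2
      (U := {f p} ∪ {g q}) rfl
    have uT := abs_det_updateCol_eq_abs_subdet A e hψ hψi (.inl q) (mem_sdiff.mp (hfm p)).2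
      (U := {f p} ∪ {g q}) (union_comm _ _)
    rw [← uS, ← uT]
    have dF := det_updateCol_eq_det_mul F G hF0 (.inl p) (.inl q)
    have dG := det_updateCol_eq_det_mul G F hG0 (.inl q) (.inl p)
    exact (hscale _ _ hle).trans_eq (congrArg _ (congrArg₂ (fun a b => |a| * |b|) dF.symm dG.symm))
  · have hvanish : ∀ c d t : ℝ, d = 0 → ¬ 1 ≤ c * |d * t| := fun c d t hd => by
      rw [hd, zero_mul, abs_zero, mul_zero]; norm_num
    have hpp : p ≠ p' := by
      rintro rfl
      exact hvanish _ _ _ (sub_eq_zero.mpr (mul_comm _ _)) hle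
    have hqq : q ≠ q' := by
      rintro rfl
      exact hvanish _ _ _ (sub_self _) hle
    have hf' : f p ≠ f p' := hf.ne hpp
    have hg' : g q ≠ g q' := hg.ne hqq
    refine ⟨{f p, f p'}, {g q, g q'}, by simp only [insert_subset_iff, singleton_subset_iff, hfm,
      and_self], by simp only [insert_subset_iff, singleton_subset_iff, hgm, and_self],
      card_toLeft_pair_eq hf' hg' ((hfl p).trans (hpq.trans (hgl q).symm))
        ((hfl p').trans (hpq'.trans (hgl q').symm)),
      by rw [card_pair hf', card_pair hg'], .inr (card_pair hf'), ?_⟩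
    have uS := abs_det_updateCol_updateCol_eq_abs_subdet A e hφ hφi (Sum.inl_injective.ne hpp)
      (mem_sdiff.mp (hgm q)).2 (mem_sdiff.mp (hgm q')).2 hg'
      (U := {f p, f p'} ∪ {g q, g q'}) rfl
    have uT := abs_det_updateCol_updateCol_eq_abs_subdet A e hψ hψi (Sum.inl_injective.ne hqq)
      (mem_sdiff.mp (hfm p)).2 (mem_sdiff.mp (hfm p')).2 hf'
      (U := {f p, f p'} ∪ {g q, g q'}) (union_comm _ _)
    rw [← uS, ← uT]
    have dF := det_updateCol_updateCol_eq_det_mul F G hF0 (Sum.inl_injective.ne hpp)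
      (.inl q) (.inl q')
    have dG := det_updateCol_updateCol_eq_det_mul G F hG0 (Sum.inl_injective.ne hqq)
      (.inl p) (.inl p')
    exact (hscale _ _ hle).trans_eq (congrArg _ (congrArg₂ (fun a b => |a| * |b|) dF.symm dG.symm))
end

section
/- (Claim 4.4, distance-reduction step, with the explicit constant from its proof.) Let α > 0 and suppose S ∈ ℐ is a (2, α)-local maximum with det(A_S) ≠ 0. Then for every T ∈ ℐ there exists W ∈ ℐ such that d(S, W) ≤ max(0, d(S, T) − 1) and |det(A_T)| ≤ ((2k² + 8k)/α) · |det(A_W)|. -/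
open Finset

open Function

/-- The columns of the matrix `[1 | A]`, indexed by the rows and the columns of `A`. -/
def extCol {m n : ℕ} (A : Matrix (Fin m) (Fin n) ℝ) : Fin m ⊕ Fin n → Fin m → ℝ :=
  Sum.elim (fun r => Pi.single r 1) (fun c r => A r c)

/-- The determinant of the vectors `v (t i)`. -/
noncomputable def famDet {ι E : Type*} [Fintype ι] [DecidableEq ι] (v : E → ι → ℝ)
    (t : ι → E) : ℝ :=
  (Matrix.of fun i => v (t i)).det

section Pluecker

variable {ι E : Type*} [Fintype ι] [DecidableEq ι] (v : E → ι → ℝ)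

theorem famDet_update (t : ι → E) (i : ι) (x : E) :
    famDet v (update t i x) = Matrix.cramer (Matrix.of fun i => v (t i)).transpose (v x) i := by
  rw [Matrix.cramer_transpose_apply, famDet]
  congr 1
  ext a b
  by_cases h : a = i
  · subst h; simp
  · simp [h]

theorem famDet_eq_zero {t : ι → E} {i j : ι} (hij : i ≠ j) (h : t i = t j) : famDet v t = 0 :=
  Matrix.det_zero_of_row_eq hij (by ext b; simp [h])

theorem famDet_swap (t : ι → E) {i j : ι} (hij : i ≠ j) :
    famDet v (t ∘ Equiv.swap i j) = - famDet v t := by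
  have := Matrix.det_permute (Equiv.swap i j) (Matrix.of fun i => v (t i))
  rw [Equiv.Perm.sign_swap hij] at this
  simpa [famDet, Matrix.submatrix] using this

/-- Grassmann–Plücker relation. -/
theorem sum_famDet_mul_famDet (s t : ι → E) (b : ι) (x : E) :
    ∑ a, famDet v (update s a x) * famDet v (update t b (s a)) =
      famDet v s * famDet v (update t b x) := by
  have h := Matrix.mulVec_cramer (Matrix.of fun i => v (s i)).transpose (v x)
  have h' : ∑ a, famDet v (update s a x) • v (s a) = famDet v s • v x := by
    rw [famDet, ← Matrix.det_transpose, ← h]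
    ext r
    simp only [Finset.sum_apply, Pi.smul_apply, smul_eq_mul, Matrix.mulVec, dotProduct,
      famDet_update, Matrix.transpose_apply, Matrix.of_apply]
    exact Finset.sum_congr rfl fun _ _ => mul_comm _ _
  have := congrArg (fun w => Matrix.cramer (Matrix.of fun i => v (t i)).transpose w b) h'
  simpa [famDet_update] using this

theorem famDet_mul_famDet_update_update (t : ι → E) {j l : ι} (hjl : j ≠ l) (x y : E) :
    famDet v t * famDet v (update (update t j x) l y) =
      famDet v (update t j x) * famDet v (update t l y) -
        famDet v (update t j y) * famDet v (update t l x) := by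
  rw [← sum_famDet_mul_famDet v t (update t j x) l y,
    ← Finset.sum_subset (Finset.subset_univ {j, l}), Finset.sum_pair hjl]
  · have h1 : update (update t j x) l (t l) = update t j x := by
      rw [update_eq_self_iff, update_of_ne hjl.symm]
    have h2 : update (update t j x) l (t j) = update t l x ∘ Equiv.swap j l := by
      ext a
      by_cases hl : a = l
      · subst hl; simp [hjl]
      · by_cases hj : a = j
        · subst hj; simp [hl]
        · simp [hl, hj, Equiv.swap_apply_of_ne_of_ne]
    rw [h1, h2, famDet_swap v _ hjl]
    ring
  · intro a _ ha
    simp only [Finset.mem_insert, Finset.mem_singleton, not_or] at ha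
    rw [famDet_eq_zero v (t := update (update t j x) l (t a)) ha.2, mul_zero]
    simp [ha.1, ha.2]

end Pluecker

/-- The identity obtained by combining the Grassmann–Plücker relations for one- and two-element
exchanges between two bases with determinants `d` and `e`. -/
theorem exchange_identity {ι : Type*} (I K : Finset ι) (d e : ℝ) (hd : d ≠ 0)
    (gj gl qj ql : ι → ℝ) (δ ρ : ι → ι → ℝ)
    (hjj : ∑ i ∈ I, gj i * qj i + ∑ k ∈ K, gj k * qj k = d * e)
    (hll : ∑ i ∈ I, gl i * ql i + ∑ k ∈ K, gl k * ql k = d * e)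
    (hlj : ∑ i ∈ I, gl i * qj i + ∑ k ∈ K, gl k * qj k = 0)
    (hjl : ∑ i ∈ I, gj i * ql i + ∑ k ∈ K, gj k * ql k = 0)
    (hδ : ∀ i ∈ I, ∀ k ∈ K, d * δ i k = gl i * gj k - gj i * gl k)
    (hρ : ∀ i ∈ I, ∀ k ∈ K, e * ρ i k = qj k * ql i - qj i * ql k) :
    d * e ^ 2 = e * (∑ i ∈ I, gl i * ql i + ∑ k ∈ K, gj k * qj k) +
      e * (∑ i ∈ I, ∑ k ∈ K, δ i k * ρ i k) -
      2 * ∑ i ∈ I, ∑ k ∈ K, δ i k * (qj k * ql i) := by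
  have h1 : d * (e * ∑ i ∈ I, ∑ k ∈ K, δ i k * ρ i k) =
      (∑ i ∈ I, gl i * ql i) * (∑ k ∈ K, gj k * qj k)
      - (∑ i ∈ I, gl i * qj i) * (∑ k ∈ K, gj k * ql k)
      - (∑ i ∈ I, gj i * ql i) * (∑ k ∈ K, gl k * qj k)
      + (∑ i ∈ I, gj i * qj i) * (∑ k ∈ K, gl k * ql k) := by
    simp only [Finset.sum_mul_sum]
    simp only [Finset.mul_sum, ← Finset.sum_sub_distrib,
      ← Finset.sum_add_distrib]
    refine Finset.sum_congr rfl fun i hi => Finset.sum_congr rfl fun k hk => ?_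
    linear_combination (e * ρ i k) * hδ i hi k hk + (gl i * gj k - gj i * gl k) * hρ i hi k hk
  have h2 : d * ∑ i ∈ I, ∑ k ∈ K, δ i k * (qj k * ql i) =
      (∑ i ∈ I, gl i * ql i) * (∑ k ∈ K, gj k * qj k)
      - (∑ i ∈ I, gj i * ql i) * (∑ k ∈ K, gl k * qj k) := by
    simp only [Finset.sum_mul_sum]
    simp only [Finset.mul_sum, ← Finset.sum_sub_distrib]
    refine Finset.sum_congr rfl fun i hi => Finset.sum_congr rfl fun k hk => ?_
    linear_combination (qj k * ql i) * hδ i hi k hk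
  apply mul_left_cancel₀ hd
  rw [eq_sub_of_add_eq hjj, eq_neg_of_add_eq_zero_left hlj,
    ← neg_eq_of_add_eq_zero_right hjl, eq_sub_of_add_eq' hll] at h1
  rw [← sub_eq_zero]
  rw [← sub_eq_zero] at h1 h2
  linear_combination 2 * h2 - h1

/-- `t` enumerates the rows outside `R` and the columns in `C`. -/
structure Enumerates {m n : ℕ} (t : Fin m → Fin m ⊕ Fin n) (R : Finset (Fin m))
    (C : Finset (Fin n)) : Prop where
  injective : Injective t
  inl_mem : ∀ r, Sum.inl r ∈ Set.range t ↔ r ∉ R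
  inr_mem : ∀ c, Sum.inr c ∈ Set.range t ↔ c ∈ C

namespace Enumerates

variable {m n : ℕ} {t : Fin m → Fin m ⊕ Fin n} {R : Finset (Fin m)} {C : Finset (Fin n)}

theorem mem_range_update (h : Injective t) (l : Fin m) (x y : Fin m ⊕ Fin n) :
    y ∈ Set.range (update t l x) ↔ y = x ∨ (y ∈ Set.range t ∧ y ≠ t l) := by
  constructor
  · rintro ⟨a, rfl⟩
    by_cases ha : a = l
    · subst ha; simp
    · right; simp [ha, h.eq_iff]
  · rintro (rfl | ⟨⟨a, rfl⟩, ha⟩)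
    · exact ⟨l, by simp⟩
    · exact ⟨a, update_of_ne (fun hal => ha (congrArg t hal)) _ _⟩

theorem injective_update (h : Injective t) (l : Fin m) {x : Fin m ⊕ Fin n}
    (hx : x ∉ Set.range t) : Injective (update t l x) := by
  intro a b hab
  by_cases ha : a = l <;> by_cases hb : b = l
  · rw [ha, hb]
  · subst ha; simp [hb] at hab; exact (hx ⟨b, hab.symm⟩).elim
  · subst hb; simp [ha] at hab; exact (hx ⟨a, hab⟩).elim
  · simp [ha, hb] at hab; exact h hab

theorem update_inr (h : Enumerates t R C) {l : Fin m} {e c : Fin n} (hl : t l = Sum.inr e)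
    (hc : c ∉ C) : Enumerates (update t l (Sum.inr c)) R (insert c (C.erase e)) where
  injective := injective_update h.injective l fun hx => hc ((h.inr_mem c).1 hx)
  inl_mem r := by rw [mem_range_update h.injective, h.inl_mem, hl]; simp
  inr_mem r := by rw [mem_range_update h.injective, h.inr_mem, hl]; simp [and_comm]

theorem update_inl (h : Enumerates t R C) {l : Fin m} {e c : Fin m} (hl : t l = Sum.inl e)
    (hc : c ∈ R) : Enumerates (update t l (Sum.inl c)) (insert e (R.erase c)) C where
  injective := injective_update h.injective l fun hx => (h.inl_mem c).1 hx hc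
  inl_mem r := by
    have he : e ∉ R := (h.inl_mem e).1 ⟨l, hl⟩
    rw [mem_range_update h.injective, h.inl_mem, hl]
    by_cases hr : r = c
    · subst hr; simpa using fun h : r = e => he (h ▸ hc)
    · simp [hr, and_comm]
  inr_mem r := by rw [mem_range_update h.injective, h.inr_mem, hl]; simp

theorem abs_famDet (A : Matrix (Fin m) (Fin n) ℝ) (h : Enumerates t R C) (hRC : R.card = C.card) :
    |famDet (extCol A) t| = |subdet A R C| := by
  have hl : ∀ r : {r // r ∉ R}, ∃ a, t a = Sum.inl r.1 := fun r => (h.inl_mem r).2 r.2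
  have hr : ∀ i : Fin R.card, ∃ a, t a = Sum.inr (C.orderEmbOfFin hRC.symm i) := fun i =>
    (h.inr_mem _).2 (C.orderEmbOfFin_mem _ i)
  choose f hf using hl
  choose g hg using hr
  have hcard : Fintype.card ({r // r ∉ R} ⊕ Fin R.card) = Fintype.card (Fin m) := by
    have := Finset.card_le_univ R
    simp [Fintype.card_subtype_compl] at this ⊢
    omega
  have h1 : Bijective (Sum.elim f g) := by
    rw [Fintype.bijective_iff_injective_and_card]
    refine ⟨fun x y hxy => ?_, hcard⟩
    have := congrArg t hxy
    rcases x with x | x <;> rcases y with y | y <;> simp [hf, hg, Subtype.ext_iff] at this ⊢ <;>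
      exact this
  have h2 : Bijective (Sum.elim (fun r : {r // r ∉ R} => r.1) (R.orderEmbOfFin rfl)) := by
    rw [Fintype.bijective_iff_injective_and_card]
    refine ⟨fun x y hxy => ?_, hcard⟩
    rcases x with x | x <;> rcases y with y | y <;> simp [Subtype.ext_iff] at hxy ⊢
    · exact hxy
    · exact x.2 (hxy ▸ R.orderEmbOfFin_mem rfl y)
    · exact y.2 (hxy ▸ R.orderEmbOfFin_mem rfl x)
    · exact hxy
  rw [subdet, dif_pos hRC, famDet,
    ← Matrix.abs_det_submatrix_equiv_equiv (Equiv.ofBijective _ h1) (Equiv.ofBijective _ h2),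
    ← Matrix.det_transpose (A.submatrix _ _)]
  have hb : (Matrix.of fun i => extCol A (t i)).submatrix (Equiv.ofBijective _ h1)
      (Equiv.ofBijective _ h2) = Matrix.fromBlocks 1 0
        (Matrix.of fun i (r : {r // r ∉ R}) => A r (C.orderEmbOfFin hRC.symm i))
        (A.submatrix (R.orderEmbOfFin rfl) (C.orderEmbOfFin hRC.symm)).transpose := by
    ext x y
    rcases x with x | x <;> rcases y with y | y
    · simp [hf, extCol, Matrix.one_apply, Pi.single_apply, Subtype.ext_iff, eq_comm]
    · have : R.orderEmbOfFin rfl y ≠ x := fun h => x.2 (h ▸ R.orderEmbOfFin_mem rfl y)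
      simp [hf, extCol, this]
    · simp [hg, extCol]
    · simp [hg, extCol]
  rw [hb, Matrix.det_fromBlocks_zero₁₂, Matrix.det_one, one_mul]

theorem exists_enumerates (R : Finset (Fin m)) (C : Finset (Fin n)) (hRC : R.card = C.card) :
    ∃ t, Enumerates t R C := by
  have hc : Fintype.card (Fin m) = Fintype.card ((Rᶜ).disjSum C) := by
    have := Finset.card_le_univ R
    simp [Finset.card_compl] at this ⊢
    omega
  let f := Fintype.equivOfCardEq hc
  refine ⟨fun i => f i, Subtype.val_injective.comp f.injective, fun r => ?_, fun c => ?_⟩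
  · constructor
    · rintro ⟨i, hi⟩
      have := (f i).2
      simpa [hi] using this
    · intro hr
      exact ⟨f.symm ⟨Sum.inl r, by simpa using hr⟩, by simp⟩
  · constructor
    · rintro ⟨i, hi⟩
      have := (f i).2
      simpa [hi] using this
    · intro hr
      exact ⟨f.symm ⟨Sum.inr c, by simpa using hr⟩, by simp⟩

end Enumerates

section Swap

variable {β : Type*} [DecidableEq β] {S T : Finset β} {c e : β}

theorem card_insert_erase (he : e ∈ T) (hc : c ∉ T) : (insert c (T.erase e)).card = T.card := by
  rw [Finset.card_insert_of_notMem (fun h => hc (Finset.mem_of_mem_erase h)),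
    Finset.card_erase_add_one he]

theorem card_symmDiff_insert_erase_self_le (S : Finset β) (c e : β) :
    (symmDiff S (insert c (S.erase e))).card ≤ 2 := by
  refine (Finset.card_le_card fun x hx => ?_).trans (Finset.card_le_two (a := c) (b := e))
  simp only [Finset.mem_symmDiff, Finset.mem_insert, Finset.mem_erase, Finset.mem_singleton] at hx ⊢
  tauto

theorem card_symmDiff_insert_erase_add_two (hcS : c ∈ S) (hcT : c ∉ T) (heS : e ∉ S)
    (heT : e ∈ T) : (symmDiff S (insert c (T.erase e))).card + 2 = (symmDiff S T).card := by
  have hce : c ≠ e := fun h => heS (h ▸ hcS)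
  have h : symmDiff S (insert c (T.erase e)) = ((symmDiff S T).erase c).erase e := by
    ext x
    by_cases hxc : x = c
    · subst hxc; simp [Finset.mem_symmDiff, *]
    · by_cases hxe : x = e
      · subst hxe; simp [Finset.mem_symmDiff, *]
      · simp [Finset.mem_symmDiff, *]
  have hc : c ∈ symmDiff S T := by simp [Finset.mem_symmDiff, *]
  have he : e ∈ (symmDiff S T).erase c := by simp [Finset.mem_symmDiff, hce.symm, *]
  rw [h, ← Finset.card_erase_add_one hc, ← Finset.card_erase_add_one he]

end Swap

theorem abs_sum_le_card_mul {ι : Type*} (I : Finset ι) (f : ι → ℝ) {k : ℕ} {c : ℝ} (hc : 0 ≤ c)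
    (hI : I.card ≤ k) (hf : ∀ i ∈ I, |f i| ≤ c) : |∑ i ∈ I, f i| ≤ k * c :=
  calc |∑ i ∈ I, f i| ≤ ∑ i ∈ I, |f i| := Finset.abs_sum_le_sum_abs _ _
    _ ≤ I.card • c := Finset.sum_le_card_nsmul _ _ _ hf
    _ ≤ k * c := by rw [nsmul_eq_mul]; gcongr

/-- If the minor at `S` dominates all minors at distance at most `2` from it up to the factor `α`,
and `M` bounds all minors closer to `S` than `T`, then the minor at `T` satisfies a quadratic
inequality in terms of `M`. -/
theorem sq_subdet_le {k m n : ℕ} (A : Matrix (Fin m) (Fin n) ℝ) {α M : ℝ} (hα : 0 < α)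
    (hM0 : 0 ≤ M) {SR TR : Finset (Fin m)} {SC TC : Finset (Fin n)}
    (hSR : SR.card = k) (hSC : SC.card = k) (hTR : TR.card = k) (hTC : TC.card = k)
    (hS0 : subdet A SR SC ≠ 0)
    (hloc : ∀ (WR : Finset (Fin m)) (WC : Finset (Fin n)), WR.card = k → WC.card = k →
      (symmDiff SR WR).card + (symmDiff SC WC).card ≤ 4 →
      |subdet A WR WC| ≤ |subdet A SR SC| / α)
    (hM : ∀ (WR : Finset (Fin m)) (WC : Finset (Fin n)), WR.card = k → WC.card = k →
      (symmDiff SR WR).card + (symmDiff SC WC).card + 2 ≤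
        (symmDiff SR TR).card + (symmDiff SC TC).card → |subdet A WR WC| ≤ M)
    (hne : SR ≠ TR ∨ SC ≠ TC) :
    |subdet A TR TC| ^ 2 ≤ |subdet A TR TC| * ((k ^ 2 + 2 * k) * M / α) +
      2 * k ^ 2 * M ^ 2 / α := by
  classical
  obtain ⟨s, hs⟩ := Enumerates.exists_enumerates SR SC (hSR.trans hSC.symm)
  obtain ⟨t, ht⟩ := Enumerates.exists_enumerates TR TC (hTR.trans hTC.symm)
  have hsd := hs.abs_famDet A (hSR.trans hSC.symm)
  have htd := ht.abs_famDet A (hTR.trans hTC.symm)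
  rw [← hsd] at hloc
  rw [← htd]
  set p := famDet (extCol A) with hp
  have hd : p s ≠ 0 := by rw [← abs_ne_zero, hsd]; exact abs_ne_zero.2 hS0
  set I := Finset.univ.filter fun a => ∃ c ∉ TC, s a = Sum.inr c with hI
  set K := Finset.univ.filter fun a => ∃ r ∈ TR, s a = Sum.inl r with hK
  have hIk : I.card ≤ k := by
    rw [← hSC, ← Finset.card_map (⟨Sum.inr, Sum.inr_injective⟩ : Fin n ↪ Fin m ⊕ Fin n)]
    refine Finset.card_le_card_of_injOn s (fun a ha => ?_) hs.injective.injOn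
    obtain ⟨c, -, hc⟩ := (Finset.mem_filter.1 ha).2
    simpa [hc] using (hs.inr_mem c).1 ⟨a, hc⟩
  have hKk : K.card ≤ k := by
    rw [← hTR, ← Finset.card_map (s := TR) (⟨Sum.inl, Sum.inl_injective⟩ : Fin m ↪ Fin m ⊕ Fin n)]
    refine Finset.card_le_card_of_injOn s (fun a ha => ?_) hs.injective.injOn
    obtain ⟨c, hcT, hc⟩ := (Finset.mem_filter.1 ha).2
    simpa [hc] using hcT
  have hsplit : ∀ b x, t b ∉ Set.range s →
      ∑ a ∈ I, p (update s a x) * p (update t b (s a)) +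
        ∑ a ∈ K, p (update s a x) * p (update t b (s a)) = p s * p (update t b x) := by
    intro b x hb
    have hdisj : Disjoint I K := by
      rw [Finset.disjoint_left]
      intro a ha ha'
      obtain ⟨c, -, hc⟩ := (Finset.mem_filter.1 ha).2
      obtain ⟨r, -, hr⟩ := (Finset.mem_filter.1 ha').2
      simp [hc] at hr
    rw [← Finset.sum_union hdisj, ← sum_famDet_mul_famDet]
    refine Finset.sum_subset (Finset.subset_univ _) fun a _ ha => ?_
    have hat : s a ∈ Set.range t := by
      rw [Finset.mem_union, not_or] at ha
      simp only [hI, hK, Finset.mem_filter, Finset.mem_univ, true_and, not_exists, not_and] at ha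
      rcases hsa : s a with r | c
      · exact (ht.inl_mem r).2 fun hr => ha.2 r hr hsa
      · by_contra hc
        exact ha.1 c (fun h => hc ((ht.inr_mem c).2 h)) hsa
    obtain ⟨b', hb'⟩ := hat
    have hbb : b ≠ b' := fun h => hb ⟨a, by rw [h, hb']⟩
    rw [hp, famDet_eq_zero _ (t := update t b (s a)) hbb, mul_zero]
    simp [hbb.symm, hb']
  have hrow : ∀ j r, t j = Sum.inl r → r ∈ SR → ∀ a ∈ K,
      |p (update s a (t j))| ≤ |p s| / α ∧ |p (update t j (s a))| ≤ M := by
    intro j r hj hr a ha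
    obtain ⟨u, huT, hu⟩ := (Finset.mem_filter.1 ha).2
    have huS : u ∉ SR := (hs.inl_mem u).1 ⟨a, hu⟩
    have hrT : r ∉ TR := (ht.inl_mem r).1 ⟨j, hj⟩
    have hcS := (card_insert_erase hr huS).trans hSR
    have hcT := (card_insert_erase huT hrT).trans hTR
    rw [hj, hu, (hs.update_inl hu hr).abs_famDet A (hcS.trans hSC.symm),
      (ht.update_inl hj huT).abs_famDet A (hcT.trans hTC.symm)]
    refine ⟨hloc _ _ hcS hSC ?_, hM _ _ hcT hTC ?_⟩
    · have := card_symmDiff_insert_erase_self_le SR u r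
      simp only [symmDiff_self, Finset.bot_eq_empty, Finset.card_empty]
      omega
    · have := card_symmDiff_insert_erase_add_two hr hrT huS huT
      omega
  have hcol : ∀ l c, t l = Sum.inr c → c ∉ SC → ∀ a ∈ I,
      |p (update s a (t l))| ≤ |p s| / α ∧ |p (update t l (s a))| ≤ M := by
    intro l c hl hc a ha
    obtain ⟨u, huT, hu⟩ := (Finset.mem_filter.1 ha).2
    have huS : u ∈ SC := (hs.inr_mem u).1 ⟨a, hu⟩
    have hcT : c ∈ TC := (ht.inr_mem c).1 ⟨l, hl⟩
    have hkS := (card_insert_erase huS hc).trans hSC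
    have hkT := (card_insert_erase hcT huT).trans hTC
    rw [hl, hu, (hs.update_inr hu hc).abs_famDet A (hSR.trans hkS.symm),
      (ht.update_inr hl huT).abs_famDet A (hTR.trans hkT.symm)]
    refine ⟨hloc _ _ hSR hkS ?_, hM _ _ hTR hkT ?_⟩
    · have := card_symmDiff_insert_erase_self_le SC c u
      simp only [symmDiff_self, Finset.bot_eq_empty, Finset.card_empty]
      omega
    · have := card_symmDiff_insert_erase_add_two huS huT hc hcT
      omega
  have hboth : ∀ j r l c, t j = Sum.inl r → r ∈ SR → t l = Sum.inr c → c ∉ SC →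
      ∀ i ∈ I, ∀ a ∈ K, |p (update (update s i (t l)) a (t j))| ≤ |p s| / α ∧
        |p (update (update t j (s a)) l (s i))| ≤ M := by
    intro j r l c hj hr hl hc i hi a ha
    obtain ⟨u, huT, hu⟩ := (Finset.mem_filter.1 ha).2
    obtain ⟨w, hwT, hw⟩ := (Finset.mem_filter.1 hi).2
    have huS : u ∉ SR := (hs.inl_mem u).1 ⟨a, hu⟩
    have hrT : r ∉ TR := (ht.inl_mem r).1 ⟨j, hj⟩
    have hwS : w ∈ SC := (hs.inr_mem w).1 ⟨i, hw⟩
    have hcT : c ∈ TC := (ht.inr_mem c).1 ⟨l, hl⟩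
    have hrS' := (card_insert_erase hr huS).trans hSR
    have hrT' := (card_insert_erase huT hrT).trans hTR
    have hkS := (card_insert_erase hwS hc).trans hSC
    have hkT := (card_insert_erase hcT hwT).trans hTC
    have hia : a ≠ i := by rintro rfl; simp [hu] at hw
    have hjl : l ≠ j := by rintro rfl; simp [hj] at hl
    have hu' : update s i (t l) a = Sum.inl u := by rw [update_of_ne hia, hu]
    have hl' : update t j (s a) l = Sum.inr c := by rw [update_of_ne hjl, hl]
    rw [hl] at hu' ⊢
    rw [hu] at hl' ⊢
    rw [hj, hw, ((hs.update_inr hw hc).update_inl hu' hr).abs_famDet A (hrS'.trans hkS.symm),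
      ((ht.update_inl hj huT).update_inr hl' hwT).abs_famDet A (hrT'.trans hkT.symm)]
    refine ⟨hloc _ _ hrS' hkS ?_, hM _ _ hrT' hkT ?_⟩
    · have := card_symmDiff_insert_erase_self_le SR u r
      have := card_symmDiff_insert_erase_self_le SC c w
      omega
    · have := card_symmDiff_insert_erase_add_two hr hrT huS huT
      have := card_symmDiff_insert_erase_add_two hwS hwT hc hcT
      omega
  have hrow_sum : ∀ j r, t j = Sum.inl r → r ∈ SR →
      |∑ a ∈ K, p (update s a (t j)) * p (update t j (s a))| ≤ k * (|p s| / α * M) := by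
    intro j r hj hr
    refine abs_sum_le_card_mul _ _ (by positivity) hKk fun a ha => ?_
    rw [abs_mul]
    exact mul_le_mul (hrow j r hj hr a ha).1 (hrow j r hj hr a ha).2 (abs_nonneg _) (by positivity)
  have hcol_sum : ∀ l c, t l = Sum.inr c → c ∉ SC →
      |∑ a ∈ I, p (update s a (t l)) * p (update t l (s a))| ≤ k * (|p s| / α * M) := by
    intro l c hl hc
    refine abs_sum_le_card_mul _ _ (by positivity) hIk fun a ha => ?_
    rw [abs_mul]
    exact mul_le_mul (hcol l c hl hc a ha).1 (hcol l c hl hc a ha).2 (abs_nonneg _) (by positivity)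
  have hd' : 0 < |p s| := abs_pos.2 hd
  have honeSided : |p s * p t| ≤ k * (|p s| / α * M) →
      |p t| ^ 2 ≤ |p t| * ((k ^ 2 + 2 * k) * M / α) + 2 * k ^ 2 * M ^ 2 / α := by
    intro h
    have h1 : |p t| ≤ k * M / α := by
      rw [abs_mul] at h
      refine le_of_mul_le_mul_left (h.trans_eq ?_) hd'
      ring
    have h2 : k * M / α ≤ (k ^ 2 + 2 * k) * M / α := by
      gcongr
      nlinarith [sq_nonneg (k : ℝ), (Nat.cast_nonneg k : (0 : ℝ) ≤ k)]
    have h3 : 0 ≤ 2 * k ^ 2 * M ^ 2 / α := by positivity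
    nlinarith [mul_le_mul_of_nonneg_left (h1.trans h2) (abs_nonneg (p t))]
  by_cases hR : SR ⊆ TR
  · have hR' : SR = TR := Finset.eq_of_subset_of_card_le hR (by omega)
    have hC : ¬ TC ⊆ SC := fun h => (hne.resolve_left (not_not.2 hR'))
      (Finset.eq_of_subset_of_card_le h (by omega)).symm
    obtain ⟨c, hcT, hcS⟩ := Finset.not_subset.1 hC
    obtain ⟨l, hl⟩ := (ht.inr_mem c).2 hcT
    have hK0 : K = ∅ := by
      refine Finset.eq_empty_of_forall_notMem fun a ha => ?_
      obtain ⟨u, huT, hu⟩ := (Finset.mem_filter.1 ha).2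
      exact (hs.inl_mem u).1 ⟨a, hu⟩ (hR' ▸ huT)
    apply honeSided
    have := hsplit l (t l) (by rw [hl, hs.inr_mem]; exact hcS)
    rw [hK0, Finset.sum_empty, add_zero, update_eq_self] at this
    rw [← this]
    exact hcol_sum l c hl hcS
  obtain ⟨r, hrS, hrT⟩ := Finset.not_subset.1 hR
  obtain ⟨j, hj⟩ := (ht.inl_mem r).2 hrT
  have hjs : t j ∉ Set.range s := by rw [hj, hs.inl_mem]; exact not_not.2 hrS
  by_cases hC : TC ⊆ SC
  · have hC' : TC = SC := Finset.eq_of_subset_of_card_le hC (by omega)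
    have hI0 : I = ∅ := by
      refine Finset.eq_empty_of_forall_notMem fun a ha => ?_
      obtain ⟨u, huT, hu⟩ := (Finset.mem_filter.1 ha).2
      exact huT (hC' ▸ (hs.inr_mem u).1 ⟨a, hu⟩)
    apply honeSided
    have := hsplit j (t j) hjs
    rw [hI0, Finset.sum_empty, zero_add, update_eq_self] at this
    rw [← this]
    exact hrow_sum j r hj hrS
  obtain ⟨c, hcT, hcS⟩ := Finset.not_subset.1 hC
  obtain ⟨l, hl⟩ := (ht.inr_mem c).2 hcT
  have hls : t l ∉ Set.range s := by rw [hl, hs.inr_mem]; exact hcS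
  have hjl : j ≠ l := by rintro rfl; simp [hj] at hl
  have hIK : ∀ i ∈ I, ∀ a ∈ K, i ≠ a := by
    rintro i hi a ha rfl
    obtain ⟨u, -, hu⟩ := (Finset.mem_filter.1 ha).2
    obtain ⟨w, -, hw⟩ := (Finset.mem_filter.1 hi).2
    simp [hu] at hw
  have key := exchange_identity I K (p s) (p t) hd
    (fun a => p (update s a (t j))) (fun a => p (update s a (t l)))
    (fun a => p (update t j (s a))) (fun a => p (update t l (s a)))
    (fun i a => p (update (update s i (t l)) a (t j)))
    (fun i a => p (update (update t j (s a)) l (s i)))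
    (by rw [hsplit j (t j) hjs, update_eq_self])
    (by rw [hsplit l (t l) hls, update_eq_self])
    (by rw [hsplit j (t l) hjs, hp, famDet_eq_zero _ (t := update t j (t l)) hjl, mul_zero]
        simp [hjl.symm])
    (by rw [hsplit l (t j) hls, hp, famDet_eq_zero _ (t := update t l (t j)) hjl, mul_zero]
        simp [hjl])
    (fun i hi a ha => by
      rw [hp, famDet_mul_famDet_update_update _ _ (hIK i hi a ha)])
    (fun i hi a ha => by
      rw [hp, famDet_mul_famDet_update_update _ _ hjl])
  have hρ : |∑ i ∈ I, ∑ a ∈ K, p (update (update s i (t l)) a (t j)) *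
      p (update (update t j (s a)) l (s i))| ≤ k * (k * (|p s| / α * M)) := by
    refine abs_sum_le_card_mul _ _ (by positivity) hIk fun i hi => ?_
    refine abs_sum_le_card_mul _ _ (by positivity) hKk fun a ha => ?_
    obtain ⟨h1, h2⟩ := hboth j r l c hj hrS hl hcS i hi a ha
    rw [abs_mul]
    exact mul_le_mul h1 h2 (abs_nonneg _) (by positivity)
  have hq : |∑ i ∈ I, ∑ a ∈ K, p (update (update s i (t l)) a (t j)) *
      (p (update t j (s a)) * p (update t l (s i)))| ≤ k * (k * (|p s| / α * (M * M))) := by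
    refine abs_sum_le_card_mul _ _ (by positivity) hIk fun i hi => ?_
    refine abs_sum_le_card_mul _ _ (by positivity) hKk fun a ha => ?_
    rw [abs_mul, abs_mul]
    exact mul_le_mul (hboth j r l c hj hrS hl hcS i hi a ha).1
      (mul_le_mul (hrow j r hj hrS a ha).2 (hcol l c hl hcS i hi).2 (abs_nonneg _) hM0)
      (by positivity) (by positivity)
  refine le_of_mul_le_mul_left ?_ hd'
  rw [← abs_pow, ← abs_mul, key]
  calc _ ≤ |p t| * (k * (|p s| / α * M) + k * (|p s| / α * M)) +
        |p t| * (k * (k * (|p s| / α * M))) + 2 * (k * (k * (|p s| / α * (M * M)))) := by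
        refine (abs_sub _ _).trans (add_le_add ((abs_add_le _ _).trans (add_le_add ?_ ?_)) ?_)
        · rw [abs_mul]
          exact mul_le_mul_of_nonneg_left ((abs_add_le _ _).trans
            (add_le_add (hcol_sum l c hl hcS) (hrow_sum j r hj hrS))) (abs_nonneg _)
        · rw [abs_mul]
          exact mul_le_mul_of_nonneg_left hρ (abs_nonneg _)
        · rw [abs_mul, abs_two]
          exact mul_le_mul_of_nonneg_left hq zero_le_two
    _ = _ := by ring

/-- **Claim 4.4** (distance-reduction step, with the explicit constant `2k² + 8k`):
if `S` is a `(2, α)`-local maximum with `det A_S ≠ 0`, then for every index pair `T`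
there is an index pair `W` with `d(S, W) ≤ max(0, d(S, T) - 1)` and
`|det A_T| ≤ ((2k² + 8k)/α) * |det A_W|`.
The distance `d(S,T)` is `(|S_R Δ T_R| + |S_C Δ T_C|) / 2` (the division is exact),
and `max(0, d - 1)` is truncated subtraction on `ℕ`. -/
theorem distance_reduction {k m n : ℕ} (hk : 1 ≤ k) (hm : k ≤ m) (hn : k ≤ n)
    (A : Matrix (Fin m) (Fin n) ℝ) (α : ℝ) (hα : 0 < α)
    (SR : Finset (Fin m)) (SC : Finset (Fin n))
    (hSR : SR.card = k) (hSC : SC.card = k)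
    (hS0 : subdet A SR SC ≠ 0)
    (hloc : ∀ (TR : Finset (Fin m)) (TC : Finset (Fin n)),
      TR.card = k → TC.card = k →
      (symmDiff SR TR).card + (symmDiff SC TC).card ≤ 2 * 2 →
      α * |subdet A TR TC| ≤ |subdet A SR SC|) :
    ∀ (TR : Finset (Fin m)) (TC : Finset (Fin n)), TR.card = k → TC.card = k →
      ∃ (WR : Finset (Fin m)) (WC : Finset (Fin n)),
        WR.card = k ∧ WC.card = k ∧
        ((symmDiff SR WR).card + (symmDiff SC WC).card) / 2 ≤
          ((symmDiff SR TR).card + (symmDiff SC TC).card) / 2 - 1 ∧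
        |subdet A TR TC| ≤ ((2 * (k : ℝ) ^ 2 + 8 * k) / α) * |subdet A WR WC| := by
  intro TR TC hTR hTC
  have hSpos : 0 < |subdet A SR SC| := abs_pos.2 hS0
  have hk' : (1 : ℝ) ≤ k := by exact_mod_cast hk
  have hα1 : α ≤ 1 := by
    have := hloc SR SC hSR hSC (by simp)
    exact (mul_le_iff_le_one_left hSpos).1 this
  have hC1 : 1 ≤ (2 * (k : ℝ) ^ 2 + 8 * k) / α := by
    rw [le_div_iff₀ hα]
    nlinarith
  by_cases hne : SR ≠ TR ∨ SC ≠ TC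
  swap
  · push Not at hne
    obtain ⟨rfl, rfl⟩ := hne
    exact ⟨SR, SC, hSR, hSC, by simp, le_mul_of_one_le_left (abs_nonneg _) hC1⟩
  by_contra! hcon
  set C : ℝ := 2 * (k : ℝ) ^ 2 + 8 * k with hC
  set e := |subdet A TR TC| with he
  have hCpos : 0 < C := by positivity
  have he0 : 0 ≤ e := abs_nonneg _
  have hW : ∀ (WR : Finset (Fin m)) (WC : Finset (Fin n)), WR.card = k → WC.card = k →
      (symmDiff SR WR).card + (symmDiff SC WC).card + 2 ≤
        (symmDiff SR TR).card + (symmDiff SC TC).card → C / α * |subdet A WR WC| < e :=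
    fun WR WC hWR hWC h => hcon WR WC hWR hWC (by omega)
  have hepos : 0 < e := by
    refine (mul_nonneg (by positivity) (abs_nonneg (subdet A SR SC))).trans_lt
      (hcon SR SC hSR hSC (by simp))
  have hsq := sq_subdet_le A (M := e * α / C) hα (by positivity) hSR hSC hTR hTC hS0
    (fun WR WC hWR hWC h => by
      rw [le_div_iff₀' hα]
      exact hloc WR WC hWR hWC h)
    (fun WR WC hWR hWC h => by
      rw [le_div_iff₀' hCpos]
      have := hW WR WC hWR hWC h
      rw [div_mul_eq_mul_div, div_lt_iff₀ hα] at this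
      exact this.le) hne
  rw [← he] at hsq
  have hrw : e * ((k ^ 2 + 2 * k) * (e * α / C) / α) + 2 * k ^ 2 * (e * α / C) ^ 2 / α =
      e ^ 2 * (((k ^ 2 + 2 * k) * C + 2 * k ^ 2 * α) / C ^ 2) := by
    field_simp
  rw [hrw] at hsq
  have hlt : ((k ^ 2 + 2 * k) * C + 2 * k ^ 2 * α) / C ^ 2 < 1 := by
    rw [div_lt_one (by positivity)]
    have h1 : 2 * (k : ℝ) ^ 2 * α ≤ C := by nlinarith [sq_nonneg (k : ℝ)]
    nlinarith
  nlinarith [mul_lt_mul_of_pos_left hlt (pow_pos hepos 2)]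
end

section
/- (Extended Plücker relation in the disjoint case, Lemma 5.1.) Let k ≥ 1 and A ∈ ℝ^{2k×2k}, with rows and columns indexed by {1,…,2k}. Let S_R = S_C = {1,…,k} and T_R = T_C = {k+1,…,2k}, and write [I,J] := det(A_{I,J}) for index sets I, J of size k. Define: s₁ = Σ_{i,j ∈ {1,…,k}, i',j' ∈ {k+1,…,2k}} (−1)^{i+j+i'+j'} [S_R Δ {i,i'}, S_C Δ {j,j'}] · [T_R Δ {i,i'}, T_C Δ {j,j'}]; s₂ = (−1)^k Σ_{i ∈ {1,…,k}, i' ∈ {k+1,…,2k}} (−1)^{i+i'+k} [S_R Δ {i,i'}, S_C] · [T_R Δ {i,i'}, T_C]; s₃ = Σ_{i<h in {1,…,k}, i'<h' in {k+1,…,2k}} (−1)^{i+h+i'+h'} [S_R Δ {i,h,i',h'}, S_C] · [T_R Δ {i,h,i',h'}, T_C]. Then s₁ − 2(k−1)·s₂ − 4·s₃ − k²·[S_R, S_C]·[T_R, T_C] = 0. -/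
open Finset

/-! ### The sign of a shuffle -/

/-- The permutation listing `R` in increasing order, followed by `Rᶜ` in increasing order. -/
def shufflePerm {a b : ℕ} (R : Finset (Fin (a + b))) (ha : #R = a) (hb : #Rᶜ = b) :
    Equiv.Perm (Fin (a + b)) :=
  finSumFinEquiv.symm.trans (finSumEquivOfFinset ha hb)

lemma shufflePerm_castAdd {a b : ℕ} (R : Finset (Fin (a + b))) (ha : #R = a) (hb : #Rᶜ = b)
    (i : Fin a) : shufflePerm R ha hb (Fin.castAdd b i) = R.orderEmbOfFin ha i := by
  simp [shufflePerm]

lemma shufflePerm_natAdd {a b : ℕ} (R : Finset (Fin (a + b))) (ha : #R = a) (hb : #Rᶜ = b)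
    (i : Fin b) : shufflePerm R ha hb (Fin.natAdd a i) = Rᶜ.orderEmbOfFin hb i := by
  simp [shufflePerm]

lemma prod_orderEmbOfFin {n a : ℕ} {M : Type*} [CommMonoid M] (R : Finset (Fin n)) (ha : #R = a)
    (f : Fin n → M) : ∏ i, f (R.orderEmbOfFin ha i) = ∏ x ∈ R, f x := by
  rw [← Finset.prod_coe_sort R]
  exact Fintype.prod_equiv (R.orderIsoOfFin ha).toEquiv _ _ fun _ => rfl

lemma sign_shufflePerm_eq_prod_prod {a b : ℕ} (R : Finset (Fin (a + b))) (ha : #R = a)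
    (hb : #Rᶜ = b) :
    Equiv.Perm.sign (shufflePerm R ha hb) =
      ∏ y ∈ Rᶜ, ∏ x ∈ R, if x < y then (1 : ℤˣ) else -1 := by
  rw [Equiv.Perm.sign_eq_prod_prod_Iio]
  simp_rw [← Finset.filter_gt_eq_Iio, Finset.prod_filter, Fin.prod_univ_add,
    shufflePerm_castAdd, shufflePerm_natAdd]
  have hlt (i : Fin a) (j : Fin b) : Fin.castAdd b i < Fin.natAdd a j := by
    simp only [Fin.lt_def, Fin.val_castAdd, Fin.val_natAdd]; omega
  have hcast (i j : Fin a) : Fin.castAdd b i < Fin.castAdd b j ↔ i < j := Iff.rfl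
  simp only [OrderEmbedding.lt_iff_lt, (hlt _ _).not_gt, hlt, if_true, if_false, prod_const_one,
    mul_one, Fin.natAdd_lt_natAdd_iff, hcast]
  have h1 (m : ℕ) (i j : Fin m) :
      (if i < j then if i < j then (1 : ℤˣ) else -1 else 1) = 1 := by
    split_ifs <;> rfl
  simp only [h1, prod_const_one, one_mul, mul_one]
  rw [← prod_orderEmbOfFin Rᶜ hb]
  refine Finset.prod_congr rfl fun j _ => ?_
  rw [← prod_orderEmbOfFin R ha]

lemma prod_Iio_neg_one {n : ℕ} (x : Fin n) :
    ∏ y, (if y < x then (-1 : ℤˣ) else 1) = (-1) ^ (x : ℕ) := by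
  rw [← Finset.prod_filter, Finset.prod_const, Finset.filter_gt_eq_Iio, Fin.card_Iio]

lemma sign_shufflePerm {a b : ℕ} (R : Finset (Fin (a + b))) (ha : #R = a) (hb : #Rᶜ = b) :
    Equiv.Perm.sign (shufflePerm R ha hb) =
      (∏ i : Fin a, (-1) ^ (i : ℕ)) * ∏ x ∈ R, (-1) ^ (x : ℕ) := by
  have hR : ∏ x ∈ R, ∏ y ∈ R, (if y < x then (-1 : ℤˣ) else 1) =
      ∏ i : Fin a, (-1) ^ (i : ℕ) := by
    rw [← prod_orderEmbOfFin R ha]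
    refine Finset.prod_congr rfl fun i _ => ?_
    rw [← prod_orderEmbOfFin R ha, ← prod_Iio_neg_one]
    simp only [OrderEmbedding.lt_iff_lt]
  rw [sign_shufflePerm_eq_prod_prod, ← hR, ← Finset.prod_mul_distrib, Finset.prod_comm]
  refine Finset.prod_congr rfl fun x hx => ?_
  rw [← prod_Iio_neg_one, ← Finset.prod_mul_prod_compl R, ← mul_assoc, Int.units_mul_self,
    one_mul]
  refine Finset.prod_congr rfl fun y hy => ?_
  have hne : x ≠ y := by rintro rfl; exact (Finset.mem_compl.1 hy) hx
  rcases lt_or_gt_of_ne hne with h | h <;> simp [h, h.not_gt]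

/-! ### Laplace expansion over permutations carrying one index set to another -/

lemma det_block_eq_sum {n : ℕ} (A : Matrix (Fin n) (Fin n) ℝ) (R C : Finset (Fin n)) :
    (Matrix.of fun i j => if (i ∈ R ↔ j ∈ C) then A i j else 0).det =
      ∑ σ : Equiv.Perm (Fin n), if C.map σ.toEmbedding = R then
        ((Equiv.Perm.sign σ : ℤ) : ℝ) * ∏ i, A (σ i) i else 0 := by
  rw [Matrix.det_apply']
  refine Finset.sum_congr rfl fun σ _ => ?_
  have hiff : C.map σ.toEmbedding = R ↔ ∀ i, (σ i ∈ R ↔ i ∈ C) := by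
    constructor
    · rintro rfl i
      simp
    · intro h
      ext x
      obtain ⟨y, rfl⟩ := σ.surjective x
      simp [h]
  simp only [Matrix.of_apply]
  split_ifs with h
  · congr 1
    exact Finset.prod_congr rfl fun i _ => if_pos (hiff.1 h i)
  · rw [hiff, not_forall] at h
    obtain ⟨i, hi⟩ := h
    rw [Finset.prod_eq_zero (Finset.mem_univ i) (if_neg hi), mul_zero]

lemma subdet_eq {m n a : ℕ} (A : Matrix (Fin m) (Fin n) ℝ) (R : Finset (Fin m))
    (C : Finset (Fin n)) (hR : #R = a) (hC : #C = a) :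
    subdet A R C = (A.submatrix (R.orderEmbOfFin hR) (C.orderEmbOfFin hC)).det := by
  subst hR
  rw [subdet, dif_pos hC.symm]

lemma subdet_mul_subdet_compl {n : ℕ} (A : Matrix (Fin n) (Fin n) ℝ) (R C : Finset (Fin n))
    (h : #R = #C) :
    (∏ x ∈ R, (-1 : ℝ) ^ (x : ℕ)) * (∏ x ∈ C, (-1 : ℝ) ^ (x : ℕ)) *
        (subdet A R C * subdet A Rᶜ Cᶜ) =
      ∑ σ : Equiv.Perm (Fin n), if C.map σ.toEmbedding = R then
        ((Equiv.Perm.sign σ : ℤ) : ℝ) * ∏ i, A (σ i) i else 0 := by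
  obtain ⟨a, hC⟩ : ∃ a, #C = a := ⟨_, rfl⟩
  obtain ⟨b, hC'⟩ : ∃ b, #Cᶜ = b := ⟨_, rfl⟩
  obtain rfl : a + b = n := by
    rw [← hC, ← hC', Finset.card_add_card_compl, Fintype.card_fin]
  have hR : #R = a := h.trans hC
  have hR' : #Rᶜ = b := by
    exact (by rw [Finset.card_compl, Finset.card_compl, h] : #Rᶜ = #Cᶜ).trans hC'
  rw [← det_block_eq_sum, subdet_eq A R C hR hC, subdet_eq A Rᶜ Cᶜ hR' hC']
  set B : Matrix (Fin (a + b)) (Fin (a + b)) ℝ :=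
    Matrix.of fun i j => if (i ∈ R ↔ j ∈ C) then A i j else 0 with hB
  have hblock : (B.submatrix (shufflePerm R hR hR') (shufflePerm C hC hC')).submatrix
      finSumFinEquiv finSumFinEquiv =
      Matrix.fromBlocks (A.submatrix (R.orderEmbOfFin hR) (C.orderEmbOfFin hC)) 0 0
        (A.submatrix (Rᶜ.orderEmbOfFin hR') (Cᶜ.orderEmbOfFin hC')) := by
    have hmem (S : Finset (Fin (a + b))) (c : ℕ) (hS : #S = c) (i) : S.orderEmbOfFin hS i ∈ S :=
      S.orderEmbOfFin_mem hS i
    have hnot (S : Finset (Fin (a + b))) (c : ℕ) (hS : #Sᶜ = c) (i) :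
        Sᶜ.orderEmbOfFin hS i ∉ S :=
      Finset.mem_compl.1 (Sᶜ.orderEmbOfFin_mem hS i)
    ext (i | i) (j | j) <;>
      simp [hB, shufflePerm_castAdd, shufflePerm_natAdd, hmem, hnot]
  have hsub : B.submatrix (shufflePerm R hR hR') (shufflePerm C hC hC') =
      (B.submatrix (shufflePerm R hR hR') id).submatrix id (shufflePerm C hC hC') := rfl
  have hdet := congrArg Matrix.det hblock
  rw [Matrix.det_submatrix_equiv_self, Matrix.det_fromBlocks_zero₂₁, hsub, Matrix.det_permute',
    Matrix.det_permute, sign_shufflePerm, sign_shufflePerm] at hdet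
  rw [← hdet]
  have hsq {s : Finset (Fin (a + b))} :
      (∏ x ∈ s, (-1 : ℝ) ^ (x : ℕ)) * ∏ x ∈ s, (-1 : ℝ) ^ (x : ℕ) = 1 := by
    rw [← Finset.prod_mul_distrib]
    exact Finset.prod_eq_one fun x _ => by rw [← mul_pow]; simp
  have hsq' : (∏ i : Fin a, (-1 : ℝ) ^ (i : ℕ)) * ∏ i : Fin a, (-1 : ℝ) ^ (i : ℕ) = 1 := by
    rw [← Finset.prod_mul_distrib]
    exact Finset.prod_eq_one fun x _ => by rw [← mul_pow]; simp
  push_cast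
  linear_combination B.det * hsq (s := R) +
    B.det * (∏ x ∈ R, (-1 : ℝ) ^ (x : ℕ)) ^ 2 * (hsq (s := C)) +
    B.det * (∏ x ∈ R, (-1 : ℝ) ^ (x : ℕ)) ^ 2 * (∏ x ∈ C, (-1 : ℝ) ^ (x : ℕ)) ^ 2 * hsq'

/-! ### Signs and complements of symmetric differences -/

lemma prod_symmDiff_neg_one_pow {n : ℕ} (S D : Finset (Fin n)) :
    ∏ x ∈ symmDiff S D, (-1 : ℝ) ^ (x : ℕ) =
      (∏ x ∈ S, (-1 : ℝ) ^ (x : ℕ)) * ∏ x ∈ D, (-1 : ℝ) ^ (x : ℕ) := by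
  simp_rw [← Finset.prod_ite_mem_eq _ (fun x : Fin n => (-1 : ℝ) ^ (x : ℕ)),
    ← Finset.prod_mul_distrib]
  refine Finset.prod_congr rfl fun x _ => ?_
  have : (-1 : ℝ) ^ (x : ℕ) * (-1 : ℝ) ^ (x : ℕ) = 1 := by rw [← mul_pow]; simp
  by_cases h1 : x ∈ S <;> by_cases h2 : x ∈ D <;> simp [Finset.mem_symmDiff, h1, h2, this]

lemma symmDiff_compl_left {n : ℕ} (S D : Finset (Fin n)) :
    symmDiff Sᶜ D = (symmDiff S D)ᶜ := by
  ext x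
  simp only [Finset.mem_symmDiff, Finset.mem_compl]
  tauto

/-! ### Counting exchanges -/

lemma symmDiff_union_eq {α : Type*} [DecidableEq α] {S D D' : Finset α} (hD : D ⊆ S)
    (hD' : Disjoint D' S) : symmDiff S (D ∪ D') = S \ D ∪ D' := by
  ext x
  have h1 := @hD x
  have h2 : x ∈ D' → x ∉ S := fun h => Finset.disjoint_left.1 hD' h
  simp only [Finset.mem_symmDiff, Finset.mem_union, Finset.mem_sdiff]
  tauto

lemma eq_symmDiff_union_iff {α : Type*} [DecidableEq α] {S D D' Y : Finset α} (hD : D ⊆ S)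
    (hD' : Disjoint D' S) : Y = symmDiff S (D ∪ D') ↔ S \ Y = D ∧ Y \ S = D' := by
  rw [symmDiff_union_eq hD hD']
  constructor
  · rintro rfl
    constructor <;> ext x <;> have h1 := @hD x <;>
      have h2 : x ∈ D' → x ∉ S := fun h => Finset.disjoint_left.1 hD' h
    all_goals
      simp only [Finset.mem_union, Finset.mem_sdiff]
      tauto
  · rintro ⟨rfl, rfl⟩
    ext x
    simp only [Finset.mem_union, Finset.mem_sdiff]
    tauto

lemma sum_symmDiff_union {α : Type*} [DecidableEq α] {S D D' : Finset α} (hD : D ⊆ S)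
    (hD' : Disjoint D' S) (f : α → ℕ) :
    ∑ x ∈ symmDiff S (D ∪ D'), f x + ∑ x ∈ D, f x = ∑ x ∈ S, f x + ∑ x ∈ D', f x := by
  rw [symmDiff_union_eq hD hD', Finset.sum_union
    (Finset.disjoint_of_subset_left Finset.sdiff_subset hD'.symm), add_right_comm,
    Finset.sum_sdiff hD]

lemma card_symmDiff_union {α : Type*} [DecidableEq α] {S D D' : Finset α} (hD : D ⊆ S)
    (hD' : Disjoint D' S) (h : #D = #D') : #(symmDiff S (D ∪ D')) = #S := by
  have := sum_symmDiff_union hD hD' fun _ => 1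
  simp only [Finset.sum_const, smul_eq_mul, mul_one] at this
  omega

lemma sum_ite_eq_singleton {α : Type*} [DecidableEq α] {S B : Finset α} (hB : B ⊆ S) :
    ∑ j ∈ S, (if B = {j} then (1 : ℝ) else 0) = if #B = 1 then 1 else 0 := by
  split_ifs with h
  · obtain ⟨b, rfl⟩ := Finset.card_eq_one.1 h
    have hb : b ∈ S := hB (Finset.mem_singleton_self b)
    simp [Finset.singleton_inj, hb]
  · refine Finset.sum_eq_zero fun j _ => if_neg ?_
    rintro rfl
    exact h (Finset.card_singleton j)

lemma sum_ite_eq_pair {α : Type*} [LinearOrder α] {S B : Finset α} (hB : B ⊆ S) :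
    ∑ i ∈ S, ∑ h ∈ S with i < h, (if B = {i, h} then (1 : ℝ) else 0) =
      if #B = 2 then 1 else 0 := by
  split_ifs with hc
  · obtain ⟨x, y, hxy, rfl⟩ : ∃ x y, x < y ∧ B = {x, y} := by
      obtain ⟨x, y, hxy, rfl⟩ := Finset.card_eq_two.1 hc
      rcases lt_or_gt_of_ne hxy with h | h
      · exact ⟨x, y, h, rfl⟩
      · exact ⟨y, x, h, Finset.pair_comm x y⟩
    have hx : x ∈ S := hB (by simp)
    have hy : y ∈ S := hB (by simp)
    have key (i h : α) (hih : i < h) : ({x, y} : Finset α) = {i, h} ↔ i = x ∧ h = y := by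
      refine ⟨fun e => ?_, by rintro ⟨rfl, rfl⟩; rfl⟩
      have h1 : i ∈ ({x, y} : Finset α) := by simp [e]
      have h2 : h ∈ ({x, y} : Finset α) := by simp [e]
      simp only [Finset.mem_insert, Finset.mem_singleton] at h1 h2
      grind
    rw [Finset.sum_eq_single_of_mem x hx, Finset.sum_eq_single_of_mem y (by simp [hy, hxy])]
    · simp
    · intro h hh hne
      rw [if_neg]
      rw [key x h (Finset.mem_filter.1 hh).2]
      exact fun e => hne e.2
    · intro i _ hne
      refine Finset.sum_eq_zero fun h hh => if_neg ?_
      rw [key i h (Finset.mem_filter.1 hh).2]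
      exact fun e => hne e.1
  · refine Finset.sum_eq_zero fun i _ => Finset.sum_eq_zero fun h hh => if_neg ?_
    rintro rfl
    exact hc (Finset.card_pair (Finset.mem_filter.1 hh).2.ne)

lemma pair_eq_union {α : Type*} [DecidableEq α] (i i' : α) :
    ({i, i'} : Finset α) = {i} ∪ {i'} := rfl

lemma quadruple_eq_union {α : Type*} [DecidableEq α] (i h i' h' : α) :
    ({i, h, i', h'} : Finset α) = {i, h} ∪ {i', h'} := by
  ext x; simp only [Finset.mem_union, Finset.mem_insert, Finset.mem_singleton, or_assoc]

lemma sum_single_exchange {α : Type*} [Fintype α] [DecidableEq α] {S Y : Finset α}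
    (hY : #Y = #S) :
    ∑ i ∈ S, ∑ i' ∈ Sᶜ, (if Y = symmDiff S {i, i'} then (1 : ℝ) else 0) =
      if #(Y \ S) = 1 then 1 else 0 := by
  have hS : S \ Y ⊆ S := Finset.sdiff_subset
  have hT : Y \ S ⊆ Sᶜ := fun x hx => by simp_all
  have hprod : ∀ i ∈ S, ∀ i' ∈ Sᶜ, (if Y = symmDiff S {i, i'} then (1 : ℝ) else 0) =
      (if S \ Y = {i} then 1 else 0) * if Y \ S = {i'} then 1 else 0 := by
    intro i hi i' hi'
    rw [pair_eq_union, ite_zero_mul_ite_zero, mul_one]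
    simp only [eq_symmDiff_union_iff (Finset.singleton_subset_iff.2 hi)
      (Finset.disjoint_singleton_left.2 (Finset.mem_compl.1 hi'))]
  rw [Finset.sum_congr rfl fun i hi => Finset.sum_congr rfl (hprod i hi), ← Finset.sum_mul_sum,
    sum_ite_eq_singleton hS, sum_ite_eq_singleton hT, Finset.card_sdiff_comm hY.symm]
  split_ifs <;> simp

lemma sum_double_exchange {α : Type*} [Fintype α] [LinearOrder α] {S Y : Finset α}
    (hY : #Y = #S) :
    ∑ i ∈ S, ∑ h ∈ S with i < h, ∑ i' ∈ Sᶜ, ∑ h' ∈ Sᶜ with i' < h',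
        (if Y = symmDiff S {i, h, i', h'} then (1 : ℝ) else 0) =
      if #(Y \ S) = 2 then 1 else 0 := by
  have hS : S \ Y ⊆ S := Finset.sdiff_subset
  have hT : Y \ S ⊆ Sᶜ := fun x hx => by simp_all
  have hprod : ∀ i ∈ S, ∀ h ∈ S.filter (i < ·), ∀ i' ∈ Sᶜ, ∀ h' ∈ Sᶜ.filter (i' < ·),
      (if Y = symmDiff S {i, h, i', h'} then (1 : ℝ) else 0) =
      (if S \ Y = {i, h} then 1 else 0) * if Y \ S = {i', h'} then 1 else 0 := by
    intro i hi h hh i' hi' h' hh'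
    have hD : ({i, h} : Finset α) ⊆ S := by
      simp [Finset.insert_subset_iff, hi, (Finset.mem_filter.1 hh).1]
    have hD' : Disjoint ({i', h'} : Finset α) S := by
      simp [Finset.mem_compl.1 hi', Finset.mem_compl.1 (Finset.mem_filter.1 hh').1]
    rw [quadruple_eq_union, ite_zero_mul_ite_zero, mul_one]
    simp only [eq_symmDiff_union_iff hD hD']
  rw [Finset.sum_congr rfl fun i hi => Finset.sum_congr rfl fun h hh =>
    Finset.sum_congr rfl fun i' hi' => Finset.sum_congr rfl (hprod i hi h hh i' hi')]
  simp_rw [← Finset.mul_sum]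
  rw [sum_ite_eq_pair hT]
  simp_rw [← Finset.sum_mul]
  rw [sum_ite_eq_pair hS, Finset.card_sdiff_comm hY.symm]
  split_ifs <;> simp

lemma sum_comp_zero_one {α : Type*} (S : Finset α) (u : α → ℕ) (hu : ∀ x, u x = 0 ∨ u x = 1)
    (g : ℕ → ℝ) :
    ∑ x ∈ S, g (u x) = (∑ x ∈ S, u x : ℕ) * g 1 + (#S - (∑ x ∈ S, u x : ℕ)) * g 0 := by
  have h (x : α) : g (u x) = u x * g 1 + (1 - u x) * g 0 := by
    rcases hu x with h | h <;> simp [h]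
  simp_rw [h, Finset.sum_add_distrib, ← Finset.sum_mul, Finset.sum_sub_distrib]
  simp

/-- The intersection numbers of the Johnson graph `J(2k, k)` for pairs of neighbours. -/
lemma card_common_exchange {α : Type*} [Fintype α] [LinearOrder α] {k : ℕ} {S : Finset α}
    (hS : #S = k) (hS' : #Sᶜ = k) (σ : Equiv.Perm α) :
    ∑ j ∈ S, ∑ j' ∈ Sᶜ, ∑ i ∈ S, ∑ i' ∈ Sᶜ,
        (if (symmDiff S {j, j'}).map σ.toEmbedding = symmDiff S {i, i'} then (1 : ℝ) else 0) =
      2 * ((k : ℝ) - 1) * (∑ i ∈ S, ∑ i' ∈ Sᶜ,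
        if S.map σ.toEmbedding = symmDiff S {i, i'} then 1 else 0) +
      4 * (∑ i ∈ S, ∑ h ∈ S with i < h, ∑ i' ∈ Sᶜ, ∑ h' ∈ Sᶜ with i' < h',
        if S.map σ.toEmbedding = symmDiff S {i, h, i', h'} then 1 else 0) +
      (k : ℝ) ^ 2 * if S.map σ.toEmbedding = S then 1 else 0 := by
  set u : α → ℕ := fun x => if σ x ∈ S then 0 else 1 with hu
  have hu01 (x : α) : u x = 0 ∨ u x = 1 := by
    simp only [hu]; split_ifs <;> simp
  have hcard (C : Finset α) : #(C.map σ.toEmbedding \ S) = ∑ x ∈ C, u x := by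
    rw [Finset.sdiff_eq_filter, Finset.card_filter, Finset.sum_map]
    refine Finset.sum_congr rfl fun x _ => ?_
    simp [hu, ite_not]
  have huniv : ∑ x ∈ S, u x + ∑ x ∈ Sᶜ, u x = k := by
    rw [Finset.sum_add_sum_compl, ← hcard, ← hS', Finset.map_univ_equiv,
      ← Finset.compl_eq_univ_sdiff]
  rw [sum_single_exchange (by simp), sum_double_exchange (by simp), hcard]
  have hself : S.map σ.toEmbedding = S ↔ ∑ x ∈ S, u x = 0 := by
    rw [← hcard, Finset.card_eq_zero, Finset.sdiff_eq_empty_iff_subset]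
    exact ⟨fun h => h.subset, fun h => Finset.eq_of_subset_of_card_le h (by simp)⟩
  have hinner : ∀ j ∈ S, ∀ j' ∈ Sᶜ, ∑ i ∈ S, ∑ i' ∈ Sᶜ,
      (if (symmDiff S {j, j'}).map σ.toEmbedding = symmDiff S {i, i'} then (1 : ℝ) else 0) =
      if ∑ x ∈ S, u x + u j' = 1 + u j then 1 else 0 := by
    intro j hj j' hj'
    have hD := Finset.singleton_subset_iff.2 hj
    have hD' := Finset.disjoint_singleton_left.2 (Finset.mem_compl.1 hj')
    have hsum := sum_symmDiff_union hD hD' u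
    rw [Finset.sum_singleton, Finset.sum_singleton] at hsum
    rw [sum_single_exchange (by
      rw [Finset.card_map, pair_eq_union, card_symmDiff_union hD hD' rfl]), hcard, pair_eq_union]
    congr 1
    rw [← hsum, eq_iff_iff]
    omega
  rw [Finset.sum_congr rfl fun j hj => Finset.sum_congr rfl (hinner j hj)]
  simp only [hself]
  have hT := fun v => sum_comp_zero_one Sᶜ u hu01
    fun v' => if ∑ x ∈ S, u x + v' = 1 + v then (1 : ℝ) else 0
  simp only [hT]
  have hS2 := sum_comp_zero_one S u hu01 fun v =>
    ((∑ x ∈ Sᶜ, u x : ℕ) : ℝ) * (if ∑ x ∈ S, u x + 1 = 1 + v then (1 : ℝ) else 0) +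
      ((#Sᶜ : ℝ) - (∑ x ∈ Sᶜ, u x : ℕ)) * (if ∑ x ∈ S, u x + 0 = 1 + v then (1 : ℝ) else 0)
  rw [hS2, hS, hS']
  generalize ∑ x ∈ S, u x = r at *
  generalize ∑ x ∈ Sᶜ, u x = t at *
  have hrt : (k : ℝ) = r + t := by rw [← huniv]; push_cast; rfl
  rw [hrt]
  obtain rfl | rfl | rfl | hr : r = 0 ∨ r = 1 ∨ r = 2 ∨ 3 ≤ r := by omega
  · simp; ring
  · simp; ring
  · simp; ring
  · have e1 : r ≠ 0 := by omega
    have e2 : r ≠ 1 := by omega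
    have e3 : r ≠ 2 := by omega
    have e4 : 1 + r ≠ 2 := by omega
    simp [e1, e2, e3, e4, add_comm r 1]

/-- **Extended Plücker relation in the disjoint case** (Lemma 5.1). Rows and columns of
`A ∈ ℝ^{2k×2k}` are indexed by `Fin (2k)`; `SR = {0,…,k−1}` plays the role of
`S_R = S_C = {1,…,k}` and `TR = {k,…,2k−1}` the role of `T_R = T_C = {k+1,…,2k}`
(0-based indexing preserves all sign parities). Then
`s₁ − 2(k−1)s₂ − 4s₃ − k²·[S_R,S_C]·[T_R,T_C] = 0`. -/
theorem extended_plucker_disjoint {k : ℕ} (hk : 1 ≤ k)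
    (A : Matrix (Fin (2 * k)) (Fin (2 * k)) ℝ)
    (SR TR : Finset (Fin (2 * k)))
    (hSR : ∀ x, x ∈ SR ↔ (x : ℕ) < k)
    (hTR : ∀ x, x ∈ TR ↔ k ≤ (x : ℕ))
    (s1 s2 s3 : ℝ)
    (hs1 : s1 = ∑ i ∈ SR, ∑ j ∈ SR, ∑ i' ∈ TR, ∑ j' ∈ TR,
      (-1 : ℝ) ^ ((i : ℕ) + (j : ℕ) + (i' : ℕ) + (j' : ℕ)) *
        (subdet A (symmDiff SR {i, i'}) (symmDiff SR {j, j'}) *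
          subdet A (symmDiff TR {i, i'}) (symmDiff TR {j, j'})))
    (hs2 : s2 = (-1 : ℝ) ^ k * ∑ i ∈ SR, ∑ i' ∈ TR,
      (-1 : ℝ) ^ ((i : ℕ) + (i' : ℕ) + k) *
        (subdet A (symmDiff SR {i, i'}) SR * subdet A (symmDiff TR {i, i'}) TR))
    (hs3 : s3 = ∑ i ∈ SR, ∑ h ∈ SR.filter (fun h => i < h),
        ∑ i' ∈ TR, ∑ h' ∈ TR.filter (fun h' => i' < h'),
      (-1 : ℝ) ^ ((i : ℕ) + (h : ℕ) + (i' : ℕ) + (h' : ℕ)) *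
        (subdet A (symmDiff SR {i, h, i', h'}) SR *
          subdet A (symmDiff TR {i, h, i', h'}) TR)) :
    s1 - 2 * ((k : ℝ) - 1) * s2 - 4 * s3 -
      (k : ℝ) ^ 2 * (subdet A SR SR * subdet A TR TR) = 0 := by
  obtain rfl : TR = SRᶜ := by ext x; simp [hSR, hTR]
  have hcS : #SR = k := by
    have : SR = (Finset.univ : Finset (Fin (2 * k))).filter fun x : Fin (2 * k) => (x : ℕ) < k := by
      ext x; simp [hSR]
    rw [this, Fin.card_filter_val_lt]
    omega
  have hcT : #SRᶜ = k := by rw [Finset.card_compl, Fintype.card_fin, hcS]; omega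
  set w : Equiv.Perm (Fin (2 * k)) → ℝ := fun σ =>
    ((Equiv.Perm.sign σ : ℤ) : ℝ) * ∏ i, A (σ i) i
  have hsq : (∏ x ∈ SR, (-1 : ℝ) ^ (x : ℕ)) * ∏ x ∈ SR, (-1 : ℝ) ^ (x : ℕ) = 1 := by
    rw [← Finset.prod_mul_distrib]
    exact Finset.prod_eq_one fun x _ => by rw [← mul_pow]; simp
  have hG (D E : Finset (Fin (2 * k))) (hD : #(symmDiff SR D) = k) (hE : #(symmDiff SR E) = k) :
      (∏ x ∈ D, (-1 : ℝ) ^ (x : ℕ)) * (∏ x ∈ E, (-1 : ℝ) ^ (x : ℕ)) *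
        (subdet A (symmDiff SR D) (symmDiff SR E) *
          subdet A (symmDiff SRᶜ D) (symmDiff SRᶜ E)) =
      ∑ σ, w σ * if (symmDiff SR E).map σ.toEmbedding = symmDiff SR D then 1 else 0 := by
    have := subdet_mul_subdet_compl A _ _ (hD.trans hE.symm)
    rw [prod_symmDiff_neg_one_pow, prod_symmDiff_neg_one_pow, ← symmDiff_compl_left,
      ← symmDiff_compl_left] at this
    simp only [mul_ite, mul_one, mul_zero]
    rw [← this]
    linear_combination -(∏ x ∈ D, (-1 : ℝ) ^ (x : ℕ)) * (∏ x ∈ E, (-1 : ℝ) ^ (x : ℕ)) *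
        (subdet A (symmDiff SR D) (symmDiff SR E) *
          subdet A (symmDiff SRᶜ D) (symmDiff SRᶜ E)) * hsq
  have hsd (S : Finset (Fin (2 * k))) : symmDiff S ∅ = S := symmDiff_bot S
  have hempty : #(symmDiff SR ∅) = k := by rw [hsd, hcS]
  have hpair : ∀ i ∈ SR, ∀ i' ∈ SRᶜ, #(symmDiff SR {i, i'}) = k := fun i hi i' hi' => by
    rw [pair_eq_union, card_symmDiff_union (Finset.singleton_subset_iff.2 hi)
      (Finset.disjoint_singleton_left.2 (Finset.mem_compl.1 hi')) rfl, hcS]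
  have hne : ∀ i ∈ SR, ∀ i' ∈ SRᶜ, i ≠ i' := fun i hi i' hi' e =>
    Finset.mem_compl.1 hi' (e ▸ hi)
  have h0 : subdet A SR SR * subdet A SRᶜ SRᶜ =
      ∑ σ, w σ * if SR.map σ.toEmbedding = SR then 1 else 0 := by
    simpa [hsd] using hG ∅ ∅ hempty hempty
  have h1 : s1 = ∑ σ, w σ * ∑ j ∈ SR, ∑ j' ∈ SRᶜ, ∑ i ∈ SR, ∑ i' ∈ SRᶜ,
      if (symmDiff SR {j, j'}).map σ.toEmbedding = symmDiff SR {i, i'} then 1 else 0 := by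
    rw [hs1]
    simp_rw [Finset.mul_sum]
    rw [Finset.sum_comm, Finset.sum_comm (s := Finset.univ)]
    refine Finset.sum_congr rfl fun j hj => ?_
    rw [Finset.sum_comm (s := Finset.univ), Finset.sum_congr rfl fun i _ => Finset.sum_comm,
      Finset.sum_comm]
    refine Finset.sum_congr rfl fun j' hj' => ?_
    rw [Finset.sum_comm (s := Finset.univ)]
    refine Finset.sum_congr rfl fun i hi => ?_
    rw [Finset.sum_comm (s := Finset.univ)]
    refine Finset.sum_congr rfl fun i' hi' => ?_
    rw [← hG _ _ (hpair i hi i' hi') (hpair j hj j' hj'), Finset.prod_pair (hne i hi i' hi'),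
      Finset.prod_pair (hne j hj j' hj')]
    ring
  have h2 : s2 = ∑ σ, w σ * ∑ i ∈ SR, ∑ i' ∈ SRᶜ,
      if SR.map σ.toEmbedding = symmDiff SR {i, i'} then 1 else 0 := by
    rw [hs2]
    simp_rw [Finset.mul_sum]
    rw [Finset.sum_comm (s := Finset.univ)]
    refine Finset.sum_congr rfl fun i hi => ?_
    rw [Finset.sum_comm (s := Finset.univ)]
    refine Finset.sum_congr rfl fun i' hi' => ?_
    have := hG {i, i'} ∅ (hpair i hi i' hi') hempty
    simp only [hsd, Finset.prod_empty, mul_one] at this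
    rw [← this, Finset.prod_pair (hne i hi i' hi')]
    have hk2 : (-1 : ℝ) ^ k * (-1) ^ k = 1 := by rw [← mul_pow]; simp
    rw [pow_add, pow_add]
    linear_combination (-1 : ℝ) ^ (i : ℕ) * (-1) ^ (i' : ℕ) *
      (subdet A (symmDiff SR {i, i'}) SR * subdet A (symmDiff SRᶜ {i, i'}) SRᶜ) * hk2
  have h3 : s3 = ∑ σ, w σ * ∑ i ∈ SR, ∑ h ∈ SR with i < h, ∑ i' ∈ SRᶜ, ∑ h' ∈ SRᶜ with i' < h',
      if SR.map σ.toEmbedding = symmDiff SR {i, h, i', h'} then 1 else 0 := by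
    rw [hs3]
    simp_rw [Finset.mul_sum]
    rw [Finset.sum_comm (s := Finset.univ)]
    refine Finset.sum_congr rfl fun i hi => ?_
    rw [Finset.sum_comm (s := Finset.univ)]
    refine Finset.sum_congr rfl fun h hh => ?_
    rw [Finset.sum_comm (s := Finset.univ)]
    refine Finset.sum_congr rfl fun i' hi' => ?_
    rw [Finset.sum_comm (s := Finset.univ)]
    refine Finset.sum_congr rfl fun h' hh' => ?_
    obtain ⟨hh, hih⟩ := Finset.mem_filter.1 hh
    obtain ⟨hh', hih'⟩ := Finset.mem_filter.1 hh'
    have hsub : ({i, h} : Finset (Fin (2 * k))) ⊆ SR := by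
      simp [Finset.insert_subset_iff, hi, hh]
    have hdisj : Disjoint ({i', h'} : Finset (Fin (2 * k))) SR := by
      simp [Finset.mem_compl.1 hi', Finset.mem_compl.1 hh']
    have hcard : #(symmDiff SR {i, h, i', h'}) = k := by
      rw [quadruple_eq_union, card_symmDiff_union hsub hdisj
        (by rw [Finset.card_pair hih.ne, Finset.card_pair hih'.ne]), hcS]
    have := hG {i, h, i', h'} ∅ hcard hempty
    simp only [hsd, Finset.prod_empty, mul_one] at this
    rw [← this, quadruple_eq_union,
      Finset.prod_union (Finset.disjoint_of_subset_left hsub hdisj.symm),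
      Finset.prod_pair hih.ne, Finset.prod_pair hih'.ne]
    ring
  rw [h0, h1, h2, h3]
  simp_rw [card_common_exchange hcS hcT, Finset.mul_sum (s := Finset.univ),
    ← Finset.sum_sub_distrib]
  exact Finset.sum_eq_zero fun σ _ => by ring
end

section
/- (Extended Plücker relation in the general case, Lemma 5.4, first equation.) With the setup and definitions of s₁, s₂, ŝ₂, s₃, ŝ₃ given in the context: (k² − 2(k−1)r + 4·C(r,2) − rc) · [S_R,S_C]·[T_R,T_C] = s₁ − r·ŝ₂ − (2(k−1) + c − 4r)·s₂ − 4·s₃, where C(r,2) = r(r−1)/2. -/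
open Finset

/-- The sign of `x - y`, with value `1` on the diagonal. -/
def orderSign {α : Type*} [LinearOrder α] (x y : α) : ℝ := if x < y then -1 else 1

lemma orderSign_mul_self {α : Type*} [LinearOrder α] (x y : α) :
    orderSign x y * orderSign x y = 1 := by
  unfold orderSign; split_ifs <;> norm_num

lemma orderSign_mul_swap {α : Type*} [LinearOrder α] {x y : α} (h : x ≠ y) :
    orderSign x y * orderSign y x = -1 := by
  unfold orderSign
  rcases lt_or_gt_of_ne h with h | h <;> simp [h, h.not_gt]

/-- The parity of the position of `i` in `U`: the product of the signs of `x - i`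
over the other elements `x` of `U`. -/
def positionSign {α : Type*} [LinearOrder α] (U : Finset α) (i : α) : ℝ :=
  ∏ x ∈ U.erase i, orderSign x i

lemma positionSign_mul_self {α : Type*} [LinearOrder α] (U : Finset α) (i : α) :
    positionSign U i * positionSign U i = 1 := by
  simp [positionSign, ← Finset.prod_mul_distrib, orderSign_mul_self]

lemma positionSign_eq_pow {α : Type*} [LinearOrder α] (U : Finset α) (i : α) :
    positionSign U i = (-1) ^ (U.filter (· < i)).card := by
  have h : (U.erase i).filter (· < i) = U.filter (· < i) := by
    ext x; simp only [mem_filter, mem_erase]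
    exact ⟨fun h => ⟨h.1.2, h.2⟩, fun h => ⟨⟨h.2.ne, h.1⟩, h.2⟩⟩
  simp only [positionSign, orderSign]
  rw [Finset.prod_ite]
  simp [h]

/-- Replacing `i` by `i'` in `R` and `i'` by `i` in `Q` produces a total sign which only
depends on the symmetric difference of `R` and `Q`. -/
lemma prod_orderSign_mul_prod_orderSign {α : Type*} [LinearOrder α] {R Q : Finset α} {i i' : α}
    (hi : i ∈ R \ Q) (hi' : i' ∈ Q \ R) :
    (∏ x ∈ R.erase i, orderSign x i * orderSign x i') *
        (∏ x ∈ Q.erase i', orderSign x i' * orderSign x i) =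
      -(positionSign (symmDiff R Q) i * positionSign (symmDiff R Q) i') := by
  rw [mem_sdiff] at hi hi'
  have hne : i ≠ i' := fun h => hi.2 (h ▸ hi'.1)
  have hR : R.erase i = (R ∩ Q) ∪ (R \ Q).erase i := by
    ext x; simp only [mem_erase, mem_union, mem_inter, mem_sdiff]
    by_cases h : x = i
    · subst h; simp [hi.2]
    · simp only [h, ne_eq, not_false_eq_true, true_and]; tauto
  have hQ : Q.erase i' = (R ∩ Q) ∪ (Q \ R).erase i' := by
    ext x; simp only [mem_erase, mem_union, mem_inter, mem_sdiff]
    by_cases h : x = i'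
    · subst h; simp [hi'.2]
    · simp only [h, ne_eq, not_false_eq_true, true_and]; tauto
  have hU : (symmDiff R Q).erase i = insert i' ((R \ Q).erase i ∪ (Q \ R).erase i') := by
    ext x; simp only [mem_erase, mem_union, mem_insert, mem_symmDiff, mem_sdiff]
    by_cases h : x = i'
    · subst h; simp [hi'.2, hi'.1, hne.symm]
    · by_cases h2 : x = i
      · subst h2; simp [hi.2, h]
      · simp [h, h2]
  have hU' : (symmDiff R Q).erase i' = insert i ((R \ Q).erase i ∪ (Q \ R).erase i') := by
    ext x; simp only [mem_erase, mem_union, mem_insert, mem_symmDiff, mem_sdiff]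
    by_cases h : x = i
    · subst h; simp [hi.2, hi.1, hne]
    · by_cases h2 : x = i'
      · subst h2; simp [hi'.2, h]
      · simp [h, h2]
  have dR : Disjoint (R ∩ Q) ((R \ Q).erase i) := by
    rw [Finset.disjoint_left]; intro x; simp only [mem_inter, mem_erase, mem_sdiff]; tauto
  have dQ : Disjoint (R ∩ Q) ((Q \ R).erase i') := by
    rw [Finset.disjoint_left]; intro x; simp only [mem_inter, mem_erase, mem_sdiff]; tauto
  have dU : Disjoint ((R \ Q).erase i) ((Q \ R).erase i') := by
    rw [Finset.disjoint_left]; intro x; simp only [mem_erase, mem_sdiff]; tauto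
  have n1 : i' ∉ (R \ Q).erase i ∪ (Q \ R).erase i' := by simp [hi'.2]
  have n2 : i ∉ (R \ Q).erase i ∪ (Q \ R).erase i' := by simp [hi.2]
  have hI : (∏ x ∈ R ∩ Q, orderSign x i * orderSign x i') *
      (∏ x ∈ R ∩ Q, orderSign x i' * orderSign x i) = 1 := by
    rw [← Finset.prod_mul_distrib]
    refine Finset.prod_eq_one fun x _ => ?_
    linear_combination (orderSign x i' * orderSign x i') * orderSign_mul_self x i +
      orderSign_mul_self x i'
  have hs := orderSign_mul_swap hne
  unfold positionSign
  rw [hU, hU', hR, hQ, prod_union dR, prod_union dQ, prod_insert n1, prod_insert n2,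
    prod_union dU, prod_union dU]
  simp only [prod_mul_distrib] at hI ⊢
  linear_combination (∏ x ∈ (R \ Q).erase i, orderSign x i) *
    (∏ x ∈ (R \ Q).erase i, orderSign x i') * (∏ x ∈ (Q \ R).erase i', orderSign x i) *
    (∏ x ∈ (Q \ R).erase i', orderSign x i') * (hI + hs)

lemma subdet_eq_det {m n k : ℕ} (A : Matrix (Fin m) (Fin n) ℝ) {R : Finset (Fin m)}
    {C : Finset (Fin n)} (hR : R.card = k) (hC : C.card = k) :
    subdet A R C = (A.submatrix (R.orderEmbOfFin hR) (C.orderEmbOfFin hC)).det := by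
  subst hR
  simp [subdet, hC]

lemma subdet_transpose {m n k : ℕ} (A : Matrix (Fin m) (Fin n) ℝ) {R : Finset (Fin m)}
    {C : Finset (Fin n)} (hR : R.card = k) (hC : C.card = k) :
    subdet A.transpose C R = subdet A R C := by
  rw [subdet_eq_det A hR hC, subdet_eq_det A.transpose hC hR, ← Matrix.det_transpose,
    Matrix.transpose_submatrix, Matrix.transpose_transpose]

/-- Sorting the rows of a submatrix costs the sign of the inversions. -/
lemma det_submatrix_eq_prod_mul_subdet {m n k : ℕ} (A : Matrix (Fin m) (Fin n) ℝ)
    {u : Fin k → Fin m} (hu : Function.Injective u) {J : Finset (Fin m)}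
    (hJ : univ.image u = J) {C : Finset (Fin n)} (hC : C.card = k) :
    (A.submatrix u (C.orderEmbOfFin hC)).det =
      (∏ a, ∏ b ∈ Ioi a, (if u a < u b then 1 else -1 : ℝ)) * subdet A J C := by
  have hcard : J.card = k := by
    rw [← hJ, card_image_of_injective _ hu, card_univ, Fintype.card_fin]
  have hmem : ∀ a, u a ∈ J := fun a => hJ ▸ mem_image_of_mem u (mem_univ a)
  let f : Fin k → Fin k := fun a => (J.orderIsoOfFin hcard).symm ⟨u a, hmem a⟩
  have hf : ∀ a, J.orderEmbOfFin hcard (f a) = u a := by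
    intro a
    rw [← coe_orderIsoOfFin_apply]
    simp [f]
  have hfinj : Function.Injective f := fun a b h => hu (by rw [← hf a, ← hf b, h])
  let π : Equiv.Perm (Fin k) := Equiv.ofBijective f (Finite.injective_iff_bijective.mp hfinj)
  have hπ : ∀ a, J.orderEmbOfFin hcard (π a) = u a := hf
  have hsub : A.submatrix u (C.orderEmbOfFin hC) =
      (A.submatrix (J.orderEmbOfFin hcard) (C.orderEmbOfFin hC)).submatrix π id := by
    ext a b
    simp [hπ]
  rw [hsub, Matrix.det_permute, subdet_eq_det A hcard hC, Equiv.Perm.sign_eq_prod_prod_Ioi]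
  congr 1
  push_cast
  refine prod_congr rfl fun a _ => prod_congr rfl fun b _ => ?_
  rw [← hπ a, ← hπ b]
  simp only [OrderEmbedding.lt_iff_lt]
  split_ifs <;> simp

/-- The inversion sign of an increasing sequence in which one entry has been replaced. -/
lemma prod_inversions_update {m k : ℕ} {e : Fin k → Fin m} (he : StrictMono e) (p : Fin k)
    {x : Fin m} (hx : ∀ a, e a ≠ x) :
    (∏ a, ∏ b ∈ Ioi a,
        (if Function.update e p x a < Function.update e p x b then 1 else -1 : ℝ)) =
      ∏ b ∈ univ.erase p, orderSign (e b) (e p) * orderSign (e b) x := by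
  set t : Fin k → ℝ := fun b => orderSign (e b) (e p) * orderSign (e b) x with ht
  have hrow : ∀ a, (∏ b ∈ Ioi a,
      (if Function.update e p x a < Function.update e p x b then 1 else -1 : ℝ)) =
      (if a = p then ∏ b ∈ Ioi p, t b else 1) * (if a < p then t a else 1) := by
    intro a
    by_cases hap : a = p
    · subst hap
      simp only [if_true, lt_irrefl, if_false, mul_one]
      refine prod_congr rfl fun b hb => ?_
      have hb := mem_Ioi.mp hb
      have h1 := he hb
      simp only [Function.update_self, Function.update_of_ne hb.ne', ht, orderSign, h1.not_gt,
        if_false, one_mul]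
      rcases lt_or_gt_of_ne (hx b) with h | h <;> simp [h, h.not_gt]
    · simp only [hap, if_false, one_mul, Function.update_of_ne hap]
      by_cases hlt : a < p
      · rw [if_pos hlt, ← mul_prod_erase _ _ (mem_Ioi.mpr hlt), prod_eq_one, mul_one]
        · simp only [Function.update_self, ht, orderSign, he hlt, if_true]
          rcases lt_or_gt_of_ne (hx a) with h | h <;> simp [h, h.not_gt]
        · intro b hb
          rw [mem_erase, mem_Ioi] at hb
          rw [Function.update_of_ne hb.1, if_pos (he hb.2)]
      · rw [if_neg hlt]
        refine prod_eq_one fun b hb => ?_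
        have hb := mem_Ioi.mp hb
        have hbp : b ≠ p := fun h => hlt (h ▸ hb)
        rw [Function.update_of_ne hbp, if_pos (he hb)]
  have hsplit : (univ : Finset (Fin k)).erase p = Ioi p ∪ univ.filter (· < p) := by
    ext b; simp only [mem_erase, mem_univ, and_true, mem_union, mem_Ioi, mem_filter, true_and]
    rw [ne_iff_lt_or_gt, or_comm]
  have hdisj : Disjoint (Ioi p) (univ.filter (· < p)) := by
    rw [Finset.disjoint_left]; intro b hb hb'
    exact (mem_Ioi.mp hb).not_gt (mem_filter.mp hb').2
  rw [prod_congr rfl fun a _ => hrow a, prod_mul_distrib, prod_ite_eq' univ p, hsplit,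
    prod_union hdisj, prod_filter]
  simp [ht]

lemma symmDiff_pair_eq_insert_erase {α : Type*} [DecidableEq α] {R : Finset α} {i i' : α}
    (hi : i ∈ R) (hi' : i' ∉ R) : symmDiff R {i, i'} = insert i' (R.erase i) := by
  ext y
  simp only [mem_symmDiff, mem_insert, mem_singleton, mem_erase]
  by_cases h : y = i
  · subst h
    have : y ≠ i' := fun h => hi' (h ▸ hi)
    simp [hi, this]
  · by_cases h2 : y = i'
    · subst h2; simp [hi']
    · simp [h, h2]

lemma card_symmDiff_pair {α : Type*} [DecidableEq α] {R : Finset α} {i i' : α}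
    (hi : i ∈ R) (hi' : i' ∉ R) : (symmDiff R {i, i'}).card = R.card := by
  rw [symmDiff_pair_eq_insert_erase hi hi', card_insert_of_notMem (by simp [hi']),
    card_erase_add_one hi]

/-- Replacing the row `i` of a minor by a new row `i'`, and sorting. -/
lemma det_submatrix_update {m n k : ℕ} (A : Matrix (Fin m) (Fin n) ℝ) {R : Finset (Fin m)}
    {C : Finset (Fin n)} (hR : R.card = k) (hC : C.card = k) (p : Fin k) {i i' : Fin m}
    (hp : R.orderEmbOfFin hR p = i) (hi' : i' ∉ R) :
    (A.submatrix (Function.update (R.orderEmbOfFin hR) p i') (C.orderEmbOfFin hC)).det =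
      (∏ x ∈ R.erase i, orderSign x i * orderSign x i') * subdet A (symmDiff R {i, i'}) C := by
  have hmem : ∀ a, R.orderEmbOfFin hR a ∈ R := orderEmbOfFin_mem R hR
  have hx : ∀ a, R.orderEmbOfFin hR a ≠ i' := fun a h => hi' (h ▸ hmem a)
  have hinj : Function.Injective (R.orderEmbOfFin hR) := (R.orderEmbOfFin hR).injective
  have himg : univ.image (R.orderEmbOfFin hR) = R := image_orderEmbOfFin_univ R hR
  have hiR : i ∈ R := hp ▸ hmem p
  have hu : Function.Injective (Function.update (R.orderEmbOfFin hR) p i') := by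
    intro a b hab
    by_cases ha : a = p <;> by_cases hb : b = p
    · rw [ha, hb]
    · subst ha; rw [Function.update_self, Function.update_of_ne hb] at hab
      exact absurd hab.symm (hx b)
    · subst hb; rw [Function.update_self, Function.update_of_ne ha] at hab
      exact absurd hab (hx a)
    · rw [Function.update_of_ne ha, Function.update_of_ne hb] at hab
      exact hinj hab
  have herase : (univ.erase p).image (R.orderEmbOfFin hR) = R.erase i := by
    rw [image_erase hinj, himg, hp]
  have hJ : univ.image (Function.update (R.orderEmbOfFin hR) p i') = symmDiff R {i, i'} := by
    rw [symmDiff_pair_eq_insert_erase hiR hi', ← herase]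
    ext y
    simp only [mem_image, mem_univ, true_and, mem_insert, mem_erase, and_true]
    constructor
    · rintro ⟨a, rfl⟩
      by_cases ha : a = p
      · subst ha; simp
      · exact Or.inr ⟨a, ha, by rw [Function.update_of_ne ha]⟩
    · rintro (rfl | ⟨a, ha, rfl⟩)
      · exact ⟨p, Function.update_self ..⟩
      · exact ⟨a, Function.update_of_ne ha ..⟩
  rw [det_submatrix_eq_prod_mul_subdet A hu hJ hC,
    prod_inversions_update (R.orderEmbOfFin hR).strictMono p hx, ← herase,
    prod_image hinj.injOn, hp]

/-- The sum over all exchanges of one row index between two minors equals the sum over all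
exchanges of one column index. -/
lemma sum_exchange_rows_eq_sum_exchange_cols {m n ι : Type*} [Fintype ι] [DecidableEq ι]
    (A : Matrix m n ℝ) (ρ σ : ι → m) (γ δ : ι → n) :
    ∑ p, ∑ q, (A.submatrix (Function.update ρ p (σ q)) γ).det *
        (A.submatrix (Function.update σ q (ρ p)) δ).det =
      ∑ s, ∑ t, (A.submatrix ρ (Function.update γ s (δ t))).det *
        (A.submatrix σ (Function.update δ t (γ s))).det := by
  have hrow : ∀ (ρ : ι → m) (γ : ι → n) (p : ι) (x : m),
      (A.submatrix (Function.update ρ p x) γ).det =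
        ∑ s, (A.submatrix ρ γ).adjugate s p * A x (γ s) := by
    intro ρ γ p x
    have h : A.submatrix (Function.update ρ p x) γ =
        (A.submatrix ρ γ).updateRow p (fun s => A x (γ s)) := by
      ext a s
      by_cases ha : a = p
      · subst ha; simp
      · simp [ha]
    rw [h, ← Matrix.cramer_transpose_apply, Matrix.cramer_eq_adjugate_mulVec,
      ← Matrix.adjugate_transpose]
    rfl
  have hcol : ∀ (ρ : ι → m) (γ : ι → n) (s : ι) (y : n),
      (A.submatrix ρ (Function.update γ s y)).det =
        ∑ p, (A.submatrix ρ γ).adjugate s p * A (ρ p) y := by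
    intro ρ γ s y
    have h : A.submatrix ρ (Function.update γ s y) =
        (A.submatrix ρ γ).updateCol s (fun p => A (ρ p) y) := by
      ext p a
      by_cases ha : a = s
      · subst ha; simp
      · simp [ha]
    rw [h, ← Matrix.cramer_apply, Matrix.cramer_eq_adjugate_mulVec]
    rfl
  simp only [hrow, hcol, sum_mul_sum]
  calc _ = ∑ p, ∑ s, ∑ q, ∑ t, (A.submatrix ρ γ).adjugate s p * A (σ q) (γ s) *
        ((A.submatrix σ δ).adjugate t q * A (ρ p) (δ t)) :=
        sum_congr rfl fun p _ => sum_comm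
    _ = ∑ s, ∑ p, ∑ q, ∑ t, (A.submatrix ρ γ).adjugate s p * A (σ q) (γ s) *
        ((A.submatrix σ δ).adjugate t q * A (ρ p) (δ t)) := sum_comm
    _ = ∑ s, ∑ p, ∑ t, ∑ q, (A.submatrix ρ γ).adjugate s p * A (σ q) (γ s) *
        ((A.submatrix σ δ).adjugate t q * A (ρ p) (δ t)) :=
        sum_congr rfl fun s _ => sum_congr rfl fun p _ => sum_comm
    _ = ∑ s, ∑ t, ∑ p, ∑ q, (A.submatrix ρ γ).adjugate s p * A (σ q) (γ s) *
        ((A.submatrix σ δ).adjugate t q * A (ρ p) (δ t)) :=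
        sum_congr rfl fun s _ => sum_comm
    _ = _ := by
      refine sum_congr rfl fun s _ => sum_congr rfl fun t _ => sum_congr rfl fun p _ =>
        sum_congr rfl fun q _ => ?_
      ring

/-- The signed sum of `X` over the exchanges of an element of `R \ Q` with an element
of `Q \ R`. -/
def exchangeSum {α : Type*} [LinearOrder α] (X : Finset α → Finset α → ℝ)
    (R Q : Finset α) : ℝ :=
  -∑ i ∈ R \ Q, ∑ i' ∈ Q \ R,
    positionSign (symmDiff R Q) i * positionSign (symmDiff R Q) i' *
      X (symmDiff R {i, i'}) (symmDiff Q {i, i'})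

lemma sum_exchange_rows_eq_exchangeSum {m n k : ℕ} (A : Matrix (Fin m) (Fin n) ℝ)
    {R Q : Finset (Fin m)} {C C' : Finset (Fin n)} (hR : R.card = k) (hQ : Q.card = k)
    (hC : C.card = k) (hC' : C'.card = k) :
    ∑ p, ∑ q, (A.submatrix (Function.update (R.orderEmbOfFin hR) p (Q.orderEmbOfFin hQ q))
          (C.orderEmbOfFin hC)).det *
        (A.submatrix (Function.update (Q.orderEmbOfFin hQ) q (R.orderEmbOfFin hR p))
          (C'.orderEmbOfFin hC')).det =
      (R ∩ Q).card * (subdet A R C * subdet A Q C') +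
        exchangeSum (fun R Q => subdet A R C * subdet A Q C') R Q := by
  set P := subdet A R C * subdet A Q C' with hP
  set G : Fin m → Fin m → ℝ := fun i i' => (if i = i' then P else 0) +
    if i ∉ Q then if i' ∉ R then
      -(positionSign (symmDiff R Q) i * positionSign (symmDiff R Q) i' *
        (subdet A (symmDiff R {i, i'}) C * subdet A (symmDiff Q {i, i'}) C')) else 0 else 0
    with hG
  have repeated : ∀ {T : Finset (Fin m)} {C : Finset (Fin n)} (hT : T.card = k)
      (hC : C.card = k) (p : Fin k) (x : Fin m), x ∈ T → T.orderEmbOfFin hT p ≠ x →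
      (A.submatrix (Function.update (T.orderEmbOfFin hT) p x) (C.orderEmbOfFin hC)).det = 0 := by
    intro T C hT hC p x hx hpx
    obtain ⟨b, hb⟩ : ∃ b, T.orderEmbOfFin hT b = x := by
      have : x ∈ Set.range (T.orderEmbOfFin hT) := by rw [range_orderEmbOfFin]; exact hx
      exact this
    have hbp : p ≠ b := fun h => hpx (h ▸ hb)
    refine Matrix.det_zero_of_row_eq hbp ?_
    ext j
    simp [Function.update_of_ne hbp.symm, hb]
  have hterm : ∀ p q, (A.submatrix (Function.update (R.orderEmbOfFin hR) p
          (Q.orderEmbOfFin hQ q)) (C.orderEmbOfFin hC)).det *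
        (A.submatrix (Function.update (Q.orderEmbOfFin hQ) q (R.orderEmbOfFin hR p))
          (C'.orderEmbOfFin hC')).det = G (R.orderEmbOfFin hR p) (Q.orderEmbOfFin hQ q) := by
    intro p q
    obtain ⟨i, hi⟩ : ∃ i, R.orderEmbOfFin hR p = i := ⟨_, rfl⟩
    obtain ⟨i', hi'⟩ : ∃ i', Q.orderEmbOfFin hQ q = i' := ⟨_, rfl⟩
    have hiR : i ∈ R := hi ▸ orderEmbOfFin_mem R hR p
    have hiQ : i' ∈ Q := hi' ▸ orderEmbOfFin_mem Q hQ q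
    rw [hi, hi']
    by_cases heq : i = i'
    · subst heq
      have h1 : Function.update (R.orderEmbOfFin hR) p i = R.orderEmbOfFin hR := by
        rw [← hi, Function.update_eq_self]
      have h2 : Function.update (Q.orderEmbOfFin hQ) q i = Q.orderEmbOfFin hQ := by
        rw [← hi', Function.update_eq_self]
      rw [h1, h2, ← subdet_eq_det, ← subdet_eq_det]
      simp [hG, hiQ, hP]
    by_cases hQi : i ∈ Q
    · rw [repeated hQ hC' q i hQi (by rw [hi']; exact Ne.symm heq)]
      simp [hG, heq, hQi]
    by_cases hRi : i' ∈ R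
    · rw [repeated hR hC p i' hRi (by rw [hi]; exact heq)]
      simp [hG, heq, hRi]
    rw [det_submatrix_update A hR hC p hi hRi, det_submatrix_update A hQ hC' q hi' hQi,
      pair_comm i' i]
    have hs := prod_orderSign_mul_prod_orderSign (mem_sdiff.mpr ⟨hiR, hQi⟩)
      (mem_sdiff.mpr ⟨hiQ, hRi⟩)
    simp only [hG, heq, hQi, hRi, if_false, not_false_eq_true, if_true, zero_add]
    linear_combination (subdet A (symmDiff R {i, i'}) C * subdet A (symmDiff Q {i, i'}) C') * hs
  have hreindex : ∑ p, ∑ q, G (R.orderEmbOfFin hR p) (Q.orderEmbOfFin hQ q) =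
      ∑ i ∈ R, ∑ i' ∈ Q, G i i' := by
    have aux : ∀ {T : Finset (Fin m)} (hT : T.card = k) (f : Fin m → ℝ),
        ∑ p, f (T.orderEmbOfFin hT p) = ∑ i ∈ T, f i := by
      intro T hT f
      conv_rhs => rw [← image_orderEmbOfFin_univ T hT]
      rw [sum_image (T.orderEmbOfFin hT).injective.injOn]
    rw [← aux hR]
    exact sum_congr rfl fun p _ => aux hQ _
  rw [sum_congr rfl fun p _ => sum_congr rfl fun q _ => hterm p q, hreindex]
  simp only [hG, sum_add_distrib, exchangeSum]
  congr 1
  · simp only [sum_ite_eq]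
    rw [← sum_filter, filter_mem_eq_inter, sum_const, nsmul_eq_mul]
  · rw [← sum_neg_distrib, ← filter_notMem_eq_sdiff, sum_filter]
    refine sum_congr rfl fun i _ => ?_
    by_cases hi : i ∈ Q
    · simp [hi]
    · simp only [hi, not_false_eq_true, if_true]
      rw [← sum_neg_distrib, ← filter_notMem_eq_sdiff, sum_filter]

/-- Row exchanges and column exchanges of a product of two minors agree. -/
lemma exchangeSum_rows_eq_exchangeSum_cols {m n k : ℕ} (A : Matrix (Fin m) (Fin n) ℝ)
    {R Q : Finset (Fin m)} {C C' : Finset (Fin n)} (hR : R.card = k) (hQ : Q.card = k)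
    (hC : C.card = k) (hC' : C'.card = k) :
    (R ∩ Q).card * (subdet A R C * subdet A Q C') +
        exchangeSum (fun R Q => subdet A R C * subdet A Q C') R Q =
      (C ∩ C').card * (subdet A R C * subdet A Q C') +
        exchangeSum (fun C C' => subdet A R C * subdet A Q C') C C' := by
  have hcols := sum_exchange_rows_eq_exchangeSum A.transpose hC hC' hR hQ
  have hX : exchangeSum (fun C C' => subdet A.transpose C R * subdet A.transpose C' Q) C C' =
      exchangeSum (fun C C' => subdet A R C * subdet A Q C') C C' := by
    unfold exchangeSum
    congr 1
    refine sum_congr rfl fun j hj => sum_congr rfl fun j' hj' => ?_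
    rw [mem_sdiff] at hj hj'
    have h1 : (symmDiff C {j, j'}).card = k := (card_symmDiff_pair hj.1 hj'.2).trans hC
    have h2 : (symmDiff C' {j, j'}).card = k := by
      rw [pair_comm]; exact (card_symmDiff_pair hj'.1 hj.2).trans hC'
    simp only [subdet_transpose A hR h1, subdet_transpose A hQ h2]
  rw [hX, subdet_transpose A hR hC, subdet_transpose A hQ hC'] at hcols
  rw [← sum_exchange_rows_eq_exchangeSum A hR hQ hC hC', ← hcols,
    sum_exchange_rows_eq_sum_exchange_cols]
  refine sum_congr rfl fun s _ => sum_congr rfl fun t _ => ?_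
  rw [← Matrix.det_transpose, ← Matrix.det_transpose (A.submatrix (Q.orderEmbOfFin hQ) _),
    Matrix.transpose_submatrix, Matrix.transpose_submatrix]

lemma symmDiff_pair_sdiff {α : Type*} [DecidableEq α] {R Q : Finset α} {i i' : α}
    (hi : i ∈ R \ Q) (hi' : i' ∈ Q \ R) :
    symmDiff R {i, i'} \ symmDiff Q {i, i'} = insert i' ((R \ Q).erase i) := by
  rw [mem_sdiff] at hi hi'
  have hne : i ≠ i' := fun h => hi.2 (h ▸ hi'.1)
  rw [pair_comm i i', symmDiff_pair_eq_insert_erase hi'.1 hi.2, pair_comm,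
    symmDiff_pair_eq_insert_erase hi.1 hi'.2]
  ext x
  simp only [mem_sdiff, mem_insert, mem_erase]
  grind

lemma symmDiff_pair_inter {α : Type*} [DecidableEq α] {R Q : Finset α} {i i' : α}
    (hi : i ∈ R \ Q) (hi' : i' ∈ Q \ R) :
    symmDiff R {i, i'} ∩ symmDiff Q {i, i'} = R ∩ Q := by
  rw [mem_sdiff] at hi hi'
  have hne : i ≠ i' := fun h => hi.2 (h ▸ hi'.1)
  rw [pair_comm i i', symmDiff_pair_eq_insert_erase hi'.1 hi.2, pair_comm,
    symmDiff_pair_eq_insert_erase hi.1 hi'.2]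
  ext x
  simp only [mem_inter, mem_insert, mem_erase]
  grind

lemma symmDiff_symmDiff_symmDiff_self {α : Type*} [DecidableEq α] (R Q T : Finset α) :
    symmDiff (symmDiff R T) (symmDiff Q T) = symmDiff R Q := by
  rw [symmDiff_symmDiff_symmDiff_comm, symmDiff_self, symmDiff_bot]

lemma exchangeSum_congr {α : Type*} [LinearOrder α] {X Y : Finset α → Finset α → ℝ}
    {R Q : Finset α} (h : ∀ i ∈ R \ Q, ∀ i' ∈ Q \ R,
      X (symmDiff R {i, i'}) (symmDiff Q {i, i'}) = Y (symmDiff R {i, i'}) (symmDiff Q {i, i'})) :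
    exchangeSum X R Q = exchangeSum Y R Q := by
  unfold exchangeSum
  congr 1
  exact sum_congr rfl fun i hi => sum_congr rfl fun i' hi' => by rw [h i hi i' hi']

lemma exchangeSum_linear {α : Type*} [LinearOrder α] (X Y : Finset α → Finset α → ℝ) (a : ℝ)
    (R Q : Finset α) :
    exchangeSum (fun R Q => a * X R Q + Y R Q) R Q = a * exchangeSum X R Q + exchangeSum Y R Q := by
  simp only [exchangeSum, mul_neg, mul_sum, ← neg_add, ← sum_add_distrib]
  congr 1
  exact sum_congr rfl fun i _ => sum_congr rfl fun i' _ => by ring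

/-- Two successive exchanges either cancel, combine to a single exchange, or exchange two
pairs of elements. -/
lemma exchangeSum_exchangeSum {α : Type*} [LinearOrder α] (X : Finset α → Finset α → ℝ)
    {R Q : Finset α} {d : ℕ} (hR : (R \ Q).card = d) (hQ : (Q \ R).card = d) :
    exchangeSum (exchangeSum X) R Q =
      (d : ℝ) ^ 2 * X R Q - 2 * ((d : ℝ) - 1) * exchangeSum X R Q +
        ∑ i ∈ R \ Q, ∑ h ∈ (R \ Q).erase i, ∑ i' ∈ Q \ R, ∑ h' ∈ (Q \ R).erase i',
          positionSign (symmDiff R Q) i * positionSign (symmDiff R Q) h *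
            (positionSign (symmDiff R Q) i' * positionSign (symmDiff R Q) h') *
            X (symmDiff R {i, h, i', h'}) (symmDiff Q {i, h, i', h'}) := by
  set s := positionSign (symmDiff R Q) with hs
  have hss : ∀ x, s x * s x = 1 := positionSign_mul_self _
  set Y : Finset α → ℝ := fun T => X (symmDiff R T) (symmDiff Q T) with hY
  have hterm : ∀ i ∈ R \ Q, ∀ i' ∈ Q \ R,
      s i * s i' * exchangeSum X (symmDiff R {i, i'}) (symmDiff Q {i, i'}) =
        -(X R Q + ∑ h' ∈ (Q \ R).erase i', s i * s h' * Y {i, h'} +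
          (∑ h ∈ (R \ Q).erase i, s h * s i' * Y {h, i'} +
          ∑ h ∈ (R \ Q).erase i, ∑ h' ∈ (Q \ R).erase i',
            s i * s h * (s i' * s h') * Y {i, h, i', h'})) := by
    intro i hi i' hi'
    have hiR := mem_sdiff.mp hi
    have hiQ := mem_sdiff.mp hi'
    have hne : i ≠ i' := fun h => hiR.2 (h ▸ hiQ.1)
    unfold exchangeSum
    have hsd' : symmDiff Q {i, i'} \ symmDiff R {i, i'} = insert i ((Q \ R).erase i') := by
      rw [pair_comm, symmDiff_pair_sdiff hi' hi]
    rw [symmDiff_symmDiff_symmDiff_self, symmDiff_pair_sdiff hi hi', hsd', ← hs,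
      sum_insert (by simp [hiQ.2]), mul_neg, neg_inj, sum_insert (by simp [hiR.2])]
    simp only [symmDiff_assoc]
    have e0 : symmDiff ({i, i'} : Finset α) {i', i} = ∅ := by
      rw [pair_comm i' i, symmDiff_self]; rfl
    have e1 : ∀ h' ∈ (Q \ R).erase i', symmDiff ({i, i'} : Finset α) {i', h'} = {i, h'} := by
      intro h' hh
      rw [mem_erase, mem_sdiff] at hh
      have : i ≠ h' := fun h => hiR.2 (h ▸ hh.2.1)
      ext x
      simp only [mem_symmDiff, mem_insert, mem_singleton]
      grind
    have e2 : ∀ h ∈ (R \ Q).erase i, symmDiff ({i, i'} : Finset α) {h, i} = {h, i'} := by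
      intro h hh
      rw [mem_erase, mem_sdiff] at hh
      have : i' ≠ h := fun e => hiQ.2 (e ▸ hh.2.1)
      ext x
      simp only [mem_symmDiff, mem_insert, mem_singleton]
      grind
    have e3 : ∀ h ∈ (R \ Q).erase i, ∀ h' ∈ (Q \ R).erase i',
        symmDiff ({i, i'} : Finset α) {h, h'} = {i, h, i', h'} := by
      intro h hh h' hh'
      rw [mem_erase, mem_sdiff] at hh hh'
      have : i' ≠ h := fun e => hiQ.2 (e ▸ hh.2.1)
      have : i ≠ h' := fun e => hiR.2 (e ▸ hh'.2.1)
      ext x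
      simp only [mem_symmDiff, mem_insert, mem_singleton]
      grind
    have hbot : ∀ T : Finset α, symmDiff T ∅ = T := symmDiff_bot
    rw [mul_add, mul_add, e0, hbot, hbot]
    congr 1
    · congr 1
      · linear_combination (s i' * s i' * X R Q) * hss i + X R Q * hss i'
      · rw [mul_sum]
        refine sum_congr rfl fun h' hh => ?_
        rw [e1 h' hh]
        linear_combination (s i * s h' * Y {i, h'}) * hss i'
    · rw [mul_sum, ← sum_add_distrib]
      refine sum_congr rfl fun h hh => ?_
      rw [sum_insert (by simp [hiR.2]), mul_add, e2 h hh, mul_sum]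
      congr 1
      · linear_combination (s h * s i' * Y {h, i'}) * hss i
      · refine sum_congr rfl fun h' hh' => ?_
        rw [e3 h hh h' hh']
        ring
  have hL : exchangeSum X R Q = -∑ i ∈ R \ Q, ∑ i' ∈ Q \ R, s i * s i' * Y {i, i'} := rfl
  have hcount : ∀ {T : Finset α} (hT : T.card = d) (g : α → ℝ),
      ∑ i ∈ T, ∑ h ∈ T.erase i, g h = ((d : ℝ) - 1) * ∑ h ∈ T, g h := by
    intro T hT g
    have h1 : ∀ i ∈ T, ∑ h ∈ T.erase i, g h = ∑ h ∈ T, g h - g i := fun i hi =>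
      sum_erase_eq_sub hi
    rw [sum_congr rfl h1, sum_sub_distrib, sum_const, hT, nsmul_eq_mul]
    ring
  have hrow : ∑ i ∈ R \ Q, ∑ i' ∈ Q \ R, ∑ h' ∈ (Q \ R).erase i', s i * s h' * Y {i, h'} =
      -((d : ℝ) - 1) * exchangeSum X R Q := by
    rw [hL, neg_mul_neg, mul_sum]
    exact sum_congr rfl fun i _ => hcount hQ _
  have hcol : ∑ i ∈ R \ Q, ∑ i' ∈ Q \ R, ∑ h ∈ (R \ Q).erase i, s h * s i' * Y {h, i'} =
      -((d : ℝ) - 1) * exchangeSum X R Q := by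
    rw [hL, neg_mul_neg, sum_comm, sum_comm (s := R \ Q), mul_sum]
    exact sum_congr rfl fun i' _ => hcount hR _
  have hfour : ∑ i ∈ R \ Q, ∑ i' ∈ Q \ R, ∑ h ∈ (R \ Q).erase i, ∑ h' ∈ (Q \ R).erase i',
      s i * s h * (s i' * s h') * Y {i, h, i', h'} =
      ∑ i ∈ R \ Q, ∑ h ∈ (R \ Q).erase i, ∑ i' ∈ Q \ R, ∑ h' ∈ (Q \ R).erase i',
      s i * s h * (s i' * s h') * Y {i, h, i', h'} :=
    sum_congr rfl fun i _ => sum_comm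
  have hexp : exchangeSum (exchangeSum X) R Q = -∑ i ∈ R \ Q, ∑ i' ∈ Q \ R,
      s i * s i' * exchangeSum X (symmDiff R {i, i'}) (symmDiff Q {i, i'}) := rfl
  rw [hexp, sum_congr rfl fun i hi => sum_congr rfl fun i' hi' => hterm i hi i' hi']
  simp only [sum_neg_distrib, sum_add_distrib, neg_neg, hrow, hcol, hfour, sum_const, hR, hQ,
    nsmul_eq_mul]
  ring

lemma sum_erase_eq_two_mul_sum_lt {α : Type*} [LinearOrder α] (T : Finset α) {g : α → α → ℝ}
    (hg : ∀ i h, g i h = g h i) :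
    ∑ i ∈ T, ∑ h ∈ T.erase i, g i h = 2 * ∑ i ∈ T, ∑ h ∈ T.filter (fun h => i < h), g i h := by
  have hsplit : ∀ i ∈ T, ∑ h ∈ T.erase i, g i h =
      ∑ h ∈ T.filter (fun h => i < h), g i h + ∑ h ∈ T.filter (fun h => h < i), g i h := by
    intro i _
    rw [← sum_union]
    · congr 1
      ext h
      simp only [mem_erase, mem_union, mem_filter]
      grind
    · rw [Finset.disjoint_left]
      intro h h1 h2
      exact (mem_filter.mp h1).2.not_gt (mem_filter.mp h2).2
  have hswap : ∑ i ∈ T, ∑ h ∈ T.filter (fun h => h < i), g i h =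
      ∑ i ∈ T, ∑ h ∈ T.filter (fun h => i < h), g i h := by
    simp only [sum_filter]
    rw [sum_comm]
    exact sum_congr rfl fun i _ => sum_congr rfl fun h _ => by rw [hg]
  rw [sum_congr rfl hsplit, sum_add_distrib, hswap, two_mul]

/-- Exchanging columns and then rows reduces to exchanging rows twice. -/
lemma exchangeSum_rows_cols {m n k : ℕ} (A : Matrix (Fin m) (Fin n) ℝ)
    {R Q : Finset (Fin m)} {C C' : Finset (Fin n)} (hR : R.card = k) (hQ : Q.card = k)
    (hC : C.card = k) (hC' : C'.card = k) :
    exchangeSum (fun R Q => exchangeSum (fun C C' => subdet A R C * subdet A Q C') C C') R Q =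
      ((R ∩ Q).card - (C ∩ C').card) *
          exchangeSum (fun R Q => subdet A R C * subdet A Q C') R Q +
        exchangeSum (exchangeSum (fun R Q => subdet A R C * subdet A Q C')) R Q := by
  rw [← exchangeSum_linear]
  refine exchangeSum_congr fun i hi i' hi' => ?_
  have hiR := mem_sdiff.mp hi
  have hiQ := mem_sdiff.mp hi'
  have h1 : (symmDiff R {i, i'}).card = k := (card_symmDiff_pair hiR.1 hiQ.2).trans hR
  have h2 : (symmDiff Q {i, i'}).card = k := by
    rw [pair_comm]; exact (card_symmDiff_pair hiQ.1 hiR.2).trans hQ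
  have h := exchangeSum_rows_eq_exchangeSum_cols A h1 h2 hC hC'
  rw [symmDiff_pair_inter hi hi'] at h
  linear_combination -h

section Intervals

variable {k r : ℕ} {S T D E : Finset (Fin (2 * k))}

lemma card_initial_segment (hS : ∀ x, x ∈ S ↔ (x : ℕ) < k) : S.card = k := by
  have : S.map Fin.valEmbedding = range k := by
    ext x
    simp only [mem_map, hS, Fin.valEmbedding_apply, mem_range]
    exact ⟨fun ⟨y, hy, e⟩ => e ▸ hy, fun h => ⟨⟨x, by omega⟩, h, rfl⟩⟩
  rw [← card_map Fin.valEmbedding, this, card_range]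

lemma card_middle_segment (hD : ∀ x, x ∈ D ↔ (r ≤ (x : ℕ) ∧ (x : ℕ) < k)) :
    D.card = k - r := by
  have : D.map Fin.valEmbedding = Ico r k := by
    ext x
    simp only [mem_map, hD, Fin.valEmbedding_apply, mem_Ico]
    exact ⟨fun ⟨y, hy, e⟩ => e ▸ hy, fun h => ⟨⟨x, by omega⟩, h, rfl⟩⟩
  rw [← card_map Fin.valEmbedding, this, Nat.card_Ico]

lemma card_final_segment (hr : r ≤ k) (hE : ∀ x, x ∈ E ↔ k + r ≤ (x : ℕ)) :
    E.card = k - r := by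
  have : E.map Fin.valEmbedding = Ico (k + r) (2 * k) := by
    ext x
    simp only [mem_map, hE, Fin.valEmbedding_apply, mem_Ico]
    exact ⟨fun ⟨y, hy, e⟩ => e ▸ ⟨hy, y.2⟩, fun h => ⟨⟨x, h.2⟩, h.1, rfl⟩⟩
  rw [← card_map Fin.valEmbedding, this, Nat.card_Ico]
  omega

lemma segment_sdiff (hS : ∀ x, x ∈ S ↔ (x : ℕ) < k)
    (hT : ∀ x, x ∈ T ↔ ((x : ℕ) < r ∨ k + r ≤ (x : ℕ)))
    (hD : ∀ x, x ∈ D ↔ (r ≤ (x : ℕ) ∧ (x : ℕ) < k)) : S \ T = D := by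
  ext x
  rw [mem_sdiff, hS, hT, hD]
  omega

lemma sdiff_segment (hr : r ≤ k) (hS : ∀ x, x ∈ S ↔ (x : ℕ) < k)
    (hT : ∀ x, x ∈ T ↔ ((x : ℕ) < r ∨ k + r ≤ (x : ℕ)))
    (hE : ∀ x, x ∈ E ↔ k + r ≤ (x : ℕ)) : T \ S = E := by
  ext x
  rw [mem_sdiff, hS, hT, hE]
  omega

lemma card_inter_segment (hr : r ≤ k) (hS : ∀ x, x ∈ S ↔ (x : ℕ) < k)
    (hT : ∀ x, x ∈ T ↔ ((x : ℕ) < r ∨ k + r ≤ (x : ℕ))) : (S ∩ T).card = r := by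
  have : (S ∩ T).map Fin.valEmbedding = range r := by
    ext x
    simp only [mem_map, mem_inter, hS, hT, Fin.valEmbedding_apply, mem_range]
    exact ⟨fun ⟨y, hy, e⟩ => by omega, fun h => ⟨⟨x, by omega⟩, by simp only; omega, rfl⟩⟩
  rw [← card_map Fin.valEmbedding, this, card_range]

lemma card_two_segments (hr : r ≤ k) (hT : ∀ x, x ∈ T ↔ ((x : ℕ) < r ∨ k + r ≤ (x : ℕ))) :
    T.card = k := by
  have : T.map Fin.valEmbedding = range r ∪ Ico (k + r) (2 * k) := by
    ext x
    simp only [mem_map, hT, Fin.valEmbedding_apply, mem_range, mem_union, mem_Ico]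
    exact ⟨fun ⟨y, hy, e⟩ => by omega, fun h => ⟨⟨x, by omega⟩, by simp only; omega, rfl⟩⟩
  rw [← card_map Fin.valEmbedding, this, card_union_of_disjoint, card_range, Nat.card_Ico]
  · omega
  · rw [Finset.disjoint_left]
    intro x
    rw [mem_range, mem_Ico]
    omega

lemma positionSign_middle (hr : r ≤ k) (hS : ∀ x, x ∈ S ↔ (x : ℕ) < k)
    (hT : ∀ x, x ∈ T ↔ ((x : ℕ) < r ∨ k + r ≤ (x : ℕ))) {i : Fin (2 * k)}
    (hi : r ≤ (i : ℕ) ∧ (i : ℕ) < k) : positionSign (symmDiff S T) i = (-1) ^ ((i : ℕ) + r) := by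
  have : ((symmDiff S T).filter (· < i)).map Fin.valEmbedding = Ico r i := by
    ext x
    simp only [mem_map, mem_filter, mem_symmDiff, hS, hT, Fin.valEmbedding_apply, mem_Ico,
      Fin.lt_def]
    exact ⟨fun ⟨y, hy, e⟩ => by omega, fun h => ⟨⟨x, by omega⟩, by simp only; omega, rfl⟩⟩
  rw [positionSign_eq_pow, ← card_map Fin.valEmbedding, this, Nat.card_Ico]
  rw [show (i : ℕ) + r = (i - r) + 2 * r by omega, pow_add, pow_mul]
  simp

lemma positionSign_final (hr : r ≤ k) (hS : ∀ x, x ∈ S ↔ (x : ℕ) < k)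
    (hT : ∀ x, x ∈ T ↔ ((x : ℕ) < r ∨ k + r ≤ (x : ℕ))) {i : Fin (2 * k)}
    (hi : k + r ≤ (i : ℕ)) : positionSign (symmDiff S T) i = (-1) ^ (i : ℕ) := by
  have : ((symmDiff S T).filter (· < i)).map Fin.valEmbedding = Ico r k ∪ Ico (k + r) i := by
    ext x
    simp only [mem_map, mem_filter, mem_symmDiff, hS, hT, Fin.valEmbedding_apply, mem_Ico,
      mem_union, Fin.lt_def]
    exact ⟨fun ⟨y, hy, e⟩ => by omega, fun h => ⟨⟨x, by omega⟩, by simp only; omega, rfl⟩⟩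
  rw [positionSign_eq_pow, ← card_map Fin.valEmbedding, this, card_union_of_disjoint,
    Nat.card_Ico, Nat.card_Ico]
  · conv_rhs => rw [show (i : ℕ) = (k - r + (i - (k + r))) + 2 * r by omega, pow_add, pow_mul]
    simp
  · rw [Finset.disjoint_left]
    intro x
    rw [mem_Ico, mem_Ico]
    omega

lemma exchangeSum_segments (hr : r ≤ k) (hS : ∀ x, x ∈ S ↔ (x : ℕ) < k)
    (hT : ∀ x, x ∈ T ↔ ((x : ℕ) < r ∨ k + r ≤ (x : ℕ)))
    (hD : ∀ x, x ∈ D ↔ (r ≤ (x : ℕ) ∧ (x : ℕ) < k)) (hE : ∀ x, x ∈ E ↔ k + r ≤ (x : ℕ))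
    (X : Finset (Fin (2 * k)) → Finset (Fin (2 * k)) → ℝ) :
    exchangeSum X S T = -((-1) ^ r * ∑ i ∈ D, ∑ i' ∈ E, (-1) ^ ((i : ℕ) + (i' : ℕ)) *
      X (symmDiff S {i, i'}) (symmDiff T {i, i'})) := by
  unfold exchangeSum
  rw [segment_sdiff hS hT hD, sdiff_segment hr hS hT hE, mul_sum]
  congr 1
  refine sum_congr rfl fun i hi => ?_
  rw [mul_sum]
  refine sum_congr rfl fun i' hi' => ?_
  rw [positionSign_middle hr hS hT ((hD i).mp hi), positionSign_final hr hS hT ((hE i').mp hi')]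
  ring

lemma exchangeSum_exchangeSum_segments (hr : r ≤ k) (hS : ∀ x, x ∈ S ↔ (x : ℕ) < k)
    (hT : ∀ x, x ∈ T ↔ ((x : ℕ) < r ∨ k + r ≤ (x : ℕ)))
    (hD : ∀ x, x ∈ D ↔ (r ≤ (x : ℕ) ∧ (x : ℕ) < k)) (hE : ∀ x, x ∈ E ↔ k + r ≤ (x : ℕ))
    (X : Finset (Fin (2 * k)) → Finset (Fin (2 * k)) → ℝ) :
    exchangeSum (exchangeSum X) S T =
      ((k : ℝ) - r) ^ 2 * X S T - 2 * ((k : ℝ) - r - 1) * exchangeSum X S T +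
        4 * ∑ i ∈ D, ∑ h ∈ D.filter (fun h => i < h),
          ∑ i' ∈ E, ∑ h' ∈ E.filter (fun h' => i' < h'),
            (-1) ^ ((i : ℕ) + (h : ℕ) + (i' : ℕ) + (h' : ℕ)) *
              X (symmDiff S {i, h, i', h'}) (symmDiff T {i, h, i', h'}) := by
  have hDS := segment_sdiff hS hT hD
  have hES := sdiff_segment hr hS hT hE
  have hDc : (S \ T).card = k - r := hDS ▸ card_middle_segment hD
  have hEc : (T \ S).card = k - r := hES ▸ card_final_segment hr hE
  rw [exchangeSum_exchangeSum X hDc hEc, hDS, hES, Nat.cast_sub hr]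
  congr 1
  have hinner : ∀ i ∈ D, ∀ h ∈ D, (∑ i' ∈ E, ∑ h' ∈ E.erase i',
      positionSign (symmDiff S T) i * positionSign (symmDiff S T) h *
        (positionSign (symmDiff S T) i' * positionSign (symmDiff S T) h') *
        X (symmDiff S {i, h, i', h'}) (symmDiff T {i, h, i', h'})) =
      2 * ∑ i' ∈ E, ∑ h' ∈ E.filter (fun h' => i' < h'),
        (-1) ^ ((i : ℕ) + (h : ℕ) + (i' : ℕ) + (h' : ℕ)) *
          X (symmDiff S {i, h, i', h'}) (symmDiff T {i, h, i', h'}) := by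
    intro i hi h hh
    rw [← sum_erase_eq_two_mul_sum_lt]
    · refine sum_congr rfl fun i' hi' => sum_congr rfl fun h' hh' => ?_
      rw [positionSign_middle hr hS hT ((hD i).mp hi), positionSign_middle hr hS hT ((hD h).mp hh),
        positionSign_final hr hS hT ((hE i').mp hi'),
        positionSign_final hr hS hT ((hE h').mp (mem_of_mem_erase hh'))]
      have h1 : ((-1 : ℝ) ^ r) ^ 2 = 1 := by rw [← pow_mul, mul_comm, pow_mul]; simp
      linear_combination ((-1) ^ ((i : ℕ) + (h : ℕ) + (i' : ℕ) + (h' : ℕ)) *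
          X (symmDiff S {i, h, i', h'}) (symmDiff T {i, h, i', h'})) * h1
    · intro i' h'
      rw [pair_comm i' h', show (i : ℕ) + h + i' + h' = i + h + h' + i' by omega]
  rw [sum_congr rfl fun i hi => sum_congr rfl fun h hh => hinner i hi h (mem_of_mem_erase hh),
    sum_erase_eq_two_mul_sum_lt]
  · simp only [← mul_sum]
    ring
  · intro i h
    congr 1
    refine sum_congr rfl fun i' _ => sum_congr rfl fun h' _ => ?_
    rw [insert_comm i h, add_comm (i : ℕ) h]

end Intervals

/-- **Extended Plücker relation, general case** (Lemma 5.4, first equation). Rows and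
columns of `A ∈ ℝ^{2k×2k}` are indexed 0-based by `Fin (2k)`: `SR = S_R = S_C = {0,…,k−1}`,
`TR = T_R = {0,…,r−1} ∪ {k+r,…,2k−1}`, `TC = T_C = {0,…,c−1} ∪ {k+c,…,2k−1}`; the
summation ranges are `RS = S_R \ T_R`, `RT = T_R \ S_R`, `CS = S_C \ T_C`,
`CT = T_C \ S_C` (0-based indexing preserves all sign parities). Then
`(k² − 2(k−1)r + 4·C(r,2) − rc)·[S_R,S_C]·[T_R,T_C] = s₁ − r·ŝ₂ − (2(k−1)+c−4r)·s₂ − 4·s₃`. -/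
theorem extended_plucker_general_first {k : ℕ} (hk : 1 ≤ k) (r c : ℕ) (hr : r ≤ k) (hc : c ≤ k)
    (A : Matrix (Fin (2 * k)) (Fin (2 * k)) ℝ)
    (SR TR TC RS RT CS CT : Finset (Fin (2 * k)))
    (hSR : ∀ x, x ∈ SR ↔ (x : ℕ) < k)
    (hTR : ∀ x, x ∈ TR ↔ ((x : ℕ) < r ∨ k + r ≤ (x : ℕ)))
    (hTC : ∀ x, x ∈ TC ↔ ((x : ℕ) < c ∨ k + c ≤ (x : ℕ)))
    (hRS : ∀ x, x ∈ RS ↔ (r ≤ (x : ℕ) ∧ (x : ℕ) < k))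
    (hRT : ∀ x, x ∈ RT ↔ k + r ≤ (x : ℕ))
    (hCS : ∀ x, x ∈ CS ↔ (c ≤ (x : ℕ) ∧ (x : ℕ) < k))
    (hCT : ∀ x, x ∈ CT ↔ k + c ≤ (x : ℕ))
    (s1 s2 s2h s3 s3h : ℝ)
    (hs1 : s1 = (-1 : ℝ) ^ (r + c) * ∑ i ∈ RS, ∑ j ∈ CS, ∑ i' ∈ RT, ∑ j' ∈ CT,
      (-1 : ℝ) ^ ((i : ℕ) + (j : ℕ) + (i' : ℕ) + (j' : ℕ)) *
        (subdet A (symmDiff SR {i, i'}) (symmDiff SR {j, j'}) *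
          subdet A (symmDiff TR {i, i'}) (symmDiff TC {j, j'})))
    (hs2 : s2 = (-1 : ℝ) ^ (k - r) * ∑ i ∈ RS, ∑ i' ∈ RT,
      (-1 : ℝ) ^ ((i : ℕ) + (i' : ℕ) + k) *
        (subdet A (symmDiff SR {i, i'}) SR * subdet A (symmDiff TR {i, i'}) TC))
    (hs2h : s2h = (-1 : ℝ) ^ (k - c) * ∑ j ∈ CS, ∑ j' ∈ CT,
      (-1 : ℝ) ^ ((j : ℕ) + (j' : ℕ) + k) *
        (subdet A SR (symmDiff SR {j, j'}) * subdet A TR (symmDiff TC {j, j'})))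
    (hs3 : s3 = ∑ i ∈ RS, ∑ h ∈ RS.filter (fun h => i < h),
        ∑ i' ∈ RT, ∑ h' ∈ RT.filter (fun h' => i' < h'),
      (-1 : ℝ) ^ ((i : ℕ) + (h : ℕ) + (i' : ℕ) + (h' : ℕ)) *
        (subdet A (symmDiff SR {i, h, i', h'}) SR *
          subdet A (symmDiff TR {i, h, i', h'}) TC))
    (hs3h : s3h = ∑ j ∈ CS, ∑ l ∈ CS.filter (fun l => j < l),
        ∑ j' ∈ CT, ∑ l' ∈ CT.filter (fun l' => j' < l'),
      (-1 : ℝ) ^ ((j : ℕ) + (l : ℕ) + (j' : ℕ) + (l' : ℕ)) *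
        (subdet A SR (symmDiff SR {j, l, j', l'}) *
          subdet A TR (symmDiff TC {j, l, j', l'}))) :
    ((k : ℝ) ^ 2 - 2 * ((k : ℝ) - 1) * r + 4 * ((r : ℝ) * ((r : ℝ) - 1) / 2) - (r : ℝ) * c) *
        (subdet A SR SR * subdet A TR TC) =
      s1 - (r : ℝ) * s2h - (2 * ((k : ℝ) - 1) + (c : ℝ) - 4 * r) * s2 - 4 * s3 := by
  have hSRc := card_initial_segment hSR
  have hTRc := card_two_segments hr hTR
  have hTCc := card_two_segments hc hTC
  have hinterR := card_inter_segment hr hSR hTR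
  have hinterC := card_inter_segment hc hSR hTC
  set X : Finset (Fin (2 * k)) → Finset (Fin (2 * k)) → ℝ :=
    fun R Q => subdet A R SR * subdet A Q TC with hX
  have hsign : ∀ {a : ℕ}, a ≤ k → ∀ n : ℕ, (-1 : ℝ) ^ (k - a) * (-1) ^ (n + k) =
      (-1) ^ a * (-1) ^ n := by
    intro a ha n
    rw [← pow_add, ← pow_add, show k - a + (n + k) = a + n + 2 * (k - a) by omega,
      pow_add _ _ (2 * (k - a)), pow_mul]
    simp
  have h2 : exchangeSum X SR TR = -s2 := by
    rw [exchangeSum_segments hr hSR hTR hRS hRT, hs2]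
    simp only [mul_sum, ← mul_assoc, hsign hr, hX]
  have h2h : exchangeSum (fun C C' => subdet A SR C * subdet A TR C') SR TC = -s2h := by
    rw [exchangeSum_segments hc hSR hTC hCS hCT, hs2h]
    simp only [mul_sum, ← mul_assoc, hsign hc]
  have h1 : exchangeSum (fun R Q => exchangeSum (fun C C' => subdet A R C * subdet A Q C')
      SR TC) SR TR = s1 := by
    rw [exchangeSum_segments hr hSR hTR hRS hRT, hs1]
    simp only [exchangeSum_segments hc hSR hTC hCS hCT, mul_neg, sum_neg_distrib, neg_neg, mul_sum]
    refine sum_congr rfl fun i _ => ?_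
    rw [sum_comm]
    refine sum_congr rfl fun j _ => sum_congr rfl fun i' _ => sum_congr rfl fun j' _ => ?_
    ring
  have hrc := exchangeSum_rows_eq_exchangeSum_cols A hSRc hTRc hSRc hTCc
  have hsq := exchangeSum_rows_cols A hSRc hTRc hSRc hTCc
  rw [exchangeSum_exchangeSum_segments hr hSR hTR hRS hRT, ← hs3] at hsq
  rw [← hX, h2] at hsq
  rw [← hX, h2, h2h] at hrc
  rw [h1, hinterR, hinterC] at hsq
  rw [hinterR, hinterC] at hrc
  linear_combination (-1) * hsq + r * hrc
end

section
/- (Extended Plücker relation in the general case, Lemma 5.4, second equation.) With the setup and definitions of s₁, s₂, ŝ₂, s₃, ŝ₃ given in the context: (k² − 2(k−1)c + 4·C(c,2) − rc) · [S_R,S_C]·[T_R,T_C] = s₁ − c·s₂ − (2(k−1) + r − 4c)·ŝ₂ − 4·ŝ₃, where C(c,2) = c(c−1)/2. -/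
open Finset

section Exchange

open Matrix

variable {m n k : ℕ}

/-- The sign `(-1) ^ #{w ∈ U | w < i}`. -/
noncomputable def signBelow (U : Finset (Fin n)) (i : Fin n) : ℝ :=
  (-1) ^ #{w ∈ U | w < i}

lemma signBelow_mul_self (U : Finset (Fin n)) (i : Fin n) :
    signBelow U i * signBelow U i = 1 := by
  rw [signBelow, ← mul_pow]
  norm_num

lemma signBelow_symmDiff (U V : Finset (Fin n)) (i : Fin n) :
    signBelow (symmDiff U V) i = signBelow U i * signBelow V i := by
  have key : ∀ W : Finset (Fin n),
      signBelow W i = ∏ w ∈ univ.filter (· < i), if w ∈ W then (-1 : ℝ) else 1 := by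
    intro W
    rw [signBelow, ← prod_filter, prod_const, filter_filter]
    congr 2
    ext w
    simp [and_comm]
  rw [key, key, key, ← prod_mul_distrib]
  refine prod_congr rfl fun w _ => ?_
  by_cases hU : w ∈ U <;> by_cases hV : w ∈ V <;> simp [mem_symmDiff, hU, hV]

lemma signBelow_singleton (u i : Fin n) :
    signBelow {u} i = if u < i then -1 else 1 := by
  by_cases h : u < i <;> simp [signBelow, filter_singleton, h]

lemma erase_eq_symmDiff_singleton {U : Finset (Fin n)} {u : Fin n} (hu : u ∈ U) :
    U.erase u = symmDiff U {u} := by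
  ext x
  by_cases hx : x = u <;> simp [mem_symmDiff, hx, hu]

lemma symmDiff_pair_eq_insert_erase_s8 {S : Finset (Fin n)} {u v : Fin n} (hu : u ∈ S)
    (hv : v ∉ S) : symmDiff S {u, v} = insert v (S.erase u) := by
  ext x
  by_cases hx : x = u
  · subst hx
    by_cases hxv : x = v
    · subst hxv
      exact absurd hu hv
    · simp [mem_symmDiff, hu, hxv]
  · by_cases hxv : x = v
    · subst hxv
      simp [mem_symmDiff, hv]
    · simp [mem_symmDiff, hx, hxv]

lemma signBelow_erase_mul_erase {S T : Finset (Fin n)} {u v : Fin n} (hu : u ∈ S) (hv : v ∈ T)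
    (huv : u ≠ v) :
    (signBelow (S.erase u) u * signBelow (S.erase u) v) *
      (signBelow (T.erase v) v * signBelow (T.erase v) u) =
      -(signBelow (symmDiff S T) u * signBelow (symmDiff S T) v) := by
  rw [erase_eq_symmDiff_singleton hu, erase_eq_symmDiff_singleton hv]
  simp only [signBelow_symmDiff, signBelow_singleton]
  rcases lt_or_gt_of_ne huv with h | h
  · simp [h, h.not_gt]
    ring
  · simp [h, h.not_gt]
    ring

lemma det_submatrix_update_s8 (A : Matrix (Fin m) (Fin n) ℝ) (x : Fin k → Fin m)
    (p : Fin k → Fin n) (a : Fin k) (v : Fin m) :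
    (A.submatrix (Function.update x a v) p).det =
      ∑ j, (A.submatrix x p).adjugate j a * A v (p j) := by
  have h : A.submatrix (Function.update x a v) p =
      (A.submatrix x p).updateRow a (fun j => A v (p j)) := by
    ext i j
    by_cases hi : i = a
    · subst hi
      simp
    · simp [hi]
  rw [h, ← cramer_transpose_apply, cramer_eq_adjugate_mulVec, ← adjugate_transpose]
  rfl

/-- Exchanging rows in all possible ways between two minors gives the same sum of products as
exchanging columns in all possible ways. -/
lemma sum_det_exchange_rows_eq_columns (A : Matrix (Fin m) (Fin n) ℝ) (x y : Fin k → Fin m)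
    (p q : Fin k → Fin n) :
    ∑ a, ∑ b, (A.submatrix (Function.update x a (y b)) p).det *
        (A.submatrix (Function.update y b (x a)) q).det =
      ∑ a, ∑ b, (Aᵀ.submatrix (Function.update p a (q b)) x).det *
        (Aᵀ.submatrix (Function.update q b (p a)) y).det := by
  simp only [det_submatrix_update_s8, sum_mul_sum]
  simp only [← transpose_submatrix, ← adjugate_transpose, transpose_apply]
  calc _ = ∑ z : (Fin k × Fin k) × Fin k × Fin k,
      (A.submatrix x p).adjugate z.2.1 z.1.1 * A (y z.1.2) (p z.2.1) *
        ((A.submatrix y q).adjugate z.2.2 z.1.2 * A (x z.1.1) (q z.2.2)) := by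
        simp only [Fintype.sum_prod_type]
    _ = ∑ z : (Fin k × Fin k) × Fin k × Fin k,
      (A.submatrix x p).adjugate z.1.1 z.2.1 * A (x z.2.1) (q z.1.2) *
        ((A.submatrix y q).adjugate z.1.2 z.2.2 * A (y z.2.2) (p z.1.1)) := by
        refine Fintype.sum_equiv (Equiv.prodComm _ _) _ _ fun z => ?_
        simp only [Equiv.prodComm_apply, Prod.fst_swap, Prod.snd_swap]
        ring
    _ = _ := by simp only [Fintype.sum_prod_type]

lemma card_filter_lt_orderEmbOfFin (S : Finset (Fin n)) (hS : #S = k) (a : Fin k) :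
    #{w ∈ S | w < S.orderEmbOfFin hS a} = a := by
  have h : {w ∈ S | w < S.orderEmbOfFin hS a} =
      (univ.filter (· < a)).map (S.orderEmbOfFin hS).toEmbedding := by
    ext w
    simp only [mem_filter, mem_map, mem_univ, true_and, RelEmbedding.coe_toEmbedding]
    constructor
    · rintro ⟨hw, hlt⟩
      obtain ⟨b, rfl⟩ : w ∈ Set.range (S.orderEmbOfFin hS) := by simpa using hw
      exact ⟨b, (S.orderEmbOfFin hS).lt_iff_lt.1 hlt, rfl⟩
    · rintro ⟨b, hb, rfl⟩
      exact ⟨orderEmbOfFin_mem _ _ _, (S.orderEmbOfFin hS).lt_iff_lt.2 hb⟩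
  rw [h, card_map, ← Fin.card_Iio a]
  congr 1
  ext b
  simp

lemma det_submatrix_insertNth (A : Matrix (Fin m) (Fin n) ℝ) (p : Fin (k + 1) → Fin n)
    (a : Fin (k + 1)) (v : Fin m) (x : Fin k → Fin m) :
    (A.submatrix (Fin.insertNth a v x : Fin (k + 1) → Fin m) p).det =
      (-1) ^ (a : ℕ) * (A.submatrix (Fin.cons v x : Fin (k + 1) → Fin m) p).det := by
  have h := (detRowAlternating (R := ℝ) (n := Fin (k + 1))).map_insertNth a
    (fun j => A v (p j)) (fun i j => A (x i) (p j))
  have h1 : A.submatrix (Fin.insertNth a v x : Fin (k + 1) → Fin m) p =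
      (Fin.insertNth a (fun j => A v (p j)) (fun i j => A (x i) (p j)) :
        Fin (k + 1) → Fin (k + 1) → ℝ) := by
    ext i j
    refine Fin.succAboveCases a ?_ (fun i => ?_) i <;> simp
  have h2 : A.submatrix (Fin.cons v x : Fin (k + 1) → Fin m) p =
      (vecCons (fun j => A v (p j)) (fun i j => A (x i) (p j)) :
        Fin (k + 1) → Fin (k + 1) → ℝ) := by
    ext i j
    refine Fin.cases ?_ (fun i => ?_) i <;> simp
  rw [h1, h2]
  simpa [detRowAlternating] using! h

lemma removeNth_orderEmbOfFin (S : Finset (Fin m)) (hS : #S = k + 1) (a : Fin (k + 1))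
    (h : #(S.erase (S.orderEmbOfFin hS a)) = k) :
    (Fin.removeNth a (S.orderEmbOfFin hS) : Fin k → Fin m) =
      (S.erase (S.orderEmbOfFin hS a)).orderEmbOfFin h := by
  refine orderEmbOfFin_unique h (fun i => ?_) ?_
  · simp [Fin.removeNth]
  · exact (S.orderEmbOfFin hS).strictMono.comp (Fin.strictMono_succAbove a)

lemma det_submatrix_orderEmbOfFin_update (A : Matrix (Fin m) (Fin n) ℝ) (p : Fin k → Fin n)
    (S : Finset (Fin m)) (hS : #S = k) (a : Fin k) (v : Fin m) (hv : v ∉ S)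
    (hS' : #(symmDiff S {S.orderEmbOfFin hS a, v}) = k) :
    (A.submatrix (Function.update (S.orderEmbOfFin hS) a v) p).det =
      signBelow (S.erase (S.orderEmbOfFin hS a)) (S.orderEmbOfFin hS a) *
        signBelow (S.erase (S.orderEmbOfFin hS a)) v *
        (A.submatrix ((symmDiff S {S.orderEmbOfFin hS a, v}).orderEmbOfFin hS') p).det := by
  cases k with
  | zero => exact a.elim0
  | succ k =>
  set u := S.orderEmbOfFin hS a with hu
  have huS : u ∈ S := orderEmbOfFin_mem _ _ _
  have hcard : #(S.erase u) = k := by rw [card_erase_of_mem huS, hS]; rfl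
  have hS'eq := symmDiff_pair_eq_insert_erase_s8 huS hv
  have hvQ : v ∈ symmDiff S {u, v} := by rw [hS'eq]; simp
  have herase : (symmDiff S {u, v}).erase v = S.erase u := by
    rw [hS'eq, erase_insert]
    simp [hv]
  generalize symmDiff S {u, v} = Q at *
  obtain ⟨b, hb⟩ : ∃ b, Q.orderEmbOfFin hS' b = v := by
    have : v ∈ Set.range (Q.orderEmbOfFin hS') := by simpa using hvQ
    exact this
  have hlt : ∀ (R : Finset (Fin m)) (w : Fin m), {z ∈ R.erase w | z < w} = {z ∈ R | z < w} := by
    intro R w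
    ext z
    simp only [mem_filter, mem_erase]
    exact ⟨fun h => ⟨h.1.2, h.2⟩, fun h => ⟨⟨h.2.ne, h.1⟩, h.2⟩⟩
  have e1 : signBelow (S.erase u) u = (-1) ^ (a : ℕ) := by
    rw [signBelow, hlt, hu, card_filter_lt_orderEmbOfFin]
  have e2 : signBelow (S.erase u) v = (-1) ^ (b : ℕ) := by
    rw [signBelow, ← herase, hlt, ← hb, card_filter_lt_orderEmbOfFin]
  have e3 : (Q.orderEmbOfFin hS' : Fin (k + 1) → Fin m) =
      Fin.insertNth b v ((S.erase u).orderEmbOfFin hcard) := by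
    rw [← Fin.insertNth_self_removeNth b (Q.orderEmbOfFin hS'), removeNth_orderEmbOfFin Q hS' b
      (by rw [hb, herase, hcard])]
    congr 1
    simp only [hb, herase]
  rw [← Fin.insertNth_removeNth, removeNth_orderEmbOfFin S hS a hcard, det_submatrix_insertNth,
    e1, e2, e3, det_submatrix_insertNth]
  have h1 : ((-1 : ℝ) ^ (b : ℕ)) * (-1) ^ (b : ℕ) = 1 := by rw [← mul_pow]; norm_num
  linear_combination (-(-1) ^ (a : ℕ) * (A.submatrix
    (Fin.cons v ((S.erase u).orderEmbOfFin hcard) : Fin (k + 1) → Fin m) p).det) * h1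

lemma subdet_eq_det_s8 (A : Matrix (Fin m) (Fin n) ℝ) {S : Finset (Fin m)} {P : Finset (Fin n)}
    (hS : #S = k) (hP : #P = k) :
    subdet A S P = (A.submatrix (S.orderEmbOfFin hS) (P.orderEmbOfFin hP)).det := by
  subst hS
  rw [subdet, dif_pos hP.symm]

lemma subdet_transpose_s8 (A : Matrix (Fin m) (Fin n) ℝ) {S : Finset (Fin m)} {P : Finset (Fin n)}
    (hS : #S = k) (hP : #P = k) : subdet Aᵀ P S = subdet A S P := by
  rw [subdet_eq_det_s8 A hS hP, subdet_eq_det_s8 Aᵀ hP hS, ← transpose_submatrix, det_transpose]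

lemma card_symmDiff_pair_s8 {S : Finset (Fin n)} {u v : Fin n} (hu : u ∈ S) (hv : v ∉ S) :
    #(symmDiff S {u, v}) = #S := by
  rw [symmDiff_pair_eq_insert_erase_s8 hu hv, card_insert_of_notMem (by simp [hv]),
    card_erase_add_one hu]

/-- Sum over the signed exchanges of one row between two minors. -/
lemma sum_det_exchange_rows (A : Matrix (Fin m) (Fin n) ℝ) {S T : Finset (Fin m)}
    {P Q : Finset (Fin n)} (hS : #S = k) (hT : #T = k) (hP : #P = k) (hQ : #Q = k) :
    ∑ a, ∑ b, (A.submatrix (Function.update (S.orderEmbOfFin hS) a (T.orderEmbOfFin hT b))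
          (P.orderEmbOfFin hP)).det *
        (A.submatrix (Function.update (T.orderEmbOfFin hT) b (S.orderEmbOfFin hS a))
          (Q.orderEmbOfFin hQ)).det =
      #(S ∩ T) * (subdet A S P * subdet A T Q) -
      ∑ i ∈ S \ T, ∑ i' ∈ T \ S, signBelow (symmDiff S T) i * signBelow (symmDiff S T) i' *
        (subdet A (symmDiff S {i, i'}) P * subdet A (symmDiff T {i, i'}) Q) := by
  set G : Fin m → Fin m → ℝ := fun i i' =>
    (if i = i' then subdet A S P * subdet A T Q else 0) -
    if i ∉ T ∧ i' ∉ S then signBelow (symmDiff S T) i * signBelow (symmDiff S T) i' *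
        (subdet A (symmDiff S {i, i'}) P * subdet A (symmDiff T {i, i'}) Q) else 0 with hG
  have hterm : ∀ a b, (A.submatrix (Function.update (S.orderEmbOfFin hS) a
      (T.orderEmbOfFin hT b)) (P.orderEmbOfFin hP)).det *
        (A.submatrix (Function.update (T.orderEmbOfFin hT) b (S.orderEmbOfFin hS a))
          (Q.orderEmbOfFin hQ)).det = G (S.orderEmbOfFin hS a) (T.orderEmbOfFin hT b) := by
    intro a b
    have hi : S.orderEmbOfFin hS a ∈ S := orderEmbOfFin_mem _ _ _
    have hi' : T.orderEmbOfFin hT b ∈ T := orderEmbOfFin_mem _ _ _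
    by_cases heq : S.orderEmbOfFin hS a = T.orderEmbOfFin hT b
    · have h2 : ¬ (S.orderEmbOfFin hS a ∉ T ∧ T.orderEmbOfFin hT b ∉ S) := by
        rw [heq]
        tauto
      simp only [hG]
      rw [if_pos heq, if_neg h2, sub_zero, ← heq, Function.update_eq_self, heq,
        Function.update_eq_self, subdet_eq_det_s8 A hS hP, subdet_eq_det_s8 A hT hQ]
    · simp only [hG]
      rw [if_neg heq, zero_sub]
      split_ifs with h2
      · obtain ⟨hiT, hi'S⟩ := h2
        have c1 := (card_symmDiff_pair_s8 hi hi'S).trans hS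
        have c2 := (card_symmDiff_pair_s8 hi' hiT).trans hT
        rw [det_submatrix_orderEmbOfFin_update A _ S hS a _ hi'S c1,
          det_submatrix_orderEmbOfFin_update A _ T hT b _ hiT c2,
          ← subdet_eq_det_s8 A c1 hP, ← subdet_eq_det_s8 A c2 hQ,
          Finset.pair_comm (T.orderEmbOfFin hT b)]
        linear_combination (subdet A (symmDiff S {S.orderEmbOfFin hS a, T.orderEmbOfFin hT b}) P *
          subdet A (symmDiff T {S.orderEmbOfFin hS a, T.orderEmbOfFin hT b}) Q) *
          signBelow_erase_mul_erase hi hi' heq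
      · have hzero : ∀ (R : Finset (Fin m)) (hR : #R = k) (a : Fin k) (v : Fin m)
            (p : Fin k → Fin n), v ∈ R → R.orderEmbOfFin hR a ≠ v →
            (A.submatrix (Function.update (R.orderEmbOfFin hR) a v) p).det = 0 := by
          intro R hR a v p hv hne
          obtain ⟨b, rfl⟩ : v ∈ Set.range (R.orderEmbOfFin hR) := by simpa using hv
          have hab : a ≠ b := fun h => hne (by rw [h])
          refine det_zero_of_row_eq hab ?_
          ext j
          simp [Function.update_of_ne hab.symm]
        rw [neg_zero]
        by_cases hiT : S.orderEmbOfFin hS a ∈ T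
        · rw [hzero T hT b _ _ hiT (Ne.symm heq), mul_zero]
        · have hi'S : T.orderEmbOfFin hT b ∈ S := by tauto
          rw [hzero S hS a _ _ hi'S heq, zero_mul]
  have hsum : ∀ (R : Finset (Fin m)) (hR : #R = k) (F : Fin m → ℝ),
      ∑ a, F (R.orderEmbOfFin hR a) = ∑ i ∈ R, F i := by
    intro R hR F
    conv_rhs => rw [← map_orderEmbOfFin_univ R hR]
    rw [sum_map]
    rfl
  simp only [hterm, hsum T hT]
  rw [hsum S hS fun i => ∑ i' ∈ T, G i i']
  simp only [hG, sum_sub_distrib]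
  congr 1
  · simp only [sum_ite_eq]
    rw [← sum_filter, sum_const, nsmul_eq_mul, filter_mem_eq_inter]
  · rw [sdiff_eq_filter, sum_filter]
    refine sum_congr rfl fun i _ => ?_
    rw [sdiff_eq_filter, sum_filter]
    by_cases h : i ∈ T <;> simp [h]

/-- The signed sums over exchanges of one row and over exchanges of one column between two minors
differ by a multiple of the product of the minors. -/
lemma sum_subdet_exchange_rows_eq_columns (A : Matrix (Fin m) (Fin n) ℝ) {S T : Finset (Fin m)}
    {P Q : Finset (Fin n)} (hS : #S = k) (hT : #T = k) (hP : #P = k) (hQ : #Q = k) :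
    (∑ i ∈ S \ T, ∑ i' ∈ T \ S, signBelow (symmDiff S T) i * signBelow (symmDiff S T) i' *
        (subdet A (symmDiff S {i, i'}) P * subdet A (symmDiff T {i, i'}) Q)) -
        #(S ∩ T) * (subdet A S P * subdet A T Q) =
      (∑ j ∈ P \ Q, ∑ j' ∈ Q \ P, signBelow (symmDiff P Q) j * signBelow (symmDiff P Q) j' *
        (subdet A S (symmDiff P {j, j'}) * subdet A T (symmDiff Q {j, j'}))) -
        #(P ∩ Q) * (subdet A S P * subdet A T Q) := by
  have h := sum_det_exchange_rows_eq_columns A (S.orderEmbOfFin hS) (T.orderEmbOfFin hT)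
    (P.orderEmbOfFin hP) (Q.orderEmbOfFin hQ)
  rw [sum_det_exchange_rows A hS hT hP hQ, sum_det_exchange_rows Aᵀ hP hQ hS hT,
    subdet_transpose_s8 A hS hP, subdet_transpose_s8 A hT hQ] at h
  have h' : ∑ j ∈ P \ Q, ∑ j' ∈ Q \ P, signBelow (symmDiff P Q) j * signBelow (symmDiff P Q) j' *
        (subdet Aᵀ (symmDiff P {j, j'}) S * subdet Aᵀ (symmDiff Q {j, j'}) T) =
      ∑ j ∈ P \ Q, ∑ j' ∈ Q \ P, signBelow (symmDiff P Q) j * signBelow (symmDiff P Q) j' *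
        (subdet A S (symmDiff P {j, j'}) * subdet A T (symmDiff Q {j, j'})) := by
    refine sum_congr rfl fun j hj => sum_congr rfl fun j' hj' => ?_
    rw [mem_sdiff] at hj hj'
    rw [subdet_transpose_s8 A hS ((card_symmDiff_pair_s8 hj.1 hj'.2).trans hP),
      subdet_transpose_s8 A hT (by rw [Finset.pair_comm, card_symmDiff_pair_s8 hj'.1 hj.2, hQ])]
  linarith

end Exchange

section DoubleExchange

variable {n : ℕ}

lemma sum_sum_erase (B : Finset (Fin n)) (g : Fin n → ℝ) :
    ∑ j ∈ B, ∑ l ∈ B.erase j, g l = ((#B : ℝ) - 1) * ∑ j ∈ B, g j := by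
  have h : ∀ j ∈ B, ∑ l ∈ B.erase j, g l = ∑ l ∈ B, g l - g j := fun j hj =>
    sum_erase_eq_sub hj
  rw [sum_congr rfl h, sum_sub_distrib, sum_const, nsmul_eq_mul]
  ring

lemma sum_sum_erase_of_symm (B : Finset (Fin n)) (g : Fin n → Fin n → ℝ)
    (hg : ∀ j l, g j l = g l j) :
    ∑ j ∈ B, ∑ l ∈ B.erase j, g j l = 2 * ∑ j ∈ B, ∑ l ∈ B.filter (fun l => j < l), g j l := by
  have h : ∀ j ∈ B, ∑ l ∈ B.erase j, g j l =
      ∑ l ∈ B.filter (fun l => j < l), g j l + ∑ l ∈ B.filter (fun l => l < j), g j l := by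
    intro j _
    rw [← sum_union]
    · refine sum_congr ?_ fun _ _ => rfl
      ext l
      simp only [mem_erase, mem_union, mem_filter, ← and_or_left, ne_iff_lt_or_gt]
      tauto
    · rw [disjoint_filter]
      exact fun l _ h h' => lt_asymm h h'
  have h' : ∑ j ∈ B, ∑ l ∈ B.filter (fun l => l < j), g j l =
      ∑ j ∈ B, ∑ l ∈ B.filter (fun l => j < l), g j l := by
    rw [sum_comm' (t' := B) (s' := fun l => B.filter (fun j => l < j))]
    · exact sum_congr rfl fun l _ => sum_congr rfl fun j _ => hg j l
    · intro j l
      simp only [mem_filter]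
      tauto
  rw [sum_congr rfl h, sum_add_distrib, h']
  ring

/-- The effect of performing two successive signed exchanges between disjoint sets `B`, `B'`. -/
lemma sum_double_exchange_s8 {B B' : Finset (Fin n)} (hd : Disjoint B B') {τ : Fin n → ℝ}
    (hτ : ∀ i, τ i * τ i = 1) (Φ : Finset (Fin n) → ℝ) :
    ∑ j ∈ B, ∑ j' ∈ B', τ j * τ j' * ∑ l ∈ insert j' (B.erase j), ∑ l' ∈ insert j (B'.erase j'),
        τ l * τ l' * Φ (symmDiff {j, j'} {l, l'}) =
      #B * #B' * Φ ∅ + ((#B : ℝ) + #B' - 2) * (∑ j ∈ B, ∑ j' ∈ B', τ j * τ j' * Φ {j, j'}) +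
      4 * ∑ j ∈ B, ∑ l ∈ B.filter (fun l => j < l), ∑ j' ∈ B', ∑ l' ∈ B'.filter (fun l' => j' < l'),
        τ j * τ l * (τ j' * τ l') * Φ {j, l, j', l'} := by
  set ψ : Fin n → Fin n → Fin n → Fin n → ℝ := fun j l j' l' =>
    τ j * τ l * (τ j' * τ l') * Φ {j, l, j', l'} with hψ
  have hterm : ∀ j ∈ B, ∀ j' ∈ B', τ j * τ j' * ∑ l ∈ insert j' (B.erase j),
      ∑ l' ∈ insert j (B'.erase j'), τ l * τ l' * Φ (symmDiff {j, j'} {l, l'}) =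
      Φ ∅ + ∑ l ∈ B.erase j, τ l * τ j' * Φ {l, j'} +
        ∑ l' ∈ B'.erase j', τ j * τ l' * Φ {j, l'} +
        ∑ l ∈ B.erase j, ∑ l' ∈ B'.erase j', ψ j l j' l' := by
    intro j hj j' hj'
    have hne : ∀ {x y}, x ∈ B → y ∈ B' → x ≠ y := fun hx hy => disjoint_iff_ne.1 hd _ hx _ hy
    have hj'B : j' ∉ B.erase j := fun h => hne (mem_of_mem_erase h) hj' rfl
    have hjB' : j ∉ B'.erase j' := fun h => hne hj (mem_of_mem_erase h) rfl
    have e1 : τ j * τ j' * (τ j' * τ j * Φ (symmDiff {j, j'} {j', j})) = Φ ∅ := by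
      rw [Finset.pair_comm j' j, symmDiff_self, bot_eq_empty]
      linear_combination (τ j * τ j * Φ ∅) * hτ j' + Φ ∅ * hτ j
    have e2 : ∀ l' ∈ B'.erase j', τ j * τ j' * (τ j' * τ l' * Φ (symmDiff {j, j'} {j', l'})) =
        τ j * τ l' * Φ {j, l'} := by
      intro l' hl'
      rw [mem_erase] at hl'
      have : symmDiff ({j, j'} : Finset (Fin n)) {j', l'} = {j, l'} := by
        have h1 := hne hj hj'
        have h2 := hne hj hl'.2
        have h3 := hl'.1
        ext x
        simp only [mem_symmDiff, mem_insert, mem_singleton]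
        grind
      rw [this]
      linear_combination (τ j * τ l' * Φ {j, l'}) * hτ j'
    have e3 : ∀ l ∈ B.erase j, τ j * τ j' * (τ l * τ j * Φ (symmDiff {j, j'} {l, j})) =
        τ l * τ j' * Φ {l, j'} := by
      intro l hl
      rw [mem_erase] at hl
      have : symmDiff ({j, j'} : Finset (Fin n)) {l, j} = {l, j'} := by
        have h1 := hne hj hj'
        have h2 := hne hl.2 hj'
        have h3 := hl.1
        ext x
        simp only [mem_symmDiff, mem_insert, mem_singleton]
        grind
      rw [this]
      linear_combination (τ l * τ j' * Φ {l, j'}) * hτ j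
    have e4 : ∀ l ∈ B.erase j, ∀ l' ∈ B'.erase j',
        τ j * τ j' * (τ l * τ l' * Φ (symmDiff {j, j'} {l, l'})) = ψ j l j' l' := by
      intro l hl l' hl'
      rw [mem_erase] at hl hl'
      have : symmDiff ({j, j'} : Finset (Fin n)) {l, l'} = {j, l, j', l'} := by
        have h1 := hne hj hj'
        have h2 := hne hl.2 hj'
        have h3 := hl.1
        have h4 := hne hj hl'.2
        have h5 := hne hl.2 hl'.2
        have h6 := hl'.1
        ext x
        simp only [mem_symmDiff, mem_insert, mem_singleton]
        grind
      rw [this, hψ]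
      ring
    rw [sum_insert hj'B, sum_insert hjB', mul_add, mul_add, e1, mul_sum, sum_congr rfl e2, mul_sum]
    have e5 : ∀ l ∈ B.erase j, τ j * τ j' * ∑ l' ∈ insert j (B'.erase j'),
        τ l * τ l' * Φ (symmDiff {j, j'} {l, l'}) =
        τ l * τ j' * Φ {l, j'} + ∑ l' ∈ B'.erase j', ψ j l j' l' := by
      intro l hl
      rw [sum_insert hjB', mul_add, e3 l hl, mul_sum, sum_congr rfl (e4 l hl)]
    rw [sum_congr rfl e5, sum_add_distrib]
    ring
  rw [sum_congr rfl fun j hj => sum_congr rfl (hterm j hj)]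
  simp only [sum_add_distrib]
  have f1 : ∑ j ∈ B, ∑ j' ∈ B', ∑ l ∈ B.erase j, τ l * τ j' * Φ {l, j'} =
      ((#B : ℝ) - 1) * ∑ j ∈ B, ∑ j' ∈ B', τ j * τ j' * Φ {j, j'} := by
    rw [← sum_sum_erase]
    exact sum_congr rfl fun j _ => sum_comm
  have f2 : ∑ j ∈ B, ∑ j' ∈ B', ∑ l' ∈ B'.erase j', τ j * τ l' * Φ {j, l'} =
      ((#B' : ℝ) - 1) * ∑ j ∈ B, ∑ j' ∈ B', τ j * τ j' * Φ {j, j'} := by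
    rw [mul_sum]
    exact sum_congr rfl fun j _ => sum_sum_erase B' fun l' => τ j * τ l' * Φ {j, l'}
  have f3 : ∑ j ∈ B, ∑ j' ∈ B', ∑ l ∈ B.erase j, ∑ l' ∈ B'.erase j', ψ j l j' l' =
      4 * ∑ j ∈ B, ∑ l ∈ B.filter (fun l => j < l), ∑ j' ∈ B',
        ∑ l' ∈ B'.filter (fun l' => j' < l'), ψ j l j' l' := by
    have hs1 : ∀ j l j' l', ψ j l j' l' = ψ l j j' l' := by
      intro j l j' l'
      simp only [hψ]
      rw [Finset.insert_comm j l]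
      ring
    have hs2 : ∀ j l j' l', ψ j l j' l' = ψ j l l' j' := by
      intro j l j' l'
      simp only [hψ]
      rw [Finset.pair_comm j' l']
      ring
    calc _ = ∑ j ∈ B, ∑ l ∈ B.erase j, ∑ j' ∈ B', ∑ l' ∈ B'.erase j', ψ j l j' l' :=
          sum_congr rfl fun j _ => sum_comm
      _ = ∑ j ∈ B, ∑ l ∈ B.erase j,
          2 * ∑ j' ∈ B', ∑ l' ∈ B'.filter (fun l' => j' < l'), ψ j l j' l' :=
          sum_congr rfl fun j _ => sum_congr rfl fun l _ =>
            sum_sum_erase_of_symm B' (ψ j l) (hs2 j l)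
      _ = _ := by
          rw [sum_sum_erase_of_symm]
          · simp only [← mul_sum]
            ring
          · intro j l
            simp only [hs1 j l]
  rw [f1, f2, f3]
  simp only [sum_const, nsmul_eq_mul]
  ring

end DoubleExchange

section Intervals

lemma neg_one_pow_eq_of_mod_two_eq {a b : ℕ} (h : a % 2 = b % 2) : (-1 : ℝ) ^ a = (-1) ^ b := by
  rw [neg_one_pow_eq_pow_mod_two, h, ← neg_one_pow_eq_pow_mod_two]

lemma card_filter_val_lt {n t : ℕ} (ht : t ≤ n) : #{x : Fin n | (x : ℕ) < t} = t := by
  rw [Fin.card_filter_val_lt, min_eq_right ht]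

lemma signBelow_filter_val_lt {n : ℕ} (t : ℕ) (i : Fin n) :
    signBelow {x : Fin n | (x : ℕ) < t} i = (-1) ^ min t (i : ℕ) := by
  rw [signBelow, filter_filter]
  congr 1
  rw [← card_filter_val_lt (n := n) (t := min t (i : ℕ)) (by omega)]
  congr 1
  ext x
  simp only [mem_filter, mem_univ, true_and, Fin.lt_def, lt_min_iff]

variable {k c : ℕ} {S T B B' : Finset (Fin (2 * k))}

lemma signBelow_mul_signBelow (hS : ∀ x, x ∈ S ↔ (x : ℕ) < k)
    (hT : ∀ x, x ∈ T ↔ ((x : ℕ) < c ∨ k + c ≤ (x : ℕ))) {i i' : Fin (2 * k)}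
    (hci : c ≤ (i : ℕ)) (hik : (i : ℕ) < k) (hi' : k + c ≤ (i' : ℕ)) :
    signBelow (symmDiff S T) i * signBelow (symmDiff S T) i' =
      (-1) ^ ((i : ℕ) + (i' : ℕ) + c) := by
  have h : symmDiff S T = symmDiff (univ.filter fun x : Fin (2 * k) => (x : ℕ) < k)
      (symmDiff (univ.filter fun x : Fin (2 * k) => (x : ℕ) < c)
        (symmDiff (univ.filter fun x : Fin (2 * k) => (x : ℕ) < k + c)
          (univ.filter fun x : Fin (2 * k) => (x : ℕ) < 2 * k))) := by
    ext x
    have := x.isLt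
    simp only [mem_symmDiff, hS, hT, mem_filter, mem_univ, true_and]
    omega
  rw [h]
  simp only [signBelow_symmDiff, signBelow_filter_val_lt, ← pow_add]
  apply neg_one_pow_eq_of_mod_two_eq
  omega

lemma card_eq_of_mem_iff_lt (hS : ∀ x, x ∈ S ↔ (x : ℕ) < k) : #S = k := by
  refine Eq.trans ?_ (card_filter_val_lt (n := 2 * k) (t := k) (by omega))
  congr 1
  ext x
  simp [hS]

lemma card_inter_of_mem_iff (hc : c ≤ k) (hS : ∀ x, x ∈ S ↔ (x : ℕ) < k)
    (hT : ∀ x, x ∈ T ↔ ((x : ℕ) < c ∨ k + c ≤ (x : ℕ))) : #(S ∩ T) = c := by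
  rw [← card_filter_val_lt (n := 2 * k) (t := c) (by omega)]
  congr 1
  ext x
  simp only [mem_inter, hS, hT, mem_filter, mem_univ, true_and]
  omega

lemma card_eq_of_mem_iff_lt_or_le (hc : c ≤ k)
    (hT : ∀ x, x ∈ T ↔ ((x : ℕ) < c ∨ k + c ≤ (x : ℕ))) : #T = k := by
  have h : Tᶜ = (univ.filter fun x : Fin (2 * k) => (x : ℕ) < k + c) \
      univ.filter fun x : Fin (2 * k) => (x : ℕ) < c := by
    ext x
    simp only [mem_compl, mem_sdiff, hT, mem_filter, mem_univ, true_and]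
    omega
  have h1 := card_compl_add_card T
  rw [h, card_sdiff_of_subset, card_filter_val_lt (by omega), card_filter_val_lt (by omega),
    Fintype.card_fin] at h1
  · omega
  · intro x
    simp only [mem_filter, mem_univ, true_and]
    omega

lemma sdiff_eq_of_mem_iff (hS : ∀ x, x ∈ S ↔ (x : ℕ) < k)
    (hT : ∀ x, x ∈ T ↔ ((x : ℕ) < c ∨ k + c ≤ (x : ℕ)))
    (hB : ∀ x, x ∈ B ↔ (c ≤ (x : ℕ) ∧ (x : ℕ) < k)) : S \ T = B := by
  ext x
  simp only [mem_sdiff, hS, hT, hB]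
  omega

lemma sdiff_eq_of_mem_iff' (hc : c ≤ k) (hS : ∀ x, x ∈ S ↔ (x : ℕ) < k)
    (hT : ∀ x, x ∈ T ↔ ((x : ℕ) < c ∨ k + c ≤ (x : ℕ)))
    (hB' : ∀ x, x ∈ B' ↔ k + c ≤ (x : ℕ)) : T \ S = B' := by
  ext x
  simp only [mem_sdiff, hS, hT, hB']
  omega

end Intervals

/-- **Extended Plücker relation, general case** (Lemma 5.4, second equation). Setup as in
the first equation (0-based indexing by `Fin (2k)` preserves all sign parities). Then
`(k² − 2(k−1)c + 4·C(c,2) − rc)·[S_R,S_C]·[T_R,T_C] = s₁ − c·s₂ − (2(k−1)+r−4c)·ŝ₂ − 4·ŝ₃`. -/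
theorem extended_plucker_general_second {k : ℕ} (hk : 1 ≤ k) (r c : ℕ) (hr : r ≤ k) (hc : c ≤ k)
    (A : Matrix (Fin (2 * k)) (Fin (2 * k)) ℝ)
    (SR TR TC RS RT CS CT : Finset (Fin (2 * k)))
    (hSR : ∀ x, x ∈ SR ↔ (x : ℕ) < k)
    (hTR : ∀ x, x ∈ TR ↔ ((x : ℕ) < r ∨ k + r ≤ (x : ℕ)))
    (hTC : ∀ x, x ∈ TC ↔ ((x : ℕ) < c ∨ k + c ≤ (x : ℕ)))
    (hRS : ∀ x, x ∈ RS ↔ (r ≤ (x : ℕ) ∧ (x : ℕ) < k))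
    (hRT : ∀ x, x ∈ RT ↔ k + r ≤ (x : ℕ))
    (hCS : ∀ x, x ∈ CS ↔ (c ≤ (x : ℕ) ∧ (x : ℕ) < k))
    (hCT : ∀ x, x ∈ CT ↔ k + c ≤ (x : ℕ))
    (s1 s2 s2h s3 s3h : ℝ)
    (hs1 : s1 = (-1 : ℝ) ^ (r + c) * ∑ i ∈ RS, ∑ j ∈ CS, ∑ i' ∈ RT, ∑ j' ∈ CT,
      (-1 : ℝ) ^ ((i : ℕ) + (j : ℕ) + (i' : ℕ) + (j' : ℕ)) *
        (subdet A (symmDiff SR {i, i'}) (symmDiff SR {j, j'}) *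
          subdet A (symmDiff TR {i, i'}) (symmDiff TC {j, j'})))
    (hs2 : s2 = (-1 : ℝ) ^ (k - r) * ∑ i ∈ RS, ∑ i' ∈ RT,
      (-1 : ℝ) ^ ((i : ℕ) + (i' : ℕ) + k) *
        (subdet A (symmDiff SR {i, i'}) SR * subdet A (symmDiff TR {i, i'}) TC))
    (hs2h : s2h = (-1 : ℝ) ^ (k - c) * ∑ j ∈ CS, ∑ j' ∈ CT,
      (-1 : ℝ) ^ ((j : ℕ) + (j' : ℕ) + k) *
        (subdet A SR (symmDiff SR {j, j'}) * subdet A TR (symmDiff TC {j, j'})))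
    (hs3 : s3 = ∑ i ∈ RS, ∑ h ∈ RS.filter (fun h => i < h),
        ∑ i' ∈ RT, ∑ h' ∈ RT.filter (fun h' => i' < h'),
      (-1 : ℝ) ^ ((i : ℕ) + (h : ℕ) + (i' : ℕ) + (h' : ℕ)) *
        (subdet A (symmDiff SR {i, h, i', h'}) SR *
          subdet A (symmDiff TR {i, h, i', h'}) TC))
    (hs3h : s3h = ∑ j ∈ CS, ∑ l ∈ CS.filter (fun l => j < l),
        ∑ j' ∈ CT, ∑ l' ∈ CT.filter (fun l' => j' < l'),
      (-1 : ℝ) ^ ((j : ℕ) + (l : ℕ) + (j' : ℕ) + (l' : ℕ)) *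
        (subdet A SR (symmDiff SR {j, l, j', l'}) *
          subdet A TR (symmDiff TC {j, l, j', l'}))) :
    ((k : ℝ) ^ 2 - 2 * ((k : ℝ) - 1) * c + 4 * ((c : ℝ) * ((c : ℝ) - 1) / 2) - (r : ℝ) * c) *
        (subdet A SR SR * subdet A TR TC) =
      s1 - (c : ℝ) * s2 - (2 * ((k : ℝ) - 1) + (r : ℝ) - 4 * c) * s2h - 4 * s3h := by
  have cS : #SR = k := card_eq_of_mem_iff_lt hSR
  have cTR : #TR = k := card_eq_of_mem_iff_lt_or_le hr hTR
  have cTC : #TC = k := card_eq_of_mem_iff_lt_or_le hc hTC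
  have cIR : #(SR ∩ TR) = r := card_inter_of_mem_iff hr hSR hTR
  have cIC : #(SR ∩ TC) = c := card_inter_of_mem_iff hc hSR hTC
  have dRS : SR \ TR = RS := sdiff_eq_of_mem_iff hSR hTR hRS
  have dRT : TR \ SR = RT := sdiff_eq_of_mem_iff' hr hSR hTR hRT
  have dCS : SR \ TC = CS := sdiff_eq_of_mem_iff hSR hTC hCS
  have dCT : TC \ SR = CT := sdiff_eq_of_mem_iff' hc hSR hTC hCT
  have cCS : (#CS : ℝ) = k - c := by
    have := card_sdiff_add_card_inter SR TC
    rw [dCS, cIC, cS] at this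
    rw [eq_sub_iff_add_eq]
    exact_mod_cast this
  have cCT : (#CT : ℝ) = k - c := by
    have := card_sdiff_add_card_inter TC SR
    rw [dCT, inter_comm, cIC, cTC] at this
    rw [eq_sub_iff_add_eq]
    exact_mod_cast this
  set τR := signBelow (symmDiff SR TR)
  set τC := signBelow (symmDiff SR TC)
  have tR : ∀ i ∈ RS, ∀ i' ∈ RT, τR i * τR i' = (-1) ^ ((i : ℕ) + (i' : ℕ) + r) :=
    fun i hi i' hi' =>
      signBelow_mul_signBelow hSR hTR ((hRS i).1 hi).1 ((hRS i).1 hi).2 ((hRT i').1 hi')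
  have tC : ∀ j ∈ CS, ∀ j' ∈ CT, τC j * τC j' = (-1) ^ ((j : ℕ) + (j' : ℕ) + c) :=
    fun j hj j' hj' =>
      signBelow_mul_signBelow hSR hTC ((hCS j).1 hj).1 ((hCS j).1 hj).2 ((hCT j').1 hj')
  have hs2' : s2 = ∑ i ∈ RS, ∑ i' ∈ RT, τR i * τR i' *
      (subdet A (symmDiff SR {i, i'}) SR * subdet A (symmDiff TR {i, i'}) TC) := by
    rw [hs2, mul_sum]
    refine sum_congr rfl fun i hi => ?_
    rw [mul_sum]
    refine sum_congr rfl fun i' hi' => ?_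
    rw [tR i hi i' hi', ← mul_assoc, ← pow_add]
    congr 1
    apply neg_one_pow_eq_of_mod_two_eq
    omega
  have hs2h' : s2h = ∑ j ∈ CS, ∑ j' ∈ CT, τC j * τC j' *
      (subdet A SR (symmDiff SR {j, j'}) * subdet A TR (symmDiff TC {j, j'})) := by
    rw [hs2h, mul_sum]
    refine sum_congr rfl fun j hj => ?_
    rw [mul_sum]
    refine sum_congr rfl fun j' hj' => ?_
    rw [tC j hj j' hj', ← mul_assoc, ← pow_add]
    congr 1
    apply neg_one_pow_eq_of_mod_two_eq
    omega
  have hs1' : s1 = ∑ j ∈ CS, ∑ j' ∈ CT, τC j * τC j' * ∑ i ∈ RS, ∑ i' ∈ RT, τR i * τR i' *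
      (subdet A (symmDiff SR {i, i'}) (symmDiff SR {j, j'}) *
        subdet A (symmDiff TR {i, i'}) (symmDiff TC {j, j'})) := by
    rw [hs1, sum_comm, mul_sum]
    refine sum_congr rfl fun j hj => ?_
    rw [sum_congr rfl fun i _ => sum_comm, sum_comm, mul_sum]
    refine sum_congr rfl fun j' hj' => ?_
    simp only [mul_sum]
    refine sum_congr rfl fun i hi => sum_congr rfl fun i' hi' => ?_
    rw [tR i hi i' hi', tC j hj j' hj', ← mul_assoc, ← pow_add,
      ← mul_assoc ((-1 : ℝ) ^ ((j : ℕ) + (j' : ℕ) + c)), ← pow_add]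
    congr 1
    apply neg_one_pow_eq_of_mod_two_eq
    omega
  have hs3h' : s3h = ∑ j ∈ CS, ∑ l ∈ CS.filter (fun l => j < l),
        ∑ j' ∈ CT, ∑ l' ∈ CT.filter (fun l' => j' < l'), τC j * τC l * (τC j' * τC l') *
        (subdet A SR (symmDiff SR {j, l, j', l'}) *
          subdet A TR (symmDiff TC {j, l, j', l'})) := by
    rw [hs3h]
    refine sum_congr rfl fun j hj => sum_congr rfl fun l hl => sum_congr rfl fun j' hj' =>
      sum_congr rfl fun l' hl' => ?_
    rw [mul_mul_mul_comm (τC j), tC j hj j' hj', tC l (mem_filter.1 hl).1 l' (mem_filter.1 hl').1,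
      ← pow_add]
    congr 1
    apply neg_one_pow_eq_of_mod_two_eq
    omega
  have single : s2 - r * (subdet A SR SR * subdet A TR TC) =
      s2h - c * (subdet A SR SR * subdet A TR TC) := by
    have h := sum_subdet_exchange_rows_eq_columns A cS cTR cS cTC
    rw [dRS, dRT, dCS, dCT, cIR, cIC] at h
    rw [hs2', hs2h']
    exact h
  have hdisj : Disjoint CS CT := by
    rw [← dCS, ← dCT]
    exact disjoint_sdiff_sdiff
  have pointwise : ∀ j ∈ CS, ∀ j' ∈ CT,
      (∑ i ∈ RS, ∑ i' ∈ RT, τR i * τR i' *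
        (subdet A (symmDiff SR {i, i'}) (symmDiff SR {j, j'}) *
          subdet A (symmDiff TR {i, i'}) (symmDiff TC {j, j'}))) =
      (∑ l ∈ insert j' (CS.erase j), ∑ l' ∈ insert j (CT.erase j'), τC l * τC l' *
        (subdet A SR (symmDiff SR (symmDiff {j, j'} {l, l'})) *
          subdet A TR (symmDiff TC (symmDiff {j, j'} {l, l'})))) +
      ((r : ℝ) - c) * (subdet A SR (symmDiff SR {j, j'}) * subdet A TR (symmDiff TC {j, j'})) := by
    intro j hj j' hj'
    have hj1 : j ∈ SR ∧ j ∉ TC := by rwa [← dCS, mem_sdiff] at hj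
    have hj2 : j' ∈ TC ∧ j' ∉ SR := by rwa [← dCT, mem_sdiff] at hj'
    have c1 : #(symmDiff SR {j, j'}) = k := (card_symmDiff_pair_s8 hj1.1 hj2.2).trans cS
    have c2 : #(symmDiff TC {j, j'}) = k := by
      rw [Finset.pair_comm, card_symmDiff_pair_s8 hj2.1 hj1.2, cTC]
    have hne : j ≠ j' := fun h => hj1.2 (h ▸ hj2.1)
    have d1 : symmDiff SR {j, j'} \ symmDiff TC {j, j'} = insert j' (CS.erase j) := by
      rw [← dCS]
      ext x
      simp only [mem_symmDiff, mem_sdiff, mem_insert, mem_singleton, mem_erase]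
      grind
    have d2 : symmDiff TC {j, j'} \ symmDiff SR {j, j'} = insert j (CT.erase j') := by
      rw [← dCT]
      ext x
      simp only [mem_symmDiff, mem_sdiff, mem_insert, mem_singleton, mem_erase]
      grind
    have d3 : symmDiff SR {j, j'} ∩ symmDiff TC {j, j'} = SR ∩ TC := by
      ext x
      simp only [mem_symmDiff, mem_inter, mem_insert, mem_singleton]
      grind
    have d4 : symmDiff (symmDiff SR {j, j'}) (symmDiff TC {j, j'}) = symmDiff SR TC := by
      rw [symmDiff_symmDiff_symmDiff_comm, symmDiff_self, symmDiff_bot]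
    have h := sum_subdet_exchange_rows_eq_columns A cS cTR c1 c2
    rw [d1, d2, d3, d4, dRS, dRT, cIR, cIC] at h
    simp only [symmDiff_assoc] at h
    linear_combination h
  have double := sum_double_exchange_s8 hdisj (τ := τC) (signBelow_mul_self _)
    (fun I => subdet A SR (symmDiff SR I) * subdet A TR (symmDiff TC I))
  rw [← hs2h', ← hs3h', cCS, cCT, ← bot_eq_empty, symmDiff_bot, symmDiff_bot] at double
  have total : s1 = (∑ j ∈ CS, ∑ j' ∈ CT, τC j * τC j' *
      ∑ l ∈ insert j' (CS.erase j), ∑ l' ∈ insert j (CT.erase j'), τC l * τC l' *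
        (subdet A SR (symmDiff SR (symmDiff {j, j'} {l, l'})) *
          subdet A TR (symmDiff TC (symmDiff {j, j'} {l, l'})))) + ((r : ℝ) - c) * s2h := by
    rw [hs1', hs2h', mul_sum, ← sum_add_distrib]
    refine sum_congr rfl fun j hj => ?_
    rw [mul_sum, ← sum_add_distrib]
    refine sum_congr rfl fun j' hj' => ?_
    rw [pointwise j hj j' hj']
    ring
  rw [double] at total
  linear_combination (-1 : ℝ) * total + c * single
end
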